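/- arXiv:1301.4853 — 5 statements merged into one kernel-verified Lean document; each statement's English description precedes it below -/
import Mathlib

section
/- There exists a constant c > 0 such that for every finite set A ⊆ ℂ with |A| ≥ 2, the set g(A) = {(a − b)/(a − c) : a, b, c ∈ A, a ≠ c} satisfies |g(A)| ≥ c·|A|² / log|A|. -/
open Finset in
lemma oct_real {a b c d : ℝ} (hb : 0 ≤ b) (hba : b ≤ a) (hd : 0 ≤ d) (hdc : d ≤ c)
    (ha : 0 < a) (hc : 0 < c) (h1 : 2 * (a * c + b * d) ≤ c ^ 2 + d ^ 2)
    (h2 : 2 * (a * c + b * d) ≤ a ^ 2 + b ^ 2) : False := by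
  have hac : 0 < a * c := mul_pos ha hc
  have hbd : 0 ≤ b * d := mul_nonneg hb hd
  have h3 : (2 * (a * c + b * d)) * (2 * (a * c + b * d)) ≤ (c ^ 2 + d ^ 2) * (a ^ 2 + b ^ 2) :=
    mul_le_mul h1 h2 (by positivity) (by positivity)
  have h4 : 0 ≤ a * d := by positivity
  have h5 : 0 ≤ b * c := by positivity
  have h6 : a * d ≤ a * c := by gcongr
  have h7 : b * c ≤ a * c := by gcongr
  have h8 : (a * d - b * c) ^ 2 ≤ (a * c) ^ 2 := sq_le_sq' (by linarith) (by linarith)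
  nlinarith

lemma oct_complex {z w : ℂ} (hz : z ≠ 0) (hw : w ≠ 0)
    (hre : 0 ≤ z.re ↔ 0 ≤ w.re) (him : 0 ≤ z.im ↔ 0 ≤ w.im)
    (hab : |z.re| ≤ |z.im| ↔ |w.re| ≤ |w.im|)
    (h1 : ‖z‖ ≤ ‖z - w‖) (h2 : ‖w‖ ≤ ‖z - w‖) : False := by
  have e1 : |z.re| * |w.re| = z.re * w.re := by
    rw [← abs_mul, abs_of_nonneg]
    by_cases h : 0 ≤ z.re
    · exact mul_nonneg h (hre.1 h)
    · have h' : ¬ 0 ≤ w.re := fun q => h (hre.2 q)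
      exact mul_nonneg_of_nonpos_of_nonpos (by linarith) (by linarith)
  have e2 : |z.im| * |w.im| = z.im * w.im := by
    rw [← abs_mul, abs_of_nonneg]
    by_cases h : 0 ≤ z.im
    · exact mul_nonneg h (him.1 h)
    · have h' : ¬ 0 ≤ w.im := fun q => h (him.2 q)
      exact mul_nonneg_of_nonpos_of_nonpos (by linarith) (by linarith)
  have n1 : ‖z‖ ^ 2 ≤ ‖z - w‖ ^ 2 := by gcongr
  have n2 : ‖w‖ ^ 2 ≤ ‖z - w‖ ^ 2 := by gcongr
  rw [Complex.sq_norm, Complex.sq_norm, Complex.normSq_apply, Complex.normSq_apply] at n1 n2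
  simp only [Complex.sub_re, Complex.sub_im] at n1 n2
  have s1 := sq_abs z.re
  have s2 := sq_abs z.im
  have s3 := sq_abs w.re
  have s4 := sq_abs w.im
  by_cases h : |z.re| ≤ |z.im|
  · have h' := hab.1 h
    refine oct_real (abs_nonneg z.re) h (abs_nonneg w.re) h' ?_ ?_ ?_ ?_
    · by_contra hc
      have i0 : |z.im| = 0 := le_antisymm (not_lt.1 hc) (abs_nonneg _)
      have r0 : |z.re| = 0 := le_antisymm (i0 ▸ h) (abs_nonneg _)
      exact hz (Complex.ext (abs_eq_zero.1 r0) (abs_eq_zero.1 i0))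
    · by_contra hc
      have i0 : |w.im| = 0 := le_antisymm (not_lt.1 hc) (abs_nonneg _)
      have r0 : |w.re| = 0 := le_antisymm (i0 ▸ h') (abs_nonneg _)
      exact hw (Complex.ext (abs_eq_zero.1 r0) (abs_eq_zero.1 i0))
    · nlinarith
    · nlinarith
  · have h' : ¬ |w.re| ≤ |w.im| := fun q => h (hab.2 q)
    rw [not_le] at h h'
    refine oct_real (abs_nonneg z.im) h.le (abs_nonneg w.im) h'.le ?_ ?_ ?_ ?_
    · exact lt_of_le_of_lt (abs_nonneg _) h
    · exact lt_of_le_of_lt (abs_nonneg _) h'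
    · nlinarith
    · nlinarith

open Finset in
open Classical in
/-- bounded overlap of nearest neighbour discs -/
lemma overlap_pt (S : Finset ℂ) (φ : ℂ → ℂ) (r : ℂ → ℝ) (hinj : Set.InjOn φ S)
    (hr : ∀ x ∈ S, ∀ y ∈ S, x ≠ y → r x ≤ ‖φ x - φ y‖) (p : ℂ) :
    (S.filter fun x => ‖p - φ x‖ ≤ r x).card ≤ 9 := by
  set B := S.filter fun x => ‖p - φ x‖ ≤ r x with hB
  have hsub : B.card ≤ (B.filter fun x => φ x = p).card + (B.filter fun x => ¬ φ x = p).card := by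
    rw [card_filter_add_card_filter_not]
  have h1 : (B.filter fun x => φ x = p).card ≤ 1 := by
    rw [card_le_one]
    intro x hx y hy
    simp only [hB, mem_filter] at hx hy
    exact hinj hx.1.1 hy.1.1 (hx.2.trans hy.2.symm)
  have h8 : (B.filter fun x => ¬ φ x = p).card ≤ 8 := by
    let code : ℂ → Bool × Bool × Bool := fun x =>
      (decide (0 ≤ (φ x - p).re), decide (0 ≤ (φ x - p).im), decide (|(φ x - p).re| ≤ |(φ x - p).im|))
    have : (B.filter fun x => ¬ φ x = p).card ≤ (Finset.univ : Finset (Bool × Bool × Bool)).card := by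
      apply card_le_card_of_injOn code (fun _ _ => by simp)
      intro x hx y hy hxy
      simp only [hB, coe_filter, mem_filter, Set.mem_ofPred_eq] at hx hy
      simp only [code, Prod.mk.injEq, decide_eq_decide] at hxy
      by_contra hne
      refine oct_complex (sub_ne_zero.2 hx.2) (sub_ne_zero.2 hy.2) hxy.1 hxy.2.1 hxy.2.2 ?_ ?_
      · have := hr x hx.1.1 y hy.1.1 hne
        rw [sub_sub_sub_cancel_right, norm_sub_rev]
        exact hx.1.2.trans this
      · have := hr y hy.1.1 x hx.1.1 (Ne.symm hne)
        rw [sub_sub_sub_cancel_right, norm_sub_rev, norm_sub_rev (φ x)]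
        exact hy.1.2.trans this
    simpa using this
  omega

open Finset in
open Classical in
lemma overlap_sum (A S : Finset ℂ) (φ : ℂ → ℂ) (r : ℂ → ℝ) (hinj : Set.InjOn φ S)
    (hr : ∀ x ∈ S, ∀ y ∈ S, x ≠ y → r x ≤ ‖φ x - φ y‖) :
    ∑ x ∈ S, (A.filter fun p => ‖p - φ x‖ ≤ r x).card ≤ 9 * A.card := by
  have := sum_card_bipartiteAbove_eq_sum_card_bipartiteBelow (s := S) (t := A)
    (fun x p => ‖p - φ x‖ ≤ r x)
  simp only [bipartiteAbove, bipartiteBelow] at this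
  rw [this, mul_comm]
  exact sum_le_card_nsmul _ _ _ fun p _ => overlap_pt S φ r hinj hr p

open Classical in
/-- number of points of `A` in the closed disc centred `x` through `y` -/
noncomputable def rk (A : Finset ℂ) (x y : ℂ) : ℕ := (A.filter fun p => ‖p - x‖ ≤ ‖y - x‖).card

open Classical in
noncomputable def closePairs (A : Finset ℂ) (j : ℕ) : Finset (ℂ × ℂ) :=
  (A ×ˢ A).filter fun q => rk A q.1 q.2 ≤ j

open Finset in
open Classical in
lemma closePairs_card (A : Finset ℂ) (j : ℕ) : (closePairs A j).card ≤ A.card * j := by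
  have h : (closePairs A j).card = ∑ x ∈ A, (A.filter fun y => rk A x y ≤ j).card := by
    rw [closePairs, card_filter, sum_product]
    simp only [card_filter]
  rw [h]
  refine sum_le_card_nsmul _ _ _ fun x _ => ?_
  rcases (A.filter fun y => rk A x y ≤ j).eq_empty_or_nonempty with h0 | hne
  · simp [h0]
  · obtain ⟨y, hy, hmax⟩ := exists_max_image _ (fun y => ‖y - x‖) hne
    refine le_trans (card_le_card ?_) (mem_filter.1 hy).2
    intro z hz
    exact mem_filter.2 ⟨(mem_filter.1 hz).1, hmax z hz⟩

/-- affine map -/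
def aff (T : ℂ × ℂ) (x : ℂ) : ℂ := T.1 * x + T.2

open Classical in
noncomputable def supp (A : Finset ℂ) (T : ℂ × ℂ) : Finset ℂ := A.filter fun x => aff T x ∈ A

open Classical in
noncomputable def affs (A : Finset ℂ) : Finset (ℂ × ℂ) :=
  ((A ×ˢ A ×ˢ A ×ˢ A).filter fun q => q.1 ≠ q.2.1 ∧ q.2.2.1 ≠ q.2.2.2).image fun q =>
    ((q.2.2.1 - q.2.2.2) / (q.1 - q.2.1),
      q.2.2.1 - (q.2.2.1 - q.2.2.2) / (q.1 - q.2.1) * q.1)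

lemma aff_sub (T : ℂ × ℂ) (x y : ℂ) : aff T x - aff T y = T.1 * (x - y) := by
  simp only [aff]; ring

open Finset in
lemma affs_spec {A : Finset ℂ} {T : ℂ × ℂ} (hT : T ∈ affs A) :
    T.1 ≠ 0 ∧ 2 ≤ (supp A T).card := by
  classical
  simp only [affs, mem_image, mem_filter, mem_product] at hT
  obtain ⟨⟨a, c, a', c'⟩, ⟨⟨ha, hc, ha', hc'⟩, h1, h2⟩, rfl⟩ := hT
  dsimp only at *
  have h1' := sub_ne_zero.2 h1
  have h2' := sub_ne_zero.2 h2
  refine ⟨div_ne_zero h2' h1', ?_⟩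
  have : 1 < (supp A ((a' - c') / (a - c), a' - (a' - c') / (a - c) * a)).card := by
    rw [one_lt_card]
    refine ⟨a, ?_, c, ?_, h1⟩
    · refine mem_filter.2 ⟨ha, ?_⟩
      simp only [aff]
      convert ha' using 1; ring
    · refine mem_filter.2 ⟨hc, ?_⟩
      simp only [aff]
      convert hc' using 1; field_simp; ring
  exact this

open Finset in
lemma exists_nn (S : Finset ℂ) (hS : 2 ≤ S.card) :
    ∃ f : ℂ → ℂ, ∀ x ∈ S, f x ∈ S ∧ f x ≠ x ∧ ∀ y ∈ S, x ≠ y → ‖f x - x‖ ≤ ‖x - y‖ := by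
  classical
  have : ∀ x ∈ S, ∃ z, z ∈ S ∧ z ≠ x ∧ ∀ y ∈ S, x ≠ y → ‖z - x‖ ≤ ‖x - y‖ := by
    intro x hx
    have hne : (S.erase x).Nonempty := by
      rw [← card_pos, card_erase_of_mem hx]; omega
    obtain ⟨z, hz, hmin⟩ := exists_min_image _ (fun y => ‖y - x‖) hne
    refine ⟨z, (mem_erase.1 hz).2, (mem_erase.1 hz).1, fun y hy hxy => ?_⟩
    rw [norm_sub_rev x y]
    exact hmin y (mem_erase.2 ⟨hxy.symm, hy⟩)
  choose! f hf using this
  exact ⟨f, hf⟩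

open Classical in
noncomputable def nn (A : Finset ℂ) (T : ℂ × ℂ) : ℂ → ℂ :=
  if h : 2 ≤ (supp A T).card then (exists_nn (supp A T) h).choose else id

lemma nn_spec {A : Finset ℂ} {T : ℂ × ℂ} (h : 2 ≤ (supp A T).card) :
    ∀ x ∈ supp A T, nn A T x ∈ supp A T ∧ nn A T x ≠ x ∧
      ∀ y ∈ supp A T, x ≠ y → ‖nn A T x - x‖ ≤ ‖x - y‖ := by
  rw [nn, dif_pos h]
  exact (exists_nn (supp A T) h).choose_spec

open Classical in
noncomputable def good (A : Finset ℂ) (T : ℂ × ℂ) (j : ℕ) : Finset ℂ :=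
  (supp A T).filter fun x =>
    rk A x (nn A T x) ≤ j ∧ rk A (aff T x) (aff T (nn A T x)) ≤ j

open Finset in
lemma good_card {A : Finset ℂ} {T : ℂ × ℂ} (hT : T ∈ affs A) {j : ℕ}
    (hj : 36 * A.card ≤ j * (supp A T).card) : (supp A T).card ≤ 2 * (good A T j).card := by
  classical
  obtain ⟨h0, h2⟩ := affs_spec hT
  have hs := nn_spec h2
  have s1 := overlap_sum A (supp A T) id (fun x => ‖nn A T x - x‖) (fun _ _ _ _ h => h)
    (fun x hx y hy hxy => (hs x hx).2.2 y hy hxy)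
  have s2 := overlap_sum A (supp A T) (aff T) (fun x => ‖aff T (nn A T x) - aff T x‖)
    (fun x _ y _ h => by
      have : T.1 * (x - y) = 0 := by rw [← aff_sub, h, sub_self]
      rcases mul_eq_zero.1 this with h | h
      · exact absurd h h0
      · exact sub_eq_zero.1 h)
    (fun x hx y hy hxy => by
      rw [aff_sub, aff_sub, norm_mul, norm_mul]
      exact mul_le_mul_of_nonneg_left ((hs x hx).2.2 y hy hxy) (norm_nonneg _))
  have hsplit : (good A T j).card + ((supp A T).filter fun x => ¬
    (rk A x (nn A T x) ≤ j ∧ rk A (aff T x) (aff T (nn A T x)) ≤ j)).card = (supp A T).card := by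
    rw [good, card_filter_add_card_filter_not]
  set bad := (supp A T).filter fun x => ¬
    (rk A x (nn A T x) ≤ j ∧ rk A (aff T x) (aff T (nn A T x)) ≤ j) with hbad
  have hb : bad.card * j ≤ 18 * A.card := by
    calc bad.card * j = ∑ x ∈ bad, j := by simp
      _ ≤ ∑ x ∈ bad, (rk A x (nn A T x) + rk A (aff T x) (aff T (nn A T x))) := by
          refine sum_le_sum fun x hx => ?_
          have := (mem_filter.1 hx).2
          omega
      _ ≤ ∑ x ∈ supp A T, (rk A x (nn A T x) + rk A (aff T x) (aff T (nn A T x))) :=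
          sum_le_sum_of_subset (filter_subset _ _)
      _ ≤ 9 * A.card + 9 * A.card := by
          rw [sum_add_distrib]
          exact add_le_add s1 s2
      _ = 18 * A.card := by ring
  have hA : 0 < A.card := lt_of_lt_of_le (by omega) (h2.trans (card_le_card (filter_subset _ _)))
  have hj0 : 0 < j := by
    rcases Nat.eq_zero_or_pos j with h | h
    · subst h; omega
    · exact h
  have : 2 * bad.card * j ≤ (supp A T).card * j := by nlinarith
  have := Nat.le_of_mul_le_mul_right this hj0
  omega

open Finset in
lemma good_sum (A : Finset ℂ) (j : ℕ) :
    ∑ T ∈ affs A, (good A T j).card ≤ (A.card * j) ^ 2 := by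
  classical
  rw [← card_sigma]
  calc _ ≤ (closePairs A j ×ˢ closePairs A j).card := by
        refine card_le_card_of_injOn (fun q : (_ : ℂ × ℂ) × ℂ =>
          ((q.2, nn A q.1 q.2), (aff q.1 q.2, aff q.1 (nn A q.1 q.2)))) ?_ ?_
        · rintro ⟨T, x⟩ hq
          have hq' := mem_sigma.1 (mem_coe.1 hq)
          obtain ⟨hT, hx⟩ := hq'
          dsimp only at hT hx
          obtain ⟨hx, hg1, hg2⟩ := mem_filter.1 hx
          have hn := (nn_spec (affs_spec hT).2 x hx).1
          have hx' := mem_filter.1 hx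
          have hn' := mem_filter.1 hn
          simp only [coe_product, Set.mem_prod, mem_coe, closePairs, mem_filter, mem_product]
          exact ⟨⟨⟨hx'.1, hn'.1⟩, hg1⟩, ⟨hx'.2, hn'.2⟩, hg2⟩
        · rintro ⟨T, x⟩ hq ⟨T', x'⟩ hq' heq
          obtain ⟨hT, hx⟩ := mem_sigma.1 (mem_coe.1 hq)
          dsimp only at hT hx
          have hn := (nn_spec (affs_spec hT).2 x (mem_filter.1 hx).1).2.1
          simp only [Prod.mk.injEq] at heq
          obtain ⟨⟨e1, e2⟩, e3, e4⟩ := heq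
          subst e1
          rw [← e2] at e4
          have e5 : T.1 * (nn A T x - x) = T'.1 * (nn A T x - x) := by
            rw [← aff_sub, ← aff_sub, e3, e4]
          have e6 := mul_right_cancel₀ (sub_ne_zero.2 hn) e5
          have e7 : T.2 = T'.2 := by
            simp only [aff] at e3
            rw [e6] at e3
            exact add_left_cancel e3
          have : T = T' := Prod.ext e6 e7
          subst this
          rfl
    _ ≤ (A.card * j) ^ 2 := by
        rw [card_product, sq]
        exact Nat.mul_le_mul (closePairs_card A j) (closePairs_card A j)

open Finset in
lemma cube_tail {n k : ℕ} (hk : 2 ≤ k) (hkn : k ≤ n) :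
    (k : ℝ) ^ 2 / (8 * 37 ^ 2 * n ^ 2) ≤
      ∑ j ∈ (Icc 1 (37 * n)).filter (fun j => 36 * n ≤ j * k), 1 / (j : ℝ) ^ 3 := by
  set m := 36 * n / k + 1 with hm
  have hmk : 36 * n ≤ m * k := by
    have := Nat.lt_div_mul_add (a := 36 * n) (b := k) (by omega)
    rw [hm, add_mul]; omega
  have hmk2 : m * k ≤ 37 * n := by
    have := Nat.div_mul_le_self (36 * n) k
    rw [hm, add_mul]; omega
  have hm0 : 0 < m := Nat.succ_pos _
  have hsub : Ico m (2 * m) ⊆ (Icc 1 (37 * n)).filter (fun j => 36 * n ≤ j * k) := by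
    intro j hj
    rw [mem_Ico] at hj
    rw [mem_filter, mem_Icc]
    refine ⟨⟨by omega, ?_⟩, ?_⟩
    · nlinarith
    · exact hmk.trans (Nat.mul_le_mul_right _ hj.1)
  refine le_trans ?_ (sum_le_sum_of_subset_of_nonneg hsub fun _ _ _ => by positivity)
  have hmR : (0 : ℝ) < m := by exact_mod_cast hm0
  have hnR : (0 : ℝ) < n := by exact_mod_cast (by omega : 0 < n)
  have h1 : (m : ℝ) * (1 / (8 * (m : ℝ) ^ 3)) ≤ ∑ j ∈ Ico m (2 * m), 1 / (j : ℝ) ^ 3 := by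
    have := card_nsmul_le_sum (Ico m (2 * m)) (fun j => 1 / (j : ℝ) ^ 3) (1 / (8 * (m : ℝ) ^ 3)) ?_
    · rw [Nat.card_Ico, nsmul_eq_mul, show 2 * m - m = m by omega] at this
      exact this
    · intro j hj
      rw [mem_Ico] at hj
      have hj0 : (0 : ℝ) < j := by exact_mod_cast (by omega : 0 < j)
      have hj2 : (j : ℝ) ≤ 2 * m := by exact_mod_cast hj.2.le
      apply one_div_le_one_div_of_le (by positivity)
      calc (j : ℝ) ^ 3 ≤ (2 * m) ^ 3 := by gcongr
        _ = 8 * (m : ℝ) ^ 3 := by ring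
  refine le_trans ?_ h1
  have h3 : (m : ℝ) * k ≤ 37 * n := by exact_mod_cast hmk2
  have h4 : ((m : ℝ) * k) ^ 2 ≤ (37 * n) ^ 2 := by gcongr
  have h5 : (m : ℝ) * (1 / (8 * (m : ℝ) ^ 3)) = 1 / (8 * m ^ 2) := by field_simp
  rw [h5, div_le_div_iff₀ (by positivity) (by positivity)]
  nlinarith

open Finset in
lemma cubes_le (A : Finset ℂ) :
    ∑ T ∈ affs A, ((supp A T).card : ℝ) ^ 3 ≤
      16 * 37 ^ 2 * (A.card : ℝ) ^ 4 * ∑ j ∈ Icc 1 (37 * A.card), 1 / (j : ℝ) := by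
  classical
  rcases Nat.eq_zero_or_pos A.card with h0 | hpos
  · have hA : A = ∅ := card_eq_zero.1 h0
    subst hA
    simp [affs]
  set n := A.card with hn
  have hnR : (0 : ℝ) < n := by exact_mod_cast hpos
  have key : ∀ T ∈ affs A, ((supp A T).card : ℝ) ^ 3 ≤
      16 * 37 ^ 2 * (n : ℝ) ^ 2 * ∑ j ∈ Icc 1 (37 * n), ((good A T j).card : ℝ) * (1 / (j : ℝ) ^ 3) := by
    intro T hT
    have h2 := (affs_spec hT).2
    have hkn : (supp A T).card ≤ n := card_le_card (filter_subset _ _)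
    have ht := cube_tail h2 hkn
    set k := (supp A T).card with hk
    have hkR : (0 : ℝ) < k := by exact_mod_cast (by omega : 0 < k)
    have h3 : (k : ℝ) / 2 * ((k : ℝ) ^ 2 / (8 * 37 ^ 2 * n ^ 2)) ≤
        ∑ j ∈ Icc 1 (37 * n), ((good A T j).card : ℝ) * (1 / (j : ℝ) ^ 3) := by
      calc _ ≤ (k : ℝ) / 2 * ∑ j ∈ (Icc 1 (37 * n)).filter (fun j => 36 * n ≤ j * k), 1 / (j : ℝ) ^ 3 := by
            gcongr
        _ = ∑ j ∈ (Icc 1 (37 * n)).filter (fun j => 36 * n ≤ j * k), (k : ℝ) / 2 * (1 / (j : ℝ) ^ 3) := by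
            rw [mul_sum]
        _ ≤ ∑ j ∈ (Icc 1 (37 * n)).filter (fun j => 36 * n ≤ j * k), ((good A T j).card : ℝ) * (1 / (j : ℝ) ^ 3) := by
            refine sum_le_sum fun j hj => ?_
            have hg := good_card hT (mem_filter.1 hj).2
            have hg' : (k : ℝ) ≤ 2 * (good A T j).card := by exact_mod_cast hg
            have : (k : ℝ) / 2 ≤ (good A T j).card := by linarith
            gcongr
        _ ≤ _ := sum_le_sum_of_subset_of_nonneg (filter_subset _ _) fun _ _ _ => by positivity
    calc (k : ℝ) ^ 3 = 16 * 37 ^ 2 * (n : ℝ) ^ 2 * ((k : ℝ) / 2 * ((k : ℝ) ^ 2 / (8 * 37 ^ 2 * n ^ 2))) := by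
          field_simp; norm_num
      _ ≤ _ := by gcongr
  calc _ ≤ ∑ T ∈ affs A, 16 * 37 ^ 2 * (n : ℝ) ^ 2 *
        ∑ j ∈ Icc 1 (37 * n), ((good A T j).card : ℝ) * (1 / (j : ℝ) ^ 3) := sum_le_sum key
    _ = 16 * 37 ^ 2 * (n : ℝ) ^ 2 * ∑ j ∈ Icc 1 (37 * n),
        ((∑ T ∈ affs A, (good A T j).card : ℕ) : ℝ) * (1 / (j : ℝ) ^ 3) := by
        rw [← mul_sum, sum_comm]
        push_cast
        simp only [sum_mul]
    _ ≤ 16 * 37 ^ 2 * (n : ℝ) ^ 2 * ∑ j ∈ Icc 1 (37 * n), (n : ℝ) ^ 2 * (1 / (j : ℝ)) := by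
        refine mul_le_mul_of_nonneg_left (sum_le_sum fun j hj => ?_) (by positivity)
        have hj0 : (0 : ℝ) < j := by exact_mod_cast (mem_Icc.1 hj).1
        have : ((∑ T ∈ affs A, (good A T j).card : ℕ) : ℝ) ≤ ((n : ℝ) * j) ^ 2 := by
          exact_mod_cast good_sum A j
        calc _ ≤ ((n : ℝ) * j) ^ 2 * (1 / (j : ℝ) ^ 3) := by gcongr
          _ = _ := by field_simp
    _ = _ := by rw [← mul_sum]; ring

open Classical in
noncomputable def trips (A : Finset ℂ) : Finset (ℂ × ℂ × ℂ) :=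
  (A ×ˢ A ×ˢ A).filter fun q => q.1 ≠ q.2.2

noncomputable def gv (q : ℂ × ℂ × ℂ) : ℂ := (q.1 - q.2.1) / (q.1 - q.2.2)

open Classical in
noncomputable def gset (A : Finset ℂ) : Finset ℂ := (trips A).image gv

open Finset in
open Classical in
lemma energy_le (A : Finset ℂ) :
    ∑ v ∈ gset A, ((trips A).filter fun q => gv q = v).card ^ 2 ≤
      ∑ T ∈ affs A, (supp A T).card ^ 3 := by
  have h1 : ∑ v ∈ gset A, ((trips A).filter fun q => gv q = v).card ^ 2 =
      ((gset A).sigma fun v => ((trips A).filter fun q => gv q = v) ×ˢ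
        ((trips A).filter fun q => gv q = v)).card := by
    rw [card_sigma]; simp only [card_product, sq]
  have h2 : ∑ T ∈ affs A, (supp A T).card ^ 3 =
      ((affs A).sigma fun T => supp A T ×ˢ supp A T ×ˢ supp A T).card := by
    rw [card_sigma]; simp only [card_product]
    refine sum_congr rfl fun _ _ => by ring
  rw [h1, h2]
  let τ : (ℂ × ℂ × ℂ) → (ℂ × ℂ × ℂ) → ℂ × ℂ := fun q q' =>
    ((q'.1 - q'.2.2) / (q.1 - q.2.2), q'.1 - (q'.1 - q'.2.2) / (q.1 - q.2.2) * q.1)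
  have hτ : ∀ q q', q ∈ trips A → q' ∈ trips A → gv q = gv q' →
      aff (τ q q') q.1 = q'.1 ∧ aff (τ q q') q.2.1 = q'.2.1 ∧ aff (τ q q') q.2.2 = q'.2.2 := by
    rintro ⟨a, b, c⟩ ⟨a', b', c'⟩ hq hq' he
    have n1 := sub_ne_zero.2 (mem_filter.1 hq).2
    have n2 := sub_ne_zero.2 (mem_filter.1 hq').2
    simp only [gv] at he n1 n2
    simp only [aff, τ]
    refine ⟨by ring, ?_, by field_simp; ring⟩
    rw [div_eq_div_iff n1 n2] at he
    field_simp
    linear_combination -he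
  refine card_le_card_of_injOn (fun q : (_ : ℂ) × ((ℂ × ℂ × ℂ) × (ℂ × ℂ × ℂ)) =>
    (⟨τ q.2.1 q.2.2, q.2.1⟩ : (_ : ℂ × ℂ) × (ℂ × ℂ × ℂ))) ?_ ?_
  · rintro ⟨v, q, q'⟩ hq
    obtain ⟨-, hq⟩ := mem_sigma.1 (mem_coe.1 hq)
    obtain ⟨hq, hq'⟩ := mem_product.1 hq
    obtain ⟨hq, e⟩ := mem_filter.1 hq
    obtain ⟨hq', e'⟩ := mem_filter.1 hq'
    dsimp only at hq hq' e e'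
    obtain ⟨t1, t2, t3⟩ := hτ q q' hq hq' (e.trans e'.symm)
    obtain ⟨m, ne⟩ := mem_filter.1 hq
    obtain ⟨m', ne'⟩ := mem_filter.1 hq'
    simp only [mem_product] at m m'
    rw [mem_coe, mem_sigma]
    refine ⟨?_, ?_⟩
    · simp only [affs, mem_image, mem_filter, mem_product]
      exact ⟨(q.1, q.2.2, q'.1, q'.2.2), ⟨⟨m.1, m.2.2, m'.1, m'.2.2⟩, ne, ne'⟩, rfl⟩
    · simp only [mem_product, supp, mem_filter]
      refine ⟨⟨m.1, ?_⟩, ⟨m.2.1, ?_⟩, ⟨m.2.2, ?_⟩⟩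
      · rw [t1]; exact m'.1
      · rw [t2]; exact m'.2.1
      · rw [t3]; exact m'.2.2
  · rintro ⟨v, q, q'⟩ hq ⟨w, p, p'⟩ hp heq
    obtain ⟨-, hq⟩ := mem_sigma.1 (mem_coe.1 hq)
    obtain ⟨hq, hq'⟩ := mem_product.1 hq
    obtain ⟨hq, e⟩ := mem_filter.1 hq
    obtain ⟨hq', e'⟩ := mem_filter.1 hq'
    obtain ⟨-, hp⟩ := mem_sigma.1 (mem_coe.1 hp)
    obtain ⟨hp, hp'⟩ := mem_product.1 hp
    obtain ⟨hp, f⟩ := mem_filter.1 hp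
    obtain ⟨hp', f'⟩ := mem_filter.1 hp'
    dsimp only at hq hq' e e' hp hp' f f'
    obtain ⟨t1, t2, t3⟩ := hτ q q' hq hq' (e.trans e'.symm)
    obtain ⟨u1, u2, u3⟩ := hτ p p' hp hp' (f.trans f'.symm)
    simp only [Sigma.mk.injEq, heq_eq_eq] at heq
    obtain ⟨g1, g2⟩ := heq
    subst g2
    rw [g1] at t1 t2 t3
    have : q' = p' := Prod.ext (t1.symm.trans u1)
      (Prod.ext (t2.symm.trans u2) (t3.symm.trans u3))
    subst this
    have : v = w := e.symm.trans f
    subst this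
    rfl

open Finset in
lemma trips_card (A : Finset ℂ) (h : 2 ≤ A.card) : (A.card : ℝ) ^ 3 / 2 ≤ (trips A).card := by
  classical
  have h1 : (trips A).card + ((A ×ˢ A ×ˢ A).filter fun q => ¬ q.1 ≠ q.2.2).card = A.card ^ 3 := by
    rw [trips, card_filter_add_card_filter_not, card_product, card_product]; ring
  have h2 : ((A ×ˢ A ×ˢ A).filter fun q => ¬ q.1 ≠ q.2.2).card ≤ (A ×ˢ A).card := by
    refine card_le_card_of_injOn (fun q => (q.1, q.2.1)) ?_ ?_
    · rintro ⟨a, b, c⟩ hq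
      have := mem_product.1 (mem_filter.1 (mem_coe.1 hq)).1
      exact mem_coe.2 (mem_product.2 ⟨this.1, (mem_product.1 this.2).1⟩)
    · rintro ⟨a, b, c⟩ hq ⟨a', b', c'⟩ hq' he
      have e1 := (mem_filter.1 (mem_coe.1 hq)).2
      have e2 := (mem_filter.1 (mem_coe.1 hq')).2
      simp only [ne_eq, not_not] at e1 e2
      simp only [Prod.mk.injEq] at he ⊢
      exact ⟨he.1, he.2, by rw [← e1, ← e2, he.1]⟩
  rw [card_product] at h2
  have h1' : ((trips A).card : ℝ) + (((A ×ˢ A ×ˢ A).filter fun q => ¬ q.1 ≠ q.2.2).card : ℝ)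
    = (A.card : ℝ) ^ 3 := by exact_mod_cast h1
  have h2' : (((A ×ˢ A ×ˢ A).filter fun q => ¬ q.1 ≠ q.2.2).card : ℝ) ≤ (A.card : ℝ) * A.card := by
    exact_mod_cast h2
  have h3 : (2 : ℝ) ≤ A.card := by exact_mod_cast h
  have h4 : 0 ≤ (A.card : ℝ) ^ 2 * ((A.card : ℝ) - 2) := mul_nonneg (by positivity) (by linarith)
  nlinarith

open Finset in
lemma harm_le {n : ℕ} (hn : 2 ≤ n) :
    ∑ j ∈ Icc 1 (37 * n), 1 / (j : ℝ) ≤ 9 * Real.logb 2 n := by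
  have h := harmonic_le_one_add_log (37 * n)
  have e : ((harmonic (37 * n) : ℚ) : ℝ) = ∑ j ∈ Icc 1 (37 * n), 1 / (j : ℝ) := by
    rw [harmonic_eq_sum_Icc]; push_cast; simp
  rw [e] at h
  refine h.trans ?_
  have hnR : (2 : ℝ) ≤ n := by exact_mod_cast hn
  have hl2 : 0 < Real.log 2 := Real.log_pos (by norm_num)
  have hl2' : Real.log 2 < 1 := by have := Real.log_two_lt_d9; linarith
  have hln : Real.log 2 ≤ Real.log n := Real.log_le_log (by norm_num) hnR
  have hb : 1 ≤ Real.logb 2 n := by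
    rw [Real.logb, le_div_iff₀ hl2]; linarith
  have hc : Real.log n ≤ Real.logb 2 n := by
    rw [Real.logb, le_div_iff₀ hl2]; nlinarith
  have h37 : Real.log 37 ≤ 6 := by
    have : Real.log 37 ≤ Real.log (2 ^ 6) := Real.log_le_log (by norm_num) (by norm_num)
    rw [Real.log_pow] at this
    push_cast at this
    linarith
  push_cast
  rw [Real.log_mul (by norm_num) (by positivity)]
  linarith

theorem stmt3 :
    ∃ c : ℝ, 0 < c ∧
      ∀ A : Finset ℂ, 2 ≤ A.card →
        c * (A.card : ℝ) ^ 2 / Real.logb 2 (A.card : ℝ) ≤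
          (({z : ℂ | ∃ a ∈ A, ∃ b ∈ A, ∃ c' ∈ A, a ≠ c' ∧ z = (a - b) / (a - c')}.ncard : ℕ) : ℝ) := by
  classical
  refine ⟨1 / (4 * (16 * 37 ^ 2 * 9)), by positivity, fun A hA => ?_⟩
  have hset : {z : ℂ | ∃ a ∈ A, ∃ b ∈ A, ∃ c' ∈ A, a ≠ c' ∧ z = (a - b) / (a - c')} =
      (gset A : Set ℂ) := by
    ext z
    simp only [gset, trips, gv, Finset.coe_image, Set.mem_image, Set.mem_ofPred_eq, Finset.mem_coe,
      Finset.mem_filter, Finset.mem_product, Prod.exists]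
    constructor
    · rintro ⟨a, ha, b, hb, c, hc, hne, rfl⟩
      exact ⟨a, b, c, ⟨⟨ha, hb, hc⟩, hne⟩, rfl⟩
    · rintro ⟨a, b, c, ⟨⟨ha, hb, hc⟩, hne⟩, rfl⟩
      exact ⟨a, ha, b, hb, c, hc, hne, rfl⟩
  rw [hset, Set.ncard_coe_finset]
  have hnR : (2 : ℝ) ≤ A.card := by exact_mod_cast hA
  have hL : 0 < Real.logb 2 (A.card : ℝ) := Real.logb_pos (by norm_num) (by linarith)
  have ht := trips_card A hA
  have hE : ((∑ v ∈ gset A, ((trips A).filter fun q => gv q = v).card ^ 2 : ℕ) : ℝ) ≤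
      16 * 37 ^ 2 * (A.card : ℝ) ^ 4 * (9 * Real.logb 2 A.card) := by
    calc _ ≤ ((∑ T ∈ affs A, (supp A T).card ^ 3 : ℕ) : ℝ) := by exact_mod_cast energy_le A
      _ = ∑ T ∈ affs A, ((supp A T).card : ℝ) ^ 3 := by push_cast; rfl
      _ ≤ _ := cubes_le A
      _ ≤ _ := by
        have := harm_le hA
        gcongr
  have hsum : (trips A).card = ∑ v ∈ gset A, ((trips A).filter fun q => gv q = v).card :=
    Finset.card_eq_sum_card_image gv (trips A)
  have hcs : ((trips A).card : ℝ) ^ 2 ≤ (gset A).card *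
      ((∑ v ∈ gset A, ((trips A).filter fun q => gv q = v).card ^ 2 : ℕ) : ℝ) := by
    rw [hsum]
    push_cast
    exact sq_sum_le_card_mul_sum_sq
  set n : ℝ := (A.card : ℝ) with hn
  have hn0 : 0 < n := by linarith
  have h1 : (n ^ 3 / 2) ^ 2 ≤ (gset A).card * (16 * 37 ^ 2 * n ^ 4 * (9 * Real.logb 2 n)) := by
    calc _ ≤ ((trips A).card : ℝ) ^ 2 := by gcongr
      _ ≤ _ := hcs
      _ ≤ _ := by gcongr
  rw [div_le_iff₀ hL]
  have h2 : n ^ 4 * (1 / (4 * (16 * 37 ^ 2 * 9)) * n ^ 2) ≤ n ^ 4 * ((gset A).card * Real.logb 2 n) := by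
    nlinarith
  exact le_of_mul_le_mul_left h2 (by positivity)
end

section
/- There exists a constant c > 0 such that for every finite set A ⊆ ℝ with |A| ≥ 2, the set h(A) = {((a − b)(c − d))/((b − c)(a − d)) : a, b, c, d ∈ A, b ≠ c, a ≠ d} satisfies |h(A)| ≥ c·|A|². -/
/-- Points on one increasing branch of the graph of the Moebius map with matrix entries
`g = (α, β, γ, δ)`, of determinant one. -/
def OnC (g : ℝ × ℝ × ℝ × ℝ) (x y : ℝ) : Prop :=
  g.1 * g.2.2.2 - g.2.1 * g.2.2.1 = 1 ∧ 0 < g.2.2.1 * x + g.2.2.2 ∧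
    y * (g.2.2.1 * x + g.2.2.2) = g.1 * x + g.2.1

theorem onC_diff {g : ℝ × ℝ × ℝ × ℝ} {x y x' y' : ℝ} (h : OnC g x y) (h' : OnC g x' y') :
    (y' - y) * ((g.2.2.1 * x + g.2.2.2) * (g.2.2.1 * x' + g.2.2.2)) = x' - x := by
  obtain ⟨a, b, c, d⟩ := g
  obtain ⟨h1, h2, h3⟩ := h
  obtain ⟨-, h5, h6⟩ := h'
  simp only at *
  linear_combination (c * x + d) * h6 - (c * x' + d) * h3 + (x' - x) * h1

theorem onC_mono {g : ℝ × ℝ × ℝ × ℝ} {x y x' y' : ℝ} (h : OnC g x y) (h' : OnC g x' y')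
    (hx : x < x') : y < y' := by
  have h1 := onC_diff h h'
  have h2 := mul_pos h.2.1 h'.2.1
  by_contra hc
  push Not at hc
  have : (y' - y) * ((g.2.2.1 * x + g.2.2.2) * (g.2.2.1 * x' + g.2.2.2)) ≤ 0 :=
    mul_nonpos_of_nonpos_of_nonneg (by linarith) h2.le
  linarith

theorem onC_fun {g : ℝ × ℝ × ℝ × ℝ} {x y y' : ℝ} (h : OnC g x y) (h' : OnC g x y') :
    y = y' := by
  have h1 := h.2.2
  rw [← h'.2.2] at h1
  exact mul_right_cancel₀ h.2.1.ne' h1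

theorem onC_unique {g k : ℝ × ℝ × ℝ × ℝ} {x1 x2 x3 y1 y2 y3 : ℝ} (h12 : x1 < x2) (h23 : x2 < x3)
    (g1 : OnC g x1 y1) (g2 : OnC g x2 y2) (g3 : OnC g x3 y3)
    (k1 : OnC k x1 y1) (k2 : OnC k x2 y2) (k3 : OnC k x3 y3) : g = k := by
  have p12 := onC_mono g1 g2 h12
  have p23 := onC_mono g2 g3 h23
  have a12 := (onC_diff g1 g2).trans (onC_diff k1 k2).symm
  have a13 := (onC_diff g1 g3).trans (onC_diff k1 k3).symm
  have a23 := (onC_diff g2 g3).trans (onC_diff k2 k3).symm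
  replace a12 := mul_left_cancel₀ (by linarith) a12
  replace a13 := mul_left_cancel₀ (by linarith) a13
  replace a23 := mul_left_cancel₀ (by linarith) a23
  obtain ⟨a, b, c, d⟩ := g
  obtain ⟨a', b', c', d'⟩ := k
  obtain ⟨-, q1, r1⟩ := g1
  obtain ⟨-, q2, r2⟩ := g2
  obtain ⟨-, q3, -⟩ := g3
  obtain ⟨-, s1, t1⟩ := k1
  obtain ⟨-, s2, t2⟩ := k2
  obtain ⟨-, s3, -⟩ := k3
  simp only at *
  have e1 : c * x1 + d = c' * x1 + d' := by
    have : (c * x1 + d) ^ 2 * ((c * x2 + d) * (c * x3 + d))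
        = (c' * x1 + d') ^ 2 * ((c * x2 + d) * (c * x3 + d)) := by
      calc _ = ((c * x1 + d) * (c * x2 + d)) * ((c * x1 + d) * (c * x3 + d)) := by ring
        _ = ((c' * x1 + d') ^ 2 * ((c' * x2 + d') * (c' * x3 + d'))) := by rw [a12, a13]; ring
        _ = _ := by rw [a23]
    have h := mul_right_cancel₀ (mul_pos q2 q3).ne' this
    exact (pow_left_inj₀ q1.le s1.le two_ne_zero).1 h
  have e2 : c * x2 + d = c' * x2 + d' := by
    rw [e1] at a12
    exact mul_left_cancel₀ s1.ne' a12
  have hne : x2 - x1 ≠ 0 := by linarith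
  have hc : c = c' := mul_right_cancel₀ hne (by linear_combination e2 - e1)
  have hd : d = d' := by rw [hc] at e1; linarith
  rw [e1] at r1
  rw [e2] at r2
  have e3 := r1.symm.trans t1
  have e4 := r2.symm.trans t2
  have ha : a = a' := mul_right_cancel₀ hne (by linear_combination e4 - e3)
  have hb : b = b' := by rw [ha] at e3; linarith
  rw [ha, hb, hc, hd]

theorem onC_exists {x1 x2 x3 x4 y1 y2 y3 y4 : ℝ} (hx1 : x1 < x2) (hx2 : x2 < x3) (hx3 : x3 < x4)
    (hy1 : y1 < y2) (hy2 : y2 < y3) (hy3 : y3 < y4)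
    (h : ((x1 - x2) * (x3 - x4)) / ((x2 - x3) * (x1 - x4))
      = ((y1 - y2) * (y3 - y4)) / ((y2 - y3) * (y1 - y4))) :
    ∃ g, OnC g x1 y1 ∧ OnC g x2 y2 ∧ OnC g x3 y3 ∧ OnC g x4 y4 := by
  have X12 : 0 < x2 - x1 := by linarith
  have X23 : 0 < x3 - x2 := by linarith
  have X13 : 0 < x3 - x1 := by linarith
  have Y12 : 0 < y2 - y1 := by linarith
  have Y23 : 0 < y3 - y2 := by linarith
  have Y13 : 0 < y3 - y1 := by linarith
  rw [div_eq_div_iff (mul_ne_zero (by linarith) (by linarith))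
    (mul_ne_zero (by linarith) (by linarith))] at h
  set f12 := (y2 - y1) / (x2 - x1) with hf12
  set f13 := (y3 - y1) / (x3 - x1) with hf13
  set f23 := (y3 - y2) / (x3 - x2) with hf23
  have F12 : f12 * (x2 - x1) = y2 - y1 := by rw [hf12]; field_simp
  have F13 : f13 * (x3 - x1) = y3 - y1 := by rw [hf13]; field_simp
  have F23 : f23 * (x3 - x2) = y3 - y2 := by rw [hf23]; field_simp
  have P12 : 0 < f12 := div_pos Y12 X12
  have P13 : 0 < f13 := div_pos Y13 X13
  have P23 : 0 < f23 := div_pos Y23 X23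
  clear_value f12 f13 f23
  obtain ⟨M, hM, hM2⟩ : ∃ M : ℝ, 0 < M ∧ M ^ 2 * (f12 * f13 * f23) = 1 := by
    have hp : 0 < f12 * f13 * f23 := by positivity
    refine ⟨√((f12 * f13 * f23)⁻¹), Real.sqrt_pos.2 (inv_pos.2 hp), ?_⟩
    rw [Real.sq_sqrt (inv_pos.2 hp).le, inv_mul_cancel₀ hp.ne']
  obtain ⟨c, hc⟩ : ∃ c, c * (x2 - x1) = M * f13 - M * f23 :=
    ⟨(M * f13 - M * f23) / (x2 - x1), by field_simp⟩
  obtain ⟨d, hd⟩ : ∃ d, c * x1 + d = M * f23 := ⟨M * f23 - c * x1, by ring⟩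
  obtain ⟨a, ha⟩ : ∃ a, a * (x2 - x1) = y2 * (M * f13) - y1 * (M * f23) :=
    ⟨(y2 * (M * f13) - y1 * (M * f23)) / (x2 - x1), by field_simp⟩
  obtain ⟨b, hb⟩ : ∃ b, a * x1 + b = y1 * (M * f23) := ⟨y1 * (M * f23) - a * x1, by ring⟩
  have hd2 : c * x2 + d = M * f13 := by linear_combination hc + hd
  have hb2 : a * x2 + b = y2 * (M * f13) := by linear_combination ha + hb
  have hy2' : y2 = y1 + f12 * (x2 - x1) := by linarith
  have hy3' : y3 = y2 + f23 * (x3 - x2) := by linarith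
  have hrel : f13 * (x3 - x1) = f12 * (x2 - x1) + f23 * (x3 - x2) := by linarith
  have hd3 : c * x3 + d = M * f12 := by
    apply mul_right_cancel₀ X12.ne'
    linear_combination (x3 - x1) * hc + (x2 - x1) * hd + M * hrel
  have hb3 : a * x3 + b = y3 * (M * f12) := by
    apply mul_right_cancel₀ X12.ne'
    rw [hy3']
    linear_combination (x3 - x1) * ha + (x2 - x1) * hb + M * y2 * hrel - M * f23 * (x3 - x2) * F12
  have det : a * d - b * c = 1 := by
    apply mul_right_cancel₀ X12.ne'
    have : (a * d - b * c) * (x2 - x1) = (a * x2 + b) * (c * x1 + d) - (a * x1 + b) * (c * x2 + d) := by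
      ring
    rw [this, hb2, hd, hb, hd2]
    linear_combination (x2 - x1) * hM2 - M ^ 2 * f13 * f23 * F12
  have key : ∀ x y : ℝ, a * x + b = y * (c * x + d) →
      (y * (c * x4 + d) - (a * x4 + b)) * (c * x + d) = x - x4 := by
    intro x y hxy
    linear_combination (x - x4) * det - (c * x4 + d) * hxy
  have k1 := key x1 y1 (by rw [hd, hb])
  have k3 := key x3 y3 (by rw [hd3, hb3])
  rw [hd] at k1
  rw [hd3] at k3
  have hrat : (y3 - y4) * (M * f12) * (x1 - x4) = (y1 - y4) * (M * f23) * (x3 - x4) := by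
    apply mul_right_cancel₀ (mul_pos X12 X23).ne'
    linear_combination M * (y3-y4)*(x1-x4)*(x3-x2) * F12 - M*(y1-y4)*(x3-x4)*(x2-x1)*F23 - M * h
  have he : y4 * (c * x4 + d) = a * x4 + b := by
    by_contra hne
    have hne' : y4 * (c * x4 + d) - (a * x4 + b) ≠ 0 := sub_ne_zero.2 hne
    have h0 : (y4 * (c * x4 + d) - (a * x4 + b)) * (M * f12 * (x1 - x4) - M * f23 * (x3 - x4)) = 0 := by
      linear_combination (x1 - x4) * k3 - (x3 - x4) * k1 - (c * x4 + d) * hrat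
    have h1 := (mul_eq_zero.1 h0).resolve_left hne'
    have h2 : (y3 - y1) * (M * f12 * (x1 - x4)) = 0 := by
      linear_combination hrat - (y1 - y4) * h1
    have h3 : (y3 - y1) * (M * f12 * (x4 - x1)) > 0 := by
      have : 0 < x4 - x1 := by linarith
      positivity
    linarith
  have hL : 0 < c * x4 + d := by
    rw [← he] at k3
    have : (c * x4 + d) * ((y4 - y3) * (M * f12)) > 0 := by
      have : (c * x4 + d) * ((y4 - y3) * (M * f12)) = x4 - x3 := by linear_combination -k3
      linarith
    have h2 : 0 < (y4 - y3) * (M * f12) := by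
      have : 0 < y4 - y3 := by linarith
      positivity
    exact pos_of_mul_pos_left this h2.le
  refine ⟨(a, b, c, d), ⟨det, ?_, ?_⟩, ⟨det, ?_, ?_⟩, ⟨det, ?_, ?_⟩, ⟨det, hL, he⟩⟩ <;> simp only
  · rw [hd]; positivity
  · rw [hd, hb]
  · rw [hd2]; positivity
  · rw [hd2, hb2]
  · rw [hd3]; positivity
  · rw [hd3, hb3]

abbrev Pt := ℕ × ℕ

def Grid (n : ℕ) : Finset Pt := Finset.range n ×ˢ Finset.range n

def Tri (n : ℕ) : Finset (Pt × Pt × Pt) :=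
  (Grid n ×ˢ Grid n ×ˢ Grid n).filter fun t =>
    t.1.1 < t.2.1.1 ∧ t.2.1.1 < t.2.2.1 ∧ t.1.2 < t.2.1.2 ∧ t.2.1.2 < t.2.2.2

def spread (t : Pt × Pt × Pt) : ℕ := (t.2.2.1 + t.2.2.2) - (t.1.1 + t.1.2)

noncomputable def wt (t : Pt × Pt × Pt) : ℝ := 1 / (spread t : ℝ) ^ 3

theorem wt_nonneg (t : Pt × Pt × Pt) : 0 ≤ wt t := by unfold wt; positivity

theorem sum_wt (n : ℕ) : ∑ t ∈ Tri n, wt t ≤ 2 * (n : ℝ) ^ 3 := by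
  classical
  let φ : Pt × Pt × Pt → (_ : Pt × ℕ) × (ℕ × ℕ × ℕ) := fun t =>
    ⟨(t.1, spread t), (t.2.1.1 - t.1.1, t.2.1.2 - t.1.2, t.2.2.1 - t.1.1)⟩
  let T : Finset ((_ : Pt × ℕ) × (ℕ × ℕ × ℕ)) :=
    (Grid n ×ˢ Finset.range (2 * n)).sigma fun s =>
      Finset.range s.2 ×ˢ Finset.range s.2 ×ˢ Finset.range s.2
  have hinj : Set.InjOn φ (Tri n) := by
    rintro ⟨⟨a1, a2⟩, ⟨b1, b2⟩, c1, c2⟩ h ⟨⟨a1', a2'⟩, ⟨b1', b2'⟩, c1', c2'⟩ h' heq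
    simp only [Tri, Finset.coe_filter, Set.mem_ofPred_eq] at h h'
    simp only [φ, spread, Sigma.mk.injEq, Prod.mk.injEq, heq_eq_eq] at heq
    simp only [Prod.mk.injEq]
    omega
  calc ∑ t ∈ Tri n, wt t = ∑ t ∈ Tri n, 1 / ((φ t).1.2 : ℝ) ^ 3 := rfl
    _ = ∑ s ∈ (Tri n).image φ, 1 / (s.1.2 : ℝ) ^ 3 := by
        rw [Finset.sum_image hinj]
    _ ≤ ∑ s ∈ T, 1 / (s.1.2 : ℝ) ^ 3 := by
        apply Finset.sum_le_sum_of_subset_of_nonneg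
        · intro s hs
          obtain ⟨⟨⟨a1, a2⟩, ⟨b1, b2⟩, c1, c2⟩, ht, rfl⟩ := Finset.mem_image.1 hs
          simp only [Tri, Grid, Finset.mem_filter, Finset.mem_product, Finset.mem_range] at ht
          simp only [T, φ, Grid, spread, Finset.mem_sigma, Finset.mem_product, Finset.mem_range]
          omega
        · intros; positivity
    _ = ∑ s ∈ Grid n ×ˢ Finset.range (2 * n), ((s.2 : ℝ) ^ 3 * (1 / (s.2 : ℝ) ^ 3)) := by
        rw [Finset.sum_sigma]
        apply Finset.sum_congr rfl
        intro s _
        simp only [Finset.sum_const, Finset.card_product, Finset.card_range, nsmul_eq_mul]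
        push_cast
        ring
    _ ≤ ∑ s ∈ Grid n ×ˢ Finset.range (2 * n), 1 := by
        apply Finset.sum_le_sum
        intro s _
        rw [mul_one_div]
        exact div_self_le_one _
    _ = 2 * (n : ℝ) ^ 3 := by
        simp only [Finset.sum_const, Grid, Finset.card_product, Finset.card_range, nsmul_eq_mul]
        push_cast
        ring

theorem tele (v : ℕ → ℝ) (m : ℕ) :
    ∑ i ∈ Finset.range m, (v (i + 2) - v i) = v (m + 1) + v m - v 0 - v 1 := by
  induction m with
  | zero => simp
  | succ m ih => rw [Finset.sum_range_succ, ih]; ring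

theorem tangent {s τ : ℝ} (hs : 0 < s) (hτ : 0 < τ) :
    4 / τ ^ 3 - 3 * s / τ ^ 4 ≤ 1 / s ^ 3 := by
  rw [div_sub_div _ _ (by positivity) (by positivity), div_le_div_iff₀ (by positivity) (by positivity)]
  have h : 0 ≤ τ ^ 3 * ((s - τ) ^ 2 * (3 * s ^ 2 + 2 * s * τ + τ ^ 2)) := by positivity
  nlinarith [h]

theorem chain_bound (n : ℕ) (S : Finset Pt) (hS : S ⊆ Grid n)
    (hm : ∀ p ∈ S, ∀ q ∈ S, p.1 < q.1 → p.2 < q.2)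
    (hf : ∀ p ∈ S, ∀ q ∈ S, p.1 = q.1 → p = q) (h4 : 4 ≤ S.card) :
    (S.card : ℝ) ^ 4 ≤ 16 * (4 * n) ^ 3 *
      ∑ t ∈ (Tri n).filter (fun t => t.1 ∈ S ∧ t.2.1 ∈ S ∧ t.2.2 ∈ S), wt t := by
  classical
  obtain ⟨m, hk⟩ : ∃ m, S.card = m + 2 := ⟨S.card - 2, by omega⟩
  have hm2 : 2 ≤ m := by omega
  have hD : (S.image Prod.fst).card = m + 2 := by
    rw [Finset.card_image_of_injOn, hk]
    intro p hp q hq h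
    exact hf p hp q hq h
  let e := (S.image Prod.fst).orderEmbOfFin hD
  have hex : ∀ i : ℕ, ∃ p : Pt, ∀ h : i < m + 2, p ∈ S ∧ p.1 = e ⟨i, h⟩ := by
    intro i
    by_cases h : i < m + 2
    · obtain ⟨p, hp, hp'⟩ := Finset.mem_image.1 (Finset.orderEmbOfFin_mem _ hD ⟨i, h⟩)
      exact ⟨p, fun _ => ⟨hp, hp'⟩⟩
    · exact ⟨(0, 0), fun h' => absurd h' h⟩
  choose p hp using hex
  have pS : ∀ i, i < m + 2 → p i ∈ S := fun i h => (hp i h).1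
  have p1 : ∀ i j, i < j → j < m + 2 → (p i).1 < (p j).1 := by
    intro i j hij hj
    rw [(hp i (by omega)).2, (hp j hj).2]
    exact e.strictMono hij
  have p2 : ∀ i j, i < j → j < m + 2 → (p i).2 < (p j).2 := fun i j hij hj =>
    hm _ (pS i (by omega)) _ (pS j hj) (p1 i j hij hj)
  have pG : ∀ i, i < m + 2 → (p i).1 < n ∧ (p i).2 < n := by
    intro i hi
    have := hS (pS i hi)
    simpa [Grid] using this
  let tr : ℕ → Pt × Pt × Pt := fun i => (p i, p (i + 1), p (i + 2))
  have hn : 0 < n := by have := pG 0 (by omega); omega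
  have hsum : ∑ i ∈ Finset.range m, wt (tr i) ≤
      ∑ t ∈ (Tri n).filter (fun t => t.1 ∈ S ∧ t.2.1 ∈ S ∧ t.2.2 ∈ S), wt t := by
    have hinj : Set.InjOn tr (Finset.range m) := by
      intro i hi j hj hij
      simp only [Finset.coe_range, Set.mem_Iio] at hi hj
      have h0 : p i = p j := congrArg Prod.fst hij
      rcases lt_trichotomy i j with h | h | h
      · have := p1 i j h (by omega); rw [h0] at this; omega
      · exact h
      · have := p1 j i h (by omega); rw [h0] at this; omega
    rw [← Finset.sum_image (f := wt) hinj]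
    apply Finset.sum_le_sum_of_subset_of_nonneg
    · intro s hs
      obtain ⟨i, hi, rfl⟩ := Finset.mem_image.1 hs
      rw [Finset.mem_range] at hi
      have s0 := pS i (by omega)
      have s1 := pS (i + 1) (by omega)
      have s2 := pS (i + 2) (by omega)
      simp only [Tri, tr, Finset.mem_filter, Finset.mem_product]
      exact ⟨⟨⟨hS s0, hS s1, hS s2⟩, p1 _ _ (by omega) (by omega), p1 _ _ (by omega) (by omega),
        p2 _ _ (by omega) (by omega), p2 _ _ (by omega) (by omega)⟩, s0, s1, s2⟩
    · intros; exact wt_nonneg _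
  let v : ℕ → ℝ := fun i => ((p i).1 + (p i).2 : ℕ)
  have hv : ∀ i < m, (spread (tr i) : ℝ) = v (i + 2) - v i ∧ 0 < v (i + 2) - v i := by
    intro i hi
    have h1 := p1 i (i + 2) (by omega) (by omega)
    have h2 := p2 i (i + 2) (by omega) (by omega)
    have h3 : (p i).1 + (p i).2 < (p (i + 2)).1 + (p (i + 2)).2 := by omega
    constructor
    · simp only [spread, tr, v]
      rw [Nat.cast_sub h3.le]
    · simp only [v]
      rw [sub_pos]
      exact_mod_cast h3
  have hmR : (0 : ℝ) < m := by exact_mod_cast (by omega : 0 < m)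
  have hnR : (0 : ℝ) < n := by exact_mod_cast hn
  have htot : ∑ i ∈ Finset.range m, (v (i + 2) - v i) ≤ 4 * n := by
    rw [tele]
    have h1 : v (m + 1) ≤ 2 * n := by
      have := pG (m + 1) (by omega)
      simp only [v]; exact_mod_cast (by omega)
    have h2 : v m ≤ 2 * n := by
      have := pG m (by omega)
      simp only [v]; exact_mod_cast (by omega)
    have h3 : 0 ≤ v 0 := Nat.cast_nonneg _
    have h4 : 0 ≤ v 1 := Nat.cast_nonneg _
    linarith
  set τ : ℝ := 4 * n / m with hτ
  have hτ0 : 0 < τ := by positivity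
  have hlow : (m : ℝ) ^ 4 / (4 * n) ^ 3 ≤ ∑ i ∈ Finset.range m, wt (tr i) := by
    calc (m : ℝ) ^ 4 / (4 * n) ^ 3 = m * (4 / τ ^ 3) - 3 * (4 * n) / τ ^ 4 := by
          rw [hτ]; field_simp; ring
      _ ≤ m * (4 / τ ^ 3) - 3 * (∑ i ∈ Finset.range m, (v (i + 2) - v i)) / τ ^ 4 := by
          gcongr
      _ = ∑ i ∈ Finset.range m, (4 / τ ^ 3 - 3 * (v (i + 2) - v i) / τ ^ 4) := by
          symm
          rw [Finset.sum_sub_distrib, Finset.sum_const, Finset.card_range, nsmul_eq_mul,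
            ← Finset.sum_div, ← Finset.mul_sum]
      _ ≤ _ := by
          apply Finset.sum_le_sum
          intro i hi
          obtain ⟨h1, h2⟩ := hv i (Finset.mem_range.1 hi)
          rw [wt, h1]
          exact tangent h2 hτ0
  have h1 := hlow.trans hsum
  rw [div_le_iff₀ (by positivity)] at h1
  have h2 : (S.card : ℝ) ≤ 2 * m := by rw [hk]; exact_mod_cast (by omega)
  calc (S.card : ℝ) ^ 4 ≤ (2 * m) ^ 4 := by gcongr
    _ = 16 * (m : ℝ) ^ 4 := by ring
    _ ≤ _ := by linarith

open Classical in
noncomputable def curvePts (a : ℕ → ℝ) (n : ℕ) (g : ℝ × ℝ × ℝ × ℝ) : Finset Pt :=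
  (Grid n).filter fun p => OnC g (a p.1) (a p.2)

theorem energy_curves (a : ℕ → ℝ) (ha : StrictMono a) (n : ℕ) (G : Finset (ℝ × ℝ × ℝ × ℝ))
    (hG : ∀ g ∈ G, 4 ≤ (curvePts a n g).card) :
    ∑ g ∈ G, ((curvePts a n g).card : ℝ) ^ 4 ≤ 2048 * (n : ℝ) ^ 6 := by
  classical
  have hmem : ∀ g p, p ∈ curvePts a n g ↔ p ∈ Grid n ∧ OnC g (a p.1) (a p.2) := by
    intro g p; simp [curvePts]
  calc ∑ g ∈ G, ((curvePts a n g).card : ℝ) ^ 4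
      ≤ ∑ g ∈ G, 16 * (4 * (n : ℝ)) ^ 3 * ∑ t ∈ (Tri n).filter (fun t => t.1 ∈ curvePts a n g ∧
          t.2.1 ∈ curvePts a n g ∧ t.2.2 ∈ curvePts a n g), wt t := by
        apply Finset.sum_le_sum
        intro g hg
        apply chain_bound n _ (Finset.filter_subset _ _) _ _ (hG g hg)
        · intro p hp q hq h
          have := onC_mono ((hmem g p).1 hp).2 ((hmem g q).1 hq).2 (ha h)
          exact ha.lt_iff_lt.1 this
        · intro p hp q hq h
          have h1 := ((hmem g p).1 hp).2
          rw [h] at h1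
          have := onC_fun h1 ((hmem g q).1 hq).2
          exact Prod.ext h (ha.injective this)
    _ = 16 * (4 * (n : ℝ)) ^ 3 * ∑ t ∈ Tri n, ∑ g ∈ G, if (t.1 ∈ curvePts a n g ∧
          t.2.1 ∈ curvePts a n g ∧ t.2.2 ∈ curvePts a n g) then wt t else 0 := by
        rw [← Finset.mul_sum, Finset.sum_comm]
        simp only [Finset.sum_filter]
    _ ≤ 16 * (4 * (n : ℝ)) ^ 3 * ∑ t ∈ Tri n, wt t := by
        gcongr with t ht
        rw [← Finset.sum_filter, Finset.sum_const, nsmul_eq_mul]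
        have : (G.filter fun g => t.1 ∈ curvePts a n g ∧
          t.2.1 ∈ curvePts a n g ∧ t.2.2 ∈ curvePts a n g).card ≤ 1 := by
          rw [Finset.card_le_one]
          intro g hg k hk
          simp only [Finset.mem_filter, hmem] at hg hk
          simp only [Tri, Finset.mem_filter] at ht
          exact onC_unique (ha ht.2.1) (ha ht.2.2.1) hg.2.1.2 hg.2.2.1.2 hg.2.2.2.2
            hk.2.1.2 hk.2.2.1.2 hk.2.2.2.2
        have h1 : ((G.filter fun g => t.1 ∈ curvePts a n g ∧
          t.2.1 ∈ curvePts a n g ∧ t.2.2 ∈ curvePts a n g).card : ℝ) ≤ 1 := by exact_mod_cast this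
        exact mul_le_of_le_one_left (wt_nonneg t) h1
    _ ≤ 16 * (4 * (n : ℝ)) ^ 3 * (2 * (n : ℝ) ^ 3) := by
        gcongr
        exact sum_wt n
    _ = 2048 * (n : ℝ) ^ 6 := by ring

abbrev Qd := ℕ × ℕ × ℕ × ℕ

noncomputable def xr (a : ℕ → ℝ) (q : Qd) : ℝ :=
  ((a q.1 - a q.2.1) * (a q.2.2.1 - a q.2.2.2)) / ((a q.2.1 - a q.2.2.1) * (a q.1 - a q.2.2.2))

def Inc (n : ℕ) (q : Qd) : Prop := q.1 < q.2.1 ∧ q.2.1 < q.2.2.1 ∧ q.2.2.1 < q.2.2.2 ∧ q.2.2.2 < n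

theorem energy (a : ℕ → ℝ) (ha : StrictMono a) (n : ℕ) (E : Finset (Qd × Qd))
    (hE : ∀ e ∈ E, Inc n e.1 ∧ Inc n e.2 ∧ xr a e.1 = xr a e.2) :
    (E.card : ℝ) ≤ 2048 * (n : ℝ) ^ 6 := by
  classical
  have hmem : ∀ g p, p ∈ curvePts a n g ↔ p ∈ Grid n ∧ OnC g (a p.1) (a p.2) := by
    intro g p; simp [curvePts]
  have hex : ∀ e : Qd × Qd, ∃ g, e ∈ E → ((e.1.1, e.2.1) ∈ curvePts a n g ∧
      (e.1.2.1, e.2.2.1) ∈ curvePts a n g ∧ (e.1.2.2.1, e.2.2.2.1) ∈ curvePts a n g ∧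
      (e.1.2.2.2, e.2.2.2.2) ∈ curvePts a n g) := by
    intro e
    by_cases he : e ∈ E
    · obtain ⟨⟨h1, h2, h3, h4⟩, ⟨k1, k2, k3, k4⟩, h⟩ := hE e he
      obtain ⟨g, g1, g2, g3, g4⟩ := onC_exists (ha h1) (ha h2) (ha h3) (ha k1) (ha k2) (ha k3) h
      refine ⟨g, fun _ => ?_⟩
      simp only [hmem, Grid, Finset.mem_product, Finset.mem_range]
      refine ⟨⟨⟨?_, ?_⟩, g1⟩, ⟨⟨?_, ?_⟩, g2⟩, ⟨⟨?_, ?_⟩, g3⟩, ⟨⟨?_, ?_⟩, g4⟩⟩ <;> omega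
    · exact ⟨0, fun h => absurd h he⟩
  choose g hg using hex
  let ψ : Qd × Qd → Pt × Pt × Pt × Pt := fun e =>
    ((e.1.1, e.2.1), (e.1.2.1, e.2.2.1), (e.1.2.2.1, e.2.2.2.1), (e.1.2.2.2, e.2.2.2.2))
  have hψ : Function.Injective ψ := by
    rintro ⟨⟨a1, a2, a3, a4⟩, b1, b2, b3, b4⟩ ⟨⟨a1', a2', a3', a4'⟩, b1', b2', b3', b4'⟩ h
    simp only [ψ, Prod.mk.injEq] at h ⊢
    tauto
  let P4 : ℝ × ℝ × ℝ × ℝ → Finset (Pt × Pt × Pt × Pt) := fun g =>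
    curvePts a n g ×ˢ curvePts a n g ×ˢ curvePts a n g ×ˢ curvePts a n g
  have hsub : E.image ψ ⊆ (E.image g).biUnion P4 := by
    intro s hs
    obtain ⟨e, he, rfl⟩ := Finset.mem_image.1 hs
    refine Finset.mem_biUnion.2 ⟨g e, Finset.mem_image_of_mem _ he, ?_⟩
    simp only [P4, ψ, Finset.mem_product]
    exact hg e he
  have hcard : E.card ≤ ∑ k ∈ E.image g, (curvePts a n k).card ^ 4 := by
    rw [← Finset.card_image_of_injective E hψ]
    refine (Finset.card_le_card hsub).trans (Finset.card_biUnion_le.trans (le_of_eq ?_))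
    apply Finset.sum_congr rfl
    intro k _
    simp only [P4, Finset.card_product]
    ring
  have h4 : ∀ k ∈ E.image g, 4 ≤ (curvePts a n k).card := by
    intro k hk
    obtain ⟨e, he, rfl⟩ := Finset.mem_image.1 hk
    obtain ⟨m1, m2, m3, m4⟩ := hg e he
    obtain ⟨⟨h1, h2, h3, h4⟩, -, -⟩ := hE e he
    have hs : ({(e.1.1, e.2.1), (e.1.2.1, e.2.2.1), (e.1.2.2.1, e.2.2.2.1),
        (e.1.2.2.2, e.2.2.2.2)} : Finset Pt) ⊆ curvePts a n (g e) := by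
      intro x hx
      simp only [Finset.mem_insert, Finset.mem_singleton] at hx
      rcases hx with rfl | rfl | rfl | rfl <;> assumption
    refine le_trans (le_of_eq ?_) (Finset.card_le_card hs)
    rw [Finset.card_insert_of_notMem, Finset.card_insert_of_notMem, Finset.card_insert_of_notMem,
      Finset.card_singleton]
    all_goals
      simp only [Finset.mem_insert, Finset.mem_singleton, Prod.mk.injEq]
      omega
  refine le_trans ?_ (energy_curves a ha n _ h4)
  exact_mod_cast hcard

theorem cs_bound (a : ℕ → ℝ) (ha : StrictMono a) (n : ℕ) (Q : Finset Qd) (hQ : ∀ q ∈ Q, Inc n q)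
    (H : Finset ℝ) (hH : ∀ q ∈ Q, xr a q ∈ H) :
    (Q.card : ℝ) ^ 2 ≤ H.card * (2048 * (n : ℝ) ^ 6) := by
  classical
  let E : Finset (Qd × Qd) := H.biUnion fun z =>
    (Q.filter fun q => xr a q = z) ×ˢ (Q.filter fun q => xr a q = z)
  have hE : (E.card : ℝ) ≤ 2048 * (n : ℝ) ^ 6 := by
    apply energy a ha n E
    intro e he
    obtain ⟨z, -, hz⟩ := Finset.mem_biUnion.1 he
    simp only [Finset.mem_product, Finset.mem_filter] at hz
    exact ⟨hQ _ hz.1.1, hQ _ hz.2.1, hz.1.2.trans hz.2.2.symm⟩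
  have hEc : E.card = ∑ z ∈ H, (Q.filter fun q => xr a q = z).card ^ 2 := by
    rw [Finset.card_biUnion]
    · simp only [Finset.card_product, sq]
    · intro z _ z' _ hne
      apply Finset.disjoint_left.2
      intro e h1 h2
      simp only [Finset.mem_product, Finset.mem_filter] at h1 h2
      exact hne (h1.1.2.symm.trans h2.1.2)
  have hc : Q.card = ∑ z ∈ H, (Q.filter fun q => xr a q = z).card :=
    Finset.card_eq_sum_card_fiberwise hH
  have h2 : (Q.card : ℝ) ^ 2 ≤ H.card * (E.card : ℝ) := by
    rw [hEc]
    nth_rewrite 1 [hc]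
    push_cast
    exact sq_sum_le_card_mul_sum_sq
  exact h2.trans (by gcongr)

theorem exists_seq (A : Finset ℝ) : ∃ a : ℕ → ℝ, StrictMono a ∧ ∀ i < A.card, a i ∈ A := by
  let e := A.orderEmbOfFin rfl
  obtain ⟨M, hM⟩ := A.bddAbove
  refine ⟨fun i => if h : i < A.card then e ⟨i, h⟩ else M + i + 1, ?_, ?_⟩
  · intro i j hij
    by_cases hj : j < A.card
    · have hi : i < A.card := by omega
      simp only [hi, hj, dif_pos]
      exact e.strictMono hij
    · by_cases hi : i < A.card
      · simp only [hi, hj, dif_pos, dif_neg, not_false_eq_true]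
        have h1 : e ⟨i, hi⟩ ≤ M := hM (Finset.orderEmbOfFin_mem A rfl _)
        have : (0 : ℝ) ≤ j := Nat.cast_nonneg _
        linarith
      · simp only [hi, hj, dif_neg, not_false_eq_true]
        have : (i : ℝ) < j := by exact_mod_cast hij
        linarith
  · intro i hi
    simp only [hi, dif_pos]
    exact Finset.orderEmbOfFin_mem A rfl _

theorem main_bound (A : Finset ℝ) (h4 : 4 ≤ A.card) (H : Finset ℝ)
    (hH : ∀ a ∈ A, ∀ b ∈ A, ∀ c ∈ A, ∀ d ∈ A, b ≠ c → a ≠ d →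
      ((a - b) * (c - d)) / ((b - c) * (a - d)) ∈ H) :
    1 / (2048 * 7 ^ 8) * (A.card : ℝ) ^ 2 ≤ H.card := by
  obtain ⟨a, ha, haA⟩ := exists_seq A
  set n := A.card with hn
  obtain ⟨m, hm⟩ : ∃ m, m = n / 4 := ⟨_, rfl⟩
  let Q : Finset Qd := Finset.Ico 0 m ×ˢ Finset.Ico m (2 * m) ×ˢ Finset.Ico (2 * m) (3 * m) ×ˢ
    Finset.Ico (3 * m) (4 * m)
  have hQ : ∀ q ∈ Q, Inc n q := by
    intro q hq
    simp only [Q, Finset.mem_product, Finset.mem_Ico] at hq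
    simp only [Inc]
    omega
  have hQc : Q.card = m ^ 4 := by
    simp only [Q, Finset.card_product, Nat.card_Ico]
    have h1 : 2 * m - m = m := by omega
    have h2 : 3 * m - 2 * m = m := by omega
    have h3 : 4 * m - 3 * m = m := by omega
    rw [h1, h2, h3, Nat.sub_zero]
    ring
  have h := cs_bound a ha n Q hQ H (by
    intro q hq
    obtain ⟨h1, h2, h3, h4⟩ := hQ q hq
    exact hH _ (haA _ (by omega)) _ (haA _ (by omega)) _ (haA _ (by omega)) _ (haA _ (by omega))
      (ha h2).ne (ha (by omega)).ne)
  rw [hQc] at h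
  push_cast at h
  have hm0 : (0 : ℝ) < m := by exact_mod_cast (by omega : 0 < m)
  have hnm : (n : ℝ) ≤ 7 * m := by exact_mod_cast (by omega : n ≤ 7 * m)
  have h1 : (m : ℝ) ^ 2 * m ^ 6 ≤ (H.card * (2048 * 7 ^ 6)) * m ^ 6 := by
    calc (m : ℝ) ^ 2 * m ^ 6 = ((m : ℝ) ^ 4) ^ 2 := by ring
      _ ≤ H.card * (2048 * (n : ℝ) ^ 6) := h
      _ ≤ H.card * (2048 * (7 * m : ℝ) ^ 6) := by gcongr
      _ = _ := by ring
  have h2 := le_of_mul_le_mul_right h1 (by positivity)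
  calc 1 / (2048 * 7 ^ 8) * (n : ℝ) ^ 2 ≤ 1 / (2048 * 7 ^ 8) * (7 * m : ℝ) ^ 2 := by gcongr
    _ = 1 / (2048 * 7 ^ 6) * (m : ℝ) ^ 2 := by ring
    _ ≤ 1 / (2048 * 7 ^ 6) * (H.card * (2048 * 7 ^ 6)) := by gcongr
    _ = H.card := by ring

theorem stmt4 :
    ∃ c : ℝ, 0 < c ∧
      ∀ A : Finset ℝ, 2 ≤ A.card →
        c * (A.card : ℝ) ^ 2 ≤
          (({z : ℝ | ∃ a ∈ A, ∃ b ∈ A, ∃ c' ∈ A, ∃ d ∈ A, b ≠ c' ∧ a ≠ d ∧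
              z = ((a - b) * (c' - d)) / ((b - c') * (a - d))}.ncard : ℕ) : ℝ) := by
  refine ⟨1 / (2048 * 7 ^ 8), by positivity, ?_⟩
  intro A hA
  set Z := {z : ℝ | ∃ a ∈ A, ∃ b ∈ A, ∃ c' ∈ A, ∃ d ∈ A, b ≠ c' ∧ a ≠ d ∧
              z = ((a - b) * (c' - d)) / ((b - c') * (a - d))} with hZ
  have hfin : Z.Finite := by
    apply ((A ×ˢ A ×ˢ A ×ˢ A).finite_toSet.image (fun q : ℝ × ℝ × ℝ × ℝ =>
      ((q.1 - q.2.1) * (q.2.2.1 - q.2.2.2)) / ((q.2.1 - q.2.2.1) * (q.1 - q.2.2.2)))).subset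
    rintro z ⟨a, ha, b, hb, c, hc, d, hd, -, -, rfl⟩
    exact ⟨(a, b, c, d), by simp [ha, hb, hc, hd], rfl⟩
  rw [Set.ncard_eq_toFinset_card Z hfin]
  by_cases h4 : 4 ≤ A.card
  · apply main_bound A h4
    intro a ha b hb c hc d hd h1 h2
    rw [Set.Finite.mem_toFinset]
    exact ⟨a, ha, b, hb, c, hc, d, hd, h1, h2, rfl⟩
  · obtain ⟨x, hx, y, hy, hxy⟩ := Finset.one_lt_card.1 hA
    have hpos : 1 ≤ hfin.toFinset.card := by
      apply Finset.card_pos.2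
      exact ⟨_, hfin.mem_toFinset.2 ⟨x, hx, x, hx, y, hy, y, hy, hxy, hxy, rfl⟩⟩
    have h1 : (1 : ℝ) ≤ hfin.toFinset.card := by exact_mod_cast hpos
    have h2 : (A.card : ℝ) ≤ 4 := by exact_mod_cast (by omega : A.card ≤ 4)
    calc 1 / (2048 * 7 ^ 8) * (A.card : ℝ) ^ 2 ≤ 1 / (2048 * 7 ^ 8) * (4 : ℝ) ^ 2 := by gcongr
      _ ≤ 1 := by norm_num
      _ ≤ _ := h1
end

section
/- Let q be a prime power and F_q(t) the field of rational functions over the finite field F_q. For every ε > 0 there exists a constant c > 0 (depending on q and ε) such that for every finite nonempty set A ⊆ F_q(t), |A + A|³ · |A·A|² ≥ c·|A|^(6 − ε). -/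
open scoped Pointwise

section helpers
open Finset

lemma subset_sum_inj {K Γ : Type*} [Field K] [LinearOrderedCommGroupWithZero Γ]
    [DecidableEq K] (v : Valuation K Γ) (U : Finset K) (u0 : K)
    (hU : Set.InjOn (fun x => v (x - u0)) (U : Set K)) (k : ℕ) :
    Set.InjOn (fun S : Finset K => ∑ x ∈ S, x) (U.powersetCard k : Set (Finset K)) := by
  have key : ∀ S T : Finset K, S ⊆ U → T ⊆ U → (S \ T).Nonempty → (T \ S).Nonempty →
      ∑ x ∈ S \ T, (x - u0) = ∑ x ∈ T \ S, (x - u0) →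
      (∃ m ∈ S \ T, ∀ y ∈ (S \ T) ∪ (T \ S), v (y - u0) ≤ v (m - u0)) → False := by
    intro S T hS hT _ hne2 hsum ⟨m, hm, hmax⟩
    have hmU : m ∈ U := hS (mem_sdiff.1 hm).1
    have hlt : ∀ y ∈ (S \ T) ∪ (T \ S), y ≠ m → v (y - u0) < v (m - u0) := by
      intro y hy hym
      refine lt_of_le_of_ne (hmax y hy) fun h => hym ?_
      refine hU ?_ hmU h
      rcases mem_union.1 hy with h | h
      · exact hS (mem_sdiff.1 h).1
      · exact hT (mem_sdiff.1 h).1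
    have hT2 : ∀ y ∈ T \ S, v (y - u0) < v (m - u0) := by
      intro y hy
      refine hlt y (mem_union_right _ hy) ?_
      rintro rfl
      exact (mem_sdiff.1 hy).2 (mem_sdiff.1 hm).1
    obtain ⟨y, hy⟩ := hne2
    have h0 : v (m - u0) ≠ 0 := ne_of_gt (lt_of_le_of_lt zero_le (hT2 y hy))
    have h1 : v (∑ x ∈ S \ T, (x - u0)) = v (m - u0) := by
      refine v.map_sum_eq_of_lt (f := fun x => x - u0) hm ?_
      intro i hi
      rw [mem_sdiff, mem_singleton] at hi
      exact hlt i (mem_union_left _ hi.1) hi.2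
    have h2 : v (∑ x ∈ T \ S, (x - u0)) < v (m - u0) := v.map_sum_lt h0 hT2
    rw [← hsum, h1] at h2
    exact lt_irrefl _ h2
  intro S hS T hT hST
  dsimp only at hST
  by_contra hne
  rw [mem_coe, mem_powersetCard] at hS hT
  have n1 : (S \ T).Nonempty := by
    rw [sdiff_nonempty]
    intro h
    exact hne (eq_of_subset_of_card_le h (by omega))
  have n2 : (T \ S).Nonempty := by
    rw [sdiff_nonempty]
    intro h
    exact hne (eq_of_subset_of_card_le h (by omega)).symm
  have hsum : ∑ x ∈ S \ T, (x - u0) = ∑ x ∈ T \ S, (x - u0) := by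
    have e : ∑ x ∈ S, (x - u0) = ∑ x ∈ T, (x - u0) := by
      rw [sum_sub_distrib, sum_sub_distrib, hST, sum_const, sum_const, hS.2, hT.2]
    rw [← sum_inter_add_sum_sdiff S T, ← sum_inter_add_sum_sdiff T S, inter_comm T S] at e
    exact add_left_cancel e
  obtain ⟨m, hm, hmax⟩ := exists_max_image ((S \ T) ∪ (T \ S)) (fun x => v (x - u0))
    (n1.mono subset_union_left)
  rcases mem_union.1 hm with h | h
  · exact key S T hS.1 hT.1 n1 n2 hsum ⟨m, h, hmax⟩
  · exact key T S hT.1 hS.1 n2 n1 hsum.symm ⟨m, h, fun y hy => hmax y (by rwa [union_comm])⟩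

lemma chain_bound_s5 {K Γ : Type*} [Field K] [LinearOrderedCommGroupWithZero Γ]
    [DecidableEq K] (v : Valuation K Γ) (A U : Finset K) (hUA : U ⊆ A) (hA : A.Nonempty) (u0 : K)
    (hU : Set.InjOn (fun x => v (x - u0)) (U : Set K)) (k : ℕ) (hk : 0 < k) :
    (U.card : ℝ) ≤ 2 * k * (((A + A).card : ℝ) / A.card) * (A.card : ℝ) ^ ((1 : ℝ) / k) := by
  have h1 : (U.card.choose k) ≤ (k • A).card := by
    rw [← card_powersetCard, ← card_image_of_injOn (subset_sum_inj v U u0 hU k)]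
    apply card_le_card
    intro z hz
    obtain ⟨S, hS, rfl⟩ := mem_image.1 hz
    rw [mem_powersetCard] at hS
    rw [← hS.2]
    have : ∀ S : Finset K, S ⊆ A → ∑ x ∈ S, x ∈ S.card • A := by
      intro S
      induction S using Finset.induction_on with
      | empty => intro _; simp
      | insert a S ha ih =>
        intro h
        rw [sum_insert ha, card_insert_of_notMem ha, succ_nsmul']
        exact add_mem_add (h (mem_insert_self _ _)) (ih ((subset_insert _ _).trans h))
    exact this S (hS.1.trans hUA)
  have h2 : ((k • A).card : ℝ) ≤ (((A + A).card : ℝ) / A.card) ^ k * A.card := by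
    have := pluennecke_ruzsa_inequality_nsmul_add hA A k
    have h := (NNRat.cast_le (K := ℝ)).2 this
    push_cast at h
    exact h
  have hA0 : (1 : ℝ) ≤ A.card := by exact_mod_cast hA.card_pos
  have hAA : (A.card : ℝ) ≤ (A + A).card := by exact_mod_cast card_le_card_add_self
  set R : ℝ := ((A + A).card : ℝ) / A.card with hR
  have hR1 : 1 ≤ R := by rw [hR, le_div_iff₀ (by linarith)]; linarith
  set e : ℝ := (A.card : ℝ) ^ ((1 : ℝ) / k) with he
  have he1 : 1 ≤ e := Real.one_le_rpow hA0 (by positivity)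
  have hek : e ^ k = A.card := by
    rw [he, ← Real.rpow_natCast, ← Real.rpow_mul (by linarith), one_div,
      inv_mul_cancel₀ (by positivity), Real.rpow_one]
  have h3 : ((U.card + 1 - k : ℕ) : ℝ) ^ k ≤ (k * R * e) ^ k := by
    have h4 := Nat.pow_le_choose (α := ℝ) k U.card
    rw [div_le_iff₀ (by positivity)] at h4
    have h5 : (k.factorial : ℝ) ≤ (k : ℝ) ^ k := by exact_mod_cast Nat.factorial_le_pow k
    calc ((U.card + 1 - k : ℕ) : ℝ) ^ k ≤ (U.card.choose k : ℝ) * k.factorial := h4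
      _ ≤ (R ^ k * A.card) * (k : ℝ) ^ k := by
        have : (U.card.choose k : ℝ) ≤ (k • A).card := by exact_mod_cast h1
        gcongr
        linarith
      _ = _ := by rw [mul_pow, mul_pow, hek]; ring
  have h6 : ((U.card + 1 - k : ℕ) : ℝ) ≤ k * R * e :=
    le_of_pow_le_pow_left₀ hk.ne' (by positivity) h3
  have h7 : (U.card : ℝ) + 1 ≤ ((U.card + 1 - k : ℕ) : ℝ) + k := by
    exact_mod_cast (by omega : U.card + 1 ≤ U.card + 1 - k + k)
  have h8 : (k : ℝ) ≤ k * R * e := by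
    have : 1 ≤ R * e := one_le_mul_of_one_le_of_one_le hR1 he1
    have hk' : (0 : ℝ) ≤ k := by positivity
    nlinarith
  linarith

lemma residue_exists (F : Type*) [Field F] [DecidableEq (RatFunc F)] (f : RatFunc F)
    (hf : RatFunc.inftyValuation F f ≤ 1) :
    ∃ c : F, RatFunc.inftyValuation F (f - RatFunc.C c) < 1 := by
  by_cases h0 : f = 0
  · exact ⟨0, by simp [h0]⟩
  rcases hf.lt_or_eq with h | h
  · exact ⟨0, by simpa using h⟩
  refine ⟨f.num.leadingCoeff / f.denom.leadingCoeff, ?_⟩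
  set c := f.num.leadingCoeff / f.denom.leadingCoeff with hc
  have hn : f.num ≠ 0 := RatFunc.num_ne_zero h0
  have hd : f.denom ≠ 0 := f.denom_ne_zero
  have hc0 : c ≠ 0 := div_ne_zero (by simpa) (by simpa)
  have hdeg : f.num.natDegree = f.denom.natDegree := by
    rw [RatFunc.inftyValuation_apply, RatFunc.inftyValuation_of_nonzero _ h0,
      ← WithZero.exp_zero, WithZero.exp_inj, RatFunc.intDegree] at h
    omega
  have hv : ∀ p : Polynomial F, p ≠ 0 → RatFunc.inftyValuation F
      (algebraMap (Polynomial F) (RatFunc F) p) = WithZero.exp (p.natDegree : ℤ) := fun p hp => by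
    rw [RatFunc.inftyValuation_apply]; exact RatFunc.inftyValuation.polynomial F hp
  have hd' : algebraMap (Polynomial F) (RatFunc F) f.denom ≠ 0 := by simpa using hd
  have heq : f - RatFunc.C c = algebraMap (Polynomial F) (RatFunc F)
      (f.num - Polynomial.C c * f.denom) / algebraMap (Polynomial F) (RatFunc F) f.denom := by
    rw [eq_div_iff hd', sub_mul, map_sub, map_mul, RatFunc.algebraMap_C]
    congr 1
    nth_rewrite 1 [← RatFunc.num_div_denom f]
    rw [div_mul_cancel₀ _ hd']
  rw [heq, map_div₀]
  by_cases hp : f.num - Polynomial.C c * f.denom = 0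
  · simp [hp]
  have hlt : (f.num - Polynomial.C c * f.denom).degree < f.num.degree := by
    refine Polynomial.degree_sub_lt_left ?_ hn ?_
    · rw [Polynomial.degree_C_mul hc0, Polynomial.degree_eq_natDegree hn,
        Polynomial.degree_eq_natDegree hd, hdeg]
    · rw [Polynomial.leadingCoeff_mul, Polynomial.leadingCoeff_C, hc,
        div_mul_cancel₀ _ (by simpa)]
  have hlt' := Polynomial.natDegree_lt_natDegree hp hlt
  rw [hv _ hp, hv _ hd, ← WithZero.exp_sub, ← WithZero.exp_zero, WithZero.exp_lt_exp]
  omega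

lemma equidistant_card (F : Type*) [Field F] [Fintype F] [DecidableEq (RatFunc F)]
    (S : Finset (RatFunc F)) (r : WithZero (Multiplicative ℤ))
    (hS : ∀ x ∈ S, ∀ y ∈ S, x ≠ y → RatFunc.inftyValuation F (x - y) = r) :
    S.card ≤ Fintype.card F := by
  classical
  set v := RatFunc.inftyValuation F
  rcases Nat.lt_or_ge 1 S.card with h1 | h1
  swap
  · exact h1.trans Fintype.card_pos
  obtain ⟨x0, hx0, x1, hx1, hne⟩ := one_lt_card.1 h1
  have hr : v (x1 - x0) = r := hS _ hx1 _ hx0 hne.symm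
  have hr0 : r ≠ 0 := by
    rw [← hr]; exact v.ne_zero_iff.2 (sub_ne_zero.2 hne.symm)
  have hex : ∀ x ∈ S, ∃ c : F, v ((x - x0) / (x1 - x0) - RatFunc.C c) < 1 := by
    intro x hx
    apply residue_exists
    change v _ ≤ 1
    rw [map_div₀, hr]
    by_cases hxx : x = x0
    · simp [hxx]
    · rw [hS x hx x0 hx0 hxx, div_self hr0]
  choose! c hc using hex
  rw [← card_univ]
  refine card_le_card_of_injOn c (fun _ _ => mem_univ _) ?_
  intro x hx y hy hxy
  by_contra hxyne
  have h3 := v.map_sub_lt (hc x hx) (hc y hy)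
  rw [hxy, sub_sub_sub_cancel_right, ← sub_div, sub_sub_sub_cancel_right, map_div₀, hr,
    hS x hx y hy hxyne, div_self hr0] at h3
  exact lt_irrefl _ h3

end helpers


section helpers2
open Finset

lemma pair_count {K Γ : Type*} [Field K] [LinearOrderedCommGroupWithZero Γ]
    [DecidableEq K] (v : Valuation K Γ) (X : Finset K) (T : ℝ) (hT : 0 ≤ T) :
    (((X ×ˢ X).filter (fun p : K × K =>
      ((X.filter (fun z => v (z - p.1) ≤ v (p.2 - p.1))).card : ℝ) ≤ T)).card : ℝ)
      ≤ X.card * T := by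
  have h : ∀ u ∈ X, ((X.filter (fun u' =>
      ((X.filter (fun z => v (z - u) ≤ v (u' - u))).card : ℝ) ≤ T)).card : ℝ) ≤ T := by
    intro u hu
    set Y := X.filter (fun u' => ((X.filter (fun z => v (z - u) ≤ v (u' - u))).card : ℝ) ≤ T)
      with hY
    rcases Y.eq_empty_or_nonempty with h | h
    · rw [h]; simpa using hT
    obtain ⟨m, hm, hmax⟩ := exists_max_image Y (fun x => v (x - u)) h
    have hm' := (mem_filter.1 hm).2
    refine le_trans ?_ hm'
    have : Y ⊆ X.filter (fun z => v (z - u) ≤ v (m - u)) := fun z hz =>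
      mem_filter.2 ⟨(mem_filter.1 hz).1, hmax z hz⟩
    exact_mod_cast card_le_card this
  rw [card_filter, sum_product]
  push_cast
  calc _ ≤ ∑ u ∈ X, T := by
        refine sum_le_sum fun u hu => ?_
        have := h u hu
        rw [card_filter] at this
        push_cast at this
        exact this
    _ = _ := by simp

lemma markov_good {ι : Type*} (A1 : Finset ι) (f g : ι → ℝ) (P Q : ℝ)
    (hf0 : ∀ a ∈ A1, 0 ≤ f a) (hg0 : ∀ a ∈ A1, 0 ≤ g a) (hP : 0 < P) (hQ : 0 < Q)
    (hf : ∑ a ∈ A1, f a ≤ P) (hg : ∑ a ∈ A1, g a ≤ Q) (hA1 : A1.Nonempty) :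
    (A1.card : ℝ) / 2 ≤
      (A1.filter (fun a => f a ≤ 4 * P / A1.card ∧ g a ≤ 4 * Q / A1.card)).card := by
  have hn : (0 : ℝ) < A1.card := by exact_mod_cast hA1.card_pos
  have h1 : ∀ a ∈ A1, (1 : ℝ) - (A1.card / (4 * P)) * f a - (A1.card / (4 * Q)) * g a ≤
      if (f a ≤ 4 * P / A1.card ∧ g a ≤ 4 * Q / A1.card) then 1 else 0 := by
    intro a ha
    have e1 : 0 ≤ (A1.card / (4 * P)) * f a := mul_nonneg (by positivity) (hf0 a ha)
    have e2 : 0 ≤ (A1.card / (4 * Q)) * g a := mul_nonneg (by positivity) (hg0 a ha)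
    split_ifs with h
    · linarith
    · rw [not_and_or, not_le, not_le] at h
      rcases h with h | h
      · have : 1 ≤ (A1.card / (4 * P)) * f a := by
          rw [div_lt_iff₀ hn] at h
          rw [div_mul_eq_mul_div, le_div_iff₀ (by positivity)]; linarith
        linarith
      · have : 1 ≤ (A1.card / (4 * Q)) * g a := by
          rw [div_lt_iff₀ hn] at h
          rw [div_mul_eq_mul_div, le_div_iff₀ (by positivity)]; linarith
        linarith
  have h2 := sum_le_sum h1
  rw [sum_sub_distrib, sum_sub_distrib, ← mul_sum, ← mul_sum] at h2
  rw [card_filter]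
  push_cast
  refine le_trans ?_ h2
  have e1 : (A1.card / (4 * P)) * ∑ a ∈ A1, f a ≤ A1.card / 4 := by
    calc _ ≤ (A1.card / (4 * P)) * P := by gcongr
      _ = _ := by field_simp
  have e2 : (A1.card / (4 * Q)) * ∑ a ∈ A1, g a ≤ A1.card / 4 := by
    calc _ ≤ (A1.card / (4 * Q)) * Q := by gcongr
      _ = _ := by field_simp
  simp only [sum_const, nsmul_eq_mul, mul_one]
  linarith

lemma quad_inj {K : Type*} [Field K] {a a' b c a2 a2' b2 c2 : K} (hc0 : c ≠ 0) (hne : a' ≠ a)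
    (h1 : a + b = a2 + b2) (h2 : a' + b = a2' + b2) (h3 : a * c = a2 * c2)
    (h4 : a' * c = a2' * c2) : a = a2 ∧ a' = a2' ∧ b = b2 ∧ c = c2 := by
  have hd : a' - a = a2' - a2 := by linear_combination h2 - h1
  have hd0 : a' - a ≠ 0 := sub_ne_zero.2 hne
  have hcc : c = c2 := by
    apply mul_left_cancel₀ hd0
    linear_combination h4 - h3 - c2 * hd
  subst hcc
  have haa : a = a2 := mul_right_cancel₀ hc0 h3
  have haa' : a' = a2' := mul_right_cancel₀ hc0 h4
  subst haa haa'
  exact ⟨rfl, rfl, add_left_cancel h1, rfl⟩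

set_option maxHeartbeats 1000000 in
lemma solymosi {K Γ : Type*} [Field K] [LinearOrderedCommGroupWithZero Γ]
    [DecidableEq K] (v : Valuation K Γ) (A A1 : Finset K) (hA1 : A1 ⊆ A) (hne : A1.Nonempty)
    (hA2 : 2 ≤ A.card) (r : K → Γ) (n O : ℝ) (hO : 0 < O)
    (hn : ∀ a ∈ A1, n ≤ ((A.filter (fun a' => a' ≠ a ∧ v (a' - a) ≤ r a)).card : ℝ))
    (hover : ∀ x : K, ((A1.filter (fun a => v (x - a) ≤ r a)).card : ℝ) ≤ O) :
    n * (A1.card : ℝ) ^ 3 * (A.card : ℝ) ^ 2 ≤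
      64 * O ^ 2 * ((A + A).card : ℝ) ^ 2 * ((A * A).card : ℝ) ^ 2 := by
  have hAne : A.Nonempty := hne.mono hA1
  set S := A + A with hS
  set M := A * A with hM
  have hSne : S.Nonempty := hAne.add hAne
  have hMne : M.Nonempty := hAne.mul hAne
  have hSpos : (0 : ℝ) < S.card := by exact_mod_cast hSne.card_pos
  have hMpos : (0 : ℝ) < M.card := by exact_mod_cast hMne.card_pos
  have hA1pos : (0 : ℝ) < A1.card := by exact_mod_cast hne.card_pos
  set A0 := A.erase 0 with hA0
  have hA0card : (A.card : ℝ) / 2 ≤ A0.card := by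
    have : A.card ≤ A0.card + 1 := by
      rw [hA0]; have := pred_card_le_card_erase (s := A) (a := (0 : K)); omega
    have h2 : A.card ≤ 2 * A0.card := by omega
    have : (A.card : ℝ) ≤ 2 * A0.card := by exact_mod_cast h2
    linarith
  let f : K → K → ℝ := fun b a => ((S.filter (fun z => v (z - (a + b)) ≤ r a)).card : ℝ)
  let g : K → K → ℝ := fun c a => ((M.filter (fun z => v (z - a * c) ≤ v c * r a)).card : ℝ)
  have hf : ∀ b, ∑ a ∈ A1, f b a ≤ O * S.card := by
    intro b
    calc ∑ a ∈ A1, f b a = ∑ z ∈ S, ((A1.filter (fun a => v ((z - b) - a) ≤ r a)).card : ℝ) := by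
          simp only [f, card_filter]
          push_cast
          rw [sum_comm]
          refine sum_congr rfl fun z _ => sum_congr rfl fun a _ => ?_
          rw [show z - (a + b) = z - b - a by ring]
      _ ≤ ∑ z ∈ S, O := sum_le_sum fun z _ => hover _
      _ = _ := by simp [mul_comm]
  have hg : ∀ c ∈ A0, ∑ a ∈ A1, g c a ≤ O * M.card := by
    intro c hc
    have hc0 : c ≠ 0 := (mem_erase.1 hc).1
    have hvc : 0 < v c := (v.pos_iff).2 hc0
    calc ∑ a ∈ A1, g c a = ∑ z ∈ M, ((A1.filter (fun a => v (z / c - a) ≤ r a)).card : ℝ) := by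
          simp only [g, card_filter]
          push_cast
          rw [sum_comm]
          refine sum_congr rfl fun z _ => sum_congr rfl fun a _ => ?_
          rw [show z - a * c = c * (z / c - a) by field_simp, map_mul]
          simp only [mul_le_mul_iff_right₀ hvc]
      _ ≤ ∑ z ∈ M, O := sum_le_sum fun z _ => hover _
      _ = _ := by simp [mul_comm]
  set T1 : ℝ := 4 * (O * S.card) / A1.card with hT1
  set T2 : ℝ := 4 * (O * M.card) / A1.card with hT2
  let G : K → K → Finset K := fun b c => A1.filter (fun a => f b a ≤ T1 ∧ g c a ≤ T2)
  have hG : ∀ b, ∀ c ∈ A0, (A1.card : ℝ) / 2 ≤ (G b c).card := by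
    intro b c hc
    exact markov_good A1 (f b) (g c) (O * S.card) (O * M.card) (fun _ _ => by positivity)
      (fun _ _ => by positivity) (by positivity) (by positivity) (hf b) (hg c hc) hne
  let N : K → Finset K := fun a => A.filter (fun a' => a' ≠ a ∧ v (a' - a) ≤ r a)
  let Q : Finset (Σ _ : K × K, Σ _ : K, K) :=
    (A ×ˢ A0).sigma (fun bc => (G bc.1 bc.2).sigma (fun a => N a))
  let P1 := (S ×ˢ S).filter (fun p : K × K =>
      ((S.filter (fun z => v (z - p.1) ≤ v (p.2 - p.1))).card : ℝ) ≤ T1)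
  let P2 := (M ×ˢ M).filter (fun p : K × K =>
      ((M.filter (fun z => v (z - p.1) ≤ v (p.2 - p.1))).card : ℝ) ≤ T2)
  have hP1 : (P1.card : ℝ) ≤ S.card * T1 := pair_count v S T1 (by positivity)
  have hP2 : (P2.card : ℝ) ≤ M.card * T2 := pair_count v M T2 (by positivity)
  have hQ : Q.card ≤ (P1 ×ˢ P2).card := by
    refine card_le_card_of_injOn (fun x => ((x.2.1 + x.1.1, x.2.2 + x.1.1),
      (x.2.1 * x.1.2, x.2.2 * x.1.2))) ?_ ?_
    · rintro ⟨⟨b, c⟩, ⟨a, a'⟩⟩ hx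
      simp only [Q, G, N, mem_coe, mem_sigma, mem_product, mem_filter] at hx
      obtain ⟨⟨hb, hc⟩, ⟨ha, hfa, hga⟩, ha', hne', hv⟩ := hx
      have hcA : c ∈ A := (mem_erase.1 hc).2
      simp only [P1, P2, mem_coe, mem_product, mem_filter]
      refine ⟨⟨⟨add_mem_add (hA1 ha) hb, add_mem_add ha' hb⟩, ?_⟩,
        ⟨⟨mul_mem_mul (hA1 ha) hcA, mul_mem_mul ha' hcA⟩, ?_⟩⟩
      · refine le_trans ?_ hfa
        simp only [f]
        norm_cast
        apply card_le_card
        intro z hz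
        rw [mem_filter] at hz ⊢
        refine ⟨hz.1, hz.2.trans ?_⟩
        rw [add_sub_add_right_eq_sub]; exact hv
      · refine le_trans ?_ hga
        simp only [g]
        norm_cast
        apply card_le_card
        intro z hz
        rw [mem_filter] at hz ⊢
        refine ⟨hz.1, hz.2.trans ?_⟩
        rw [← sub_mul, map_mul, mul_comm]
        gcongr
    · rintro ⟨⟨b, c⟩, ⟨a, a'⟩⟩ hx ⟨⟨b2, c2⟩, ⟨a2, a2'⟩⟩ hy hxy
      simp only [Q, G, N, mem_coe, mem_sigma, mem_product, mem_filter] at hx hy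
      obtain ⟨⟨hb, hc⟩, ⟨ha, hfa, hga⟩, ha', hne', hv⟩ := hx
      have hc0 : c ≠ 0 := (mem_erase.1 hc).1
      simp only [Prod.mk.injEq] at hxy
      obtain ⟨⟨h1, h2⟩, h3, h4⟩ := hxy
      obtain ⟨e1, e2, e3, e4⟩ := quad_inj hc0 hne' h1 h2 h3 h4
      rw [e1, e2, e3, e4]
  have hQ2 : (A.card : ℝ) * A0.card * (A1.card / 2 * n) ≤ Q.card := by
    have hQc : (Q.card : ℝ) = ∑ bc ∈ A ×ˢ A0, ∑ a ∈ G bc.1 bc.2, ((N a).card : ℝ) := by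
      rw [show Q.card = ∑ bc ∈ A ×ˢ A0, ∑ a ∈ G bc.1 bc.2, (N a).card by
        rw [card_sigma]; exact sum_congr rfl fun _ _ => card_sigma _ _]
      rw [Nat.cast_sum]
      exact sum_congr rfl fun _ _ => Nat.cast_sum _ _
    rw [hQc]
    clear_value Q
    by_cases hn0 : n < 0
    · calc _ ≤ (0 : ℝ) := by
            apply mul_nonpos_of_nonneg_of_nonpos (by positivity)
            apply mul_nonpos_of_nonneg_of_nonpos (by positivity) hn0.le
        _ ≤ _ := sum_nonneg fun _ _ => sum_nonneg fun _ _ => Nat.cast_nonneg _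
    push Not at hn0
    calc (A.card : ℝ) * A0.card * (A1.card / 2 * n)
          = ∑ bc ∈ A ×ˢ A0, ((A1.card : ℝ) / 2 * n) := by
          rw [sum_const, card_product, nsmul_eq_mul]; push_cast; ring
      _ ≤ _ := by
        refine sum_le_sum fun bc hbc => ?_
        rw [mem_product] at hbc
        calc (A1.card : ℝ) / 2 * n ≤ (G bc.1 bc.2).card * n := by
              gcongr; exact hG _ _ hbc.2
          _ = ∑ a ∈ G bc.1 bc.2, n := by simp
          _ ≤ _ := sum_le_sum fun a ha => hn a (mem_filter.1 ha).1
  have hQ3 : (Q.card : ℝ) ≤ (S.card * T1) * (M.card * T2) := by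
    calc (Q.card : ℝ) ≤ (P1.card : ℝ) * P2.card := by
          rw [card_product] at hQ; exact_mod_cast hQ
      _ ≤ _ := by gcongr
  by_cases hn0 : n < 0
  · calc _ ≤ (0 : ℝ) := by
          apply mul_nonpos_of_nonpos_of_nonneg _ (by positivity)
          apply mul_nonpos_of_nonpos_of_nonneg hn0.le (by positivity)
      _ ≤ _ := by positivity
  push Not at hn0
  have h5 : (A.card : ℝ) * (A.card / 2) * (A1.card / 2 * n) ≤ (S.card * T1) * (M.card * T2) := by
    refine le_trans ?_ (hQ2.trans hQ3)
    gcongr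
  have h6 : (S.card * T1) * (M.card * T2) * (A1.card : ℝ) ^ 2 =
      16 * O ^ 2 * (S.card : ℝ) ^ 2 * (M.card : ℝ) ^ 2 := by
    rw [hT1, hT2]; field_simp; ring
  have h7 := mul_le_mul_of_nonneg_right h5 (sq_nonneg (A1.card : ℝ))
  rw [h6] at h7
  nlinarith [h7]

end helpers2

section helpers3
open Finset

lemma overlap {K Γ : Type*} [Field K] [LinearOrderedCommGroupWithZero Γ]
    [DecidableEq K] (v : Valuation K Γ) (q : ℕ)
    (hq : ∀ (S : Finset K) (ρ : Γ), (∀ x ∈ S, ∀ y ∈ S, x ≠ y → v (x - y) = ρ) → S.card ≤ q)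
    (A A1 : Finset K) (hA1 : A1 ⊆ A) (r : K → Γ)
    (hmin : ∀ a ∈ A, ∀ a' ∈ A, a' ≠ a → r a ≤ v (a' - a)) (s : ℕ)
    (hs : ∀ a ∈ A1, s ≤ (A.filter (fun a' => v (a' - a) ≤ r a)).card ∧
      (A.filter (fun a' => v (a' - a) ≤ r a)).card < 2 * s) (x : K) :
    ∃ U : Finset K, ∃ u0 : K, U ⊆ A ∧ Set.InjOn (fun y => v (y - u0)) (U : Set K) ∧
      (A1.filter (fun a => v (x - a) ≤ r a)).card ≤ q * U.card ∧ U.card ≤ s := by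
  set O := A1.filter (fun a => v (x - a) ≤ r a) with hO
  have hOA : O ⊆ A1 := filter_subset _ _
  rcases O.eq_empty_or_nonempty with hOe | hOne
  · exact ⟨∅, 0, by simp, by simp, by simp [hOe], by simp⟩
  have htri : ∀ y ∈ O, ∀ z ∈ O, r y ≤ r z → v (y - z) ≤ r z := by
    intro y hy z hz hyz
    rw [show y - z = (x - z) - (x - y) by ring]
    exact v.map_sub_le (mem_filter.1 hz).2 ((mem_filter.1 hy).2.trans hyz)
  have heq : ∀ y ∈ O, ∀ z ∈ O, r y ≤ r z → y ≠ z → v (y - z) = r z := by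
    intro y hy z hz hyz hne
    exact le_antisymm (htri y hy z hz hyz)
      (hmin z (hA1 (hOA hz)) y (hA1 (hOA hy)) hne)
  have hfib : O.card ≤ q * (O.image r).card := by
    refine card_le_mul_card_image O q fun ρ _ => hq _ ρ ?_
    intro y hy z hz hne
    rw [mem_filter] at hy hz
    rw [heq y hy.1 z hz.1 (by rw [hy.2, hz.2]) hne, hz.2]
  have hrep : ∀ ρ ∈ O.image r, ∃ a ∈ O, r a = ρ := fun ρ h => by simpa using h
  choose! rep hrepO hrepr using hrep
  set U := (O.image r).image rep with hU
  have hUO : U ⊆ O := by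
    intro y hy
    obtain ⟨ρ, hρ, rfl⟩ := mem_image.1 hy
    exact hrepO ρ hρ
  have hUcard : U.card = (O.image r).card := by
    refine card_image_of_injOn fun ρ hρ ρ' hρ' h => ?_
    rw [← hrepr ρ hρ, ← hrepr ρ' hρ', h]
  have hUinj : ∀ y ∈ U, ∀ z ∈ U, r y = r z → y = z := by
    intro y hy z hz h
    obtain ⟨ρ, hρ, rfl⟩ := mem_image.1 hy
    obtain ⟨ρ', hρ', rfl⟩ := mem_image.1 hz
    rw [hrepr ρ hρ, hrepr ρ' hρ'] at h
    rw [h]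
  have hUne : U.Nonempty := (hOne.image r).image rep
  obtain ⟨u0, hu0, hu0min⟩ := exists_min_image U r hUne
  refine ⟨U, u0, hUO.trans (hOA.trans hA1), ?_, by rw [hUcard]; exact hfib, ?_⟩
  · intro y hy z hz h
    dsimp only at h
    have hval : ∀ y ∈ U, y ≠ u0 → v (y - u0) = r y := by
      intro y hy hne
      rw [v.map_sub_swap]
      exact heq u0 (hUO hu0) y (hUO hy) (hu0min y hy) hne.symm
    by_cases h1 : y = u0
    · rw [h1, sub_self, map_zero] at h
      rw [h1]
      exact (sub_eq_zero.1 (v.zero_iff.1 h.symm)).symm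
    by_cases h2 : z = u0
    · rw [h2, sub_self, map_zero] at h
      rw [h2]
      exact sub_eq_zero.1 (v.zero_iff.1 h)
    rw [hval y hy h1, hval z hz h2] at h
    exact hUinj y hy z hz h
  · have hlt : ∀ y ∈ U, ∀ z ∈ U, r y < r z →
        (A.filter (fun a' => v (a' - y) ≤ r y)).card <
          (A.filter (fun a' => v (a' - z) ≤ r z)).card := by
      intro y hy z hz h
      have hne : y ≠ z := fun e => by rw [e] at h; exact lt_irrefl _ h
      have hyz := heq y (hUO hy) z (hUO hz) h.le hne
      apply card_lt_card
      rw [ssubset_iff_of_subset]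
      · refine ⟨z, mem_filter.2 ⟨hA1 (hOA (hUO hz)), by simp⟩, fun hh => ?_⟩
        have := (mem_filter.1 hh).2
        rw [v.map_sub_swap, hyz] at this
        exact absurd h (not_lt.2 this)
      · intro w hw
        rw [mem_filter] at hw ⊢
        refine ⟨hw.1, ?_⟩
        rw [show w - z = (w - y) + (y - z) by ring]
        exact v.map_add_le (hw.2.trans h.le) hyz.le
    have : U.card ≤ (Finset.Ico s (2 * s)).card := by
      refine card_le_card_of_injOn (fun a => (A.filter (fun a' => v (a' - a) ≤ r a)).card) ?_ ?_
      · intro a ha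
        rw [mem_coe, mem_Ico]
        exact hs a (hOA (hUO ha))
      · intro y hy z hz h
        dsimp only at h
        refine hUinj y hy z hz ?_
        rcases lt_trichotomy (r y) (r z) with h1 | h1 | h1
        · exact absurd h (hlt y hy z hz h1).ne
        · exact h1
        · exact absurd h (hlt z hz y hy h1).ne'
    rw [Nat.card_Ico] at this
    omega

lemma main_bound_s5 {K Γ : Type*} [Field K] [LinearOrderedCommGroupWithZero Γ]
    [DecidableEq K] (v : Valuation K Γ) (q : ℕ) (hq0 : 0 < q)
    (hq : ∀ (S : Finset K) (ρ : Γ), (∀ x ∈ S, ∀ y ∈ S, x ≠ y → v (x - y) = ρ) → S.card ≤ q)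
    (A : Finset K) (hA2 : 2 ≤ A.card) (k : ℕ) (hk : 0 < k) :
    (A.card : ℝ) ^ 6 ≤ 256 * (q : ℝ) ^ 2 * k * ((Nat.log 2 A.card + 1 : ℕ) : ℝ) ^ 3 *
      (A.card : ℝ) ^ ((1 : ℝ) / k) * (((A + A).card : ℝ) ^ 3 * ((A * A).card : ℝ) ^ 2) := by
  have hAne : A.Nonempty := card_pos.1 (by omega)
  have hApos : (0 : ℝ) < A.card := by exact_mod_cast hAne.card_pos
  have hSpos : (0 : ℝ) < (A + A).card := by exact_mod_cast (hAne.add hAne).card_pos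
  have hnn : ∀ a ∈ A, ∃ a' ∈ A, a' ≠ a ∧ ∀ b ∈ A, b ≠ a → v (a' - a) ≤ v (b - a) := by
    intro a ha
    have hne : (A.erase a).Nonempty := by
      apply card_pos.1; rw [card_erase_of_mem ha]; omega
    obtain ⟨m, hm, hmin⟩ := exists_min_image (A.erase a) (fun b => v (b - a)) hne
    exact ⟨m, (mem_erase.1 hm).2, (mem_erase.1 hm).1, fun b hb hba =>
      hmin b (mem_erase.2 ⟨hba, hb⟩)⟩
  choose! nn hnnA hnnne hnnmin using hnn
  let r : K → Γ := fun a => v (nn a - a)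
  let cnt : K → ℕ := fun a => (A.filter (fun a' => v (a' - a) ≤ r a)).card
  set L := Nat.log 2 A.card + 1 with hL
  have hcnt_le : ∀ a, cnt a ≤ A.card := fun a => card_filter_le _ _
  have hsplit : ∀ a ∈ A, cnt a = (A.filter (fun a' => a' ≠ a ∧ v (a' - a) ≤ r a)).card + 1 := by
    intro a ha
    change (A.filter (fun a' => v (a' - a) ≤ r a)).card = _
    rw [← card_erase_add_one (s := A.filter (fun a' => v (a' - a) ≤ r a)) (a := a)
      (mem_filter.2 ⟨ha, by simp⟩)]
    congr 2
    ext z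
    simp only [mem_erase, mem_filter]
    tauto
  have hcnt2 : ∀ a ∈ A, 2 ≤ cnt a := by
    intro a ha
    rw [hsplit a ha]
    have : 0 < (A.filter (fun a' => a' ≠ a ∧ v (a' - a) ≤ r a)).card :=
      card_pos.2 ⟨nn a, mem_filter.2 ⟨hnnA a ha, hnnne a ha, le_refl _⟩⟩
    omega
  obtain ⟨i, hi, hicard⟩ := exists_le_card_fiber_of_nsmul_le_card_of_maps_to
    (s := A) (t := range L) (f := fun a => Nat.log 2 (cnt a)) (b := (A.card : ℝ) / L)
    (fun a ha => by
      rw [mem_range, hL, Nat.lt_succ_iff]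
      exact Nat.log_mono_right (hcnt_le a)) ⟨0, by simp [hL]⟩ (by
      rw [card_range, nsmul_eq_mul, mul_div_cancel₀]
      positivity)
  set A1 := A.filter (fun a => Nat.log 2 (cnt a) = i) with hA1
  have hLpos : (0 : ℝ) < L := by positivity
  have hA1pos : (0 : ℝ) < A1.card := lt_of_lt_of_le (by positivity) hicard
  have hA1ne : A1.Nonempty := card_pos.1 (by exact_mod_cast hA1pos)
  have hA1A : A1 ⊆ A := filter_subset _ _
  have hs : ∀ a ∈ A1, 2 ^ i ≤ cnt a ∧ cnt a < 2 * 2 ^ i := by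
    intro a ha
    rw [hA1, mem_filter] at ha
    have h2 := hcnt2 a ha.1
    rw [← ha.2]
    refine ⟨Nat.pow_log_le_self 2 (by omega), ?_⟩
    have := Nat.lt_pow_succ_log_self (b := 2) (by norm_num) (cnt a)
    rwa [pow_succ, mul_comm] at this
  have hi1 : 1 ≤ i := by
    obtain ⟨a, ha⟩ := hA1ne
    rw [hA1, mem_filter] at ha
    rw [← ha.2]
    exact Nat.log_pos (by norm_num) (hcnt2 a ha.1)
  set s : ℕ := 2 ^ i with hsdef
  have hs2 : 2 ≤ s := by
    calc 2 = 2 ^ 1 := by norm_num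
      _ ≤ 2 ^ i := Nat.pow_le_pow_right (by norm_num) hi1
  have hspos : (0 : ℝ) < s := by positivity
  set D : ℝ := 2 * k * (((A + A).card : ℝ) / A.card) * (A.card : ℝ) ^ ((1 : ℝ) / k) with hD
  have hDpos : 0 < D := by positivity
  have hmain := solymosi v A A1 hA1A hA1ne hA2 r ((s : ℝ) / 2) (q * Real.sqrt (s * D))
    (by positivity) (by
      intro a ha
      have h1 := (hs a ha).1
      rw [hsplit a (hA1A ha)] at h1
      have h2 : s ≤ 2 * (A.filter (fun a' => a' ≠ a ∧ v (a' - a) ≤ r a)).card := by omega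
      have h3 : (s : ℝ) ≤ 2 * (A.filter (fun a' => a' ≠ a ∧ v (a' - a) ≤ r a)).card := by
        exact_mod_cast h2
      linarith) (by
      intro x
      obtain ⟨U, u0, hUA, hinj, hc, hUs⟩ := overlap v q hq A A1 hA1A r
        (fun a ha a' ha' hne => hnnmin a ha a' ha' hne) s hs x
      have hUD := chain_bound_s5 v A U hUA hAne u0 hinj k hk
      have hUs' : (U.card : ℝ) ≤ s := by exact_mod_cast hUs
      have hUsq : (U.card : ℝ) ≤ Real.sqrt (s * D) := by
        apply Real.le_sqrt_of_sq_le
        rw [sq]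
        gcongr
      calc _ ≤ (q : ℝ) * U.card := by exact_mod_cast hc
        _ ≤ _ := by gcongr)
  rw [mul_pow, Real.sq_sqrt (by positivity)] at hmain
  set S : ℝ := ((A + A).card : ℝ)
  set M : ℝ := ((A * A).card : ℝ)
  set a : ℝ := (A.card : ℝ)
  set e : ℝ := a ^ ((1 : ℝ) / k)
  have h1 : (A1.card : ℝ) ^ 3 * a ^ 2 ≤ 128 * (q : ℝ) ^ 2 * D * S ^ 2 * M ^ 2 := by
    have : (s : ℝ) / 2 * ((A1.card : ℝ) ^ 3 * a ^ 2) ≤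
        (s : ℝ) / 2 * (128 * (q : ℝ) ^ 2 * D * S ^ 2 * M ^ 2) := by nlinarith [hmain]
    exact le_of_mul_le_mul_left this (by positivity)
  have h2 : (a / L) ^ 3 * a ^ 2 ≤ 128 * (q : ℝ) ^ 2 * D * S ^ 2 * M ^ 2 :=
    le_trans (by gcongr) h1
  have h3 : (a / L) ^ 3 * a ^ 2 * (L ^ 3 * a) = a ^ 6 := by field_simp
  have h4 : 128 * (q : ℝ) ^ 2 * D * S ^ 2 * M ^ 2 * (L ^ 3 * a) =
      256 * (q : ℝ) ^ 2 * k * (L : ℝ) ^ 3 * e * (S ^ 3 * M ^ 2) := by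
    rw [hD]; field_simp; ring
  rw [← h3, ← h4]
  gcongr

lemma log_bound (n : ℕ) (hn : 1 ≤ n) (δ : ℝ) (hδ : 0 < δ) :
    ((Nat.log 2 n + 1 : ℕ) : ℝ) ≤ (2 / δ + 1) * (n : ℝ) ^ δ := by
  have hn' : (1 : ℝ) ≤ n := by exact_mod_cast hn
  have h1 : (Nat.log 2 n : ℝ) * Real.log 2 ≤ Real.log n := by
    rw [← Real.log_pow]
    apply Real.log_le_log (by positivity)
    exact_mod_cast Nat.pow_log_le_self 2 (by omega)
  have h2 : Real.log n ≤ (n : ℝ) ^ δ / δ := Real.log_le_rpow_div (by positivity) hδ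
  have h3 : (1 : ℝ) ≤ (n : ℝ) ^ δ := Real.one_le_rpow hn' hδ.le
  have h4 := Real.log_two_gt_d9
  have h5 : (Nat.log 2 n : ℝ) * (1 / 2) ≤ (Nat.log 2 n : ℝ) * Real.log 2 := by
    gcongr; linarith
  push_cast
  have h6 : (2 / δ + 1) * (n : ℝ) ^ δ = 2 * ((n : ℝ) ^ δ / δ) + (n : ℝ) ^ δ := by
    field_simp
  rw [h6]
  linarith

end helpers3

theorem stmt5 (F : Type) [Field F] [Fintype F] :
    ∀ ε : ℝ, 0 < ε → ∃ c : ℝ, 0 < c ∧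
      ∀ A : Set (RatFunc F), A.Finite → A.Nonempty →
        c * (A.ncard : ℝ) ^ ((6 : ℝ) - ε) ≤
          ((A + A).ncard : ℝ) ^ 3 * ((A * A).ncard : ℝ) ^ 2 := by
  classical
  intro ε hε
  set q := Fintype.card F with hq
  have hq0 : 0 < q := Fintype.card_pos
  obtain ⟨k, hk⟩ := exists_nat_gt (2 / ε)
  have hkpos : (0 : ℝ) < k := lt_trans (by positivity) hk
  have hk0 : 0 < k := by exact_mod_cast hkpos
  have hkε : (1 : ℝ) / k ≤ ε / 2 := by
    rw [div_lt_iff₀ hε] at hk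
    rw [div_le_iff₀ hkpos]
    linarith
  set B : ℝ := 2 / (ε / 6) + 1 with hB
  have hB1 : 1 ≤ B := by
    have : 0 ≤ 2 / (ε / 6) := by positivity
    linarith
  set C : ℝ := 256 * (q : ℝ) ^ 2 * k * B ^ 3 with hC
  have hC1 : 1 ≤ C := by
    have h1 : (1 : ℝ) ≤ q := by exact_mod_cast hq0
    have h2 : (1 : ℝ) ≤ k := by exact_mod_cast hk0
    have h3 : (1 : ℝ) ≤ (q : ℝ) ^ 2 := one_le_pow₀ h1
    have h4 : (1 : ℝ) ≤ B ^ 3 := one_le_pow₀ hB1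
    calc (1 : ℝ) ≤ 256 * 1 * 1 * 1 := by norm_num
      _ ≤ C := by rw [hC]; gcongr
  have hCpos : 0 < C := by linarith
  refine ⟨C⁻¹, by positivity, ?_⟩
  intro A hfin hne
  obtain ⟨A, rfl⟩ := hfin.exists_finset_coe
  rw [← Finset.coe_add, ← Finset.coe_mul, Set.ncard_coe_finset, Set.ncard_coe_finset,
    Set.ncard_coe_finset]
  have hAne : A.Nonempty := by simpa using hne
  rw [inv_mul_le_iff₀ hCpos]
  have hAcard := hAne.card_pos
  have hApos : (0 : ℝ) < A.card := by exact_mod_cast hAcard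
  have hSM : (1 : ℝ) ≤ ((A + A).card : ℝ) ^ 3 * ((A * A).card : ℝ) ^ 2 := by
    have h1 : (1 : ℝ) ≤ (A + A).card := by exact_mod_cast (hAne.add hAne).card_pos
    have h2 : (1 : ℝ) ≤ (A * A).card := by exact_mod_cast (hAne.mul hAne).card_pos
    exact one_le_mul_of_one_le_of_one_le (one_le_pow₀ h1) (one_le_pow₀ h2)
  rcases Nat.lt_or_ge A.card 2 with h1 | h2
  · have : A.card = 1 := by omega
    rw [this, Nat.cast_one, Real.one_rpow]
    exact one_le_mul_of_one_le_of_one_le hC1 hSM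
  have hb := main_bound_s5 (RatFunc.inftyValuation F) q hq0
    (fun S ρ h => equidistant_card F S ρ h) A h2 k hk0
  have hA1 : (1 : ℝ) ≤ A.card := by exact_mod_cast hAcard
  have hlog := log_bound A.card hAcard (ε / 6) (by positivity)
  have hlog3 : ((Nat.log 2 A.card + 1 : ℕ) : ℝ) ^ 3 ≤ B ^ 3 * (A.card : ℝ) ^ (ε / 2) := by
    calc _ ≤ (B * (A.card : ℝ) ^ (ε / 6)) ^ 3 := by gcongr
      _ = _ := by
        rw [mul_pow, ← Real.rpow_natCast ((A.card : ℝ) ^ (ε / 6)) 3, ← Real.rpow_mul hApos.le]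
        congr 2
        push_cast
        ring
  have hek : (A.card : ℝ) ^ ((1 : ℝ) / k) ≤ (A.card : ℝ) ^ (ε / 2) :=
    Real.rpow_le_rpow_of_exponent_le hA1 hkε
  have hfinal : (A.card : ℝ) ^ 6 ≤
      C * (((A + A).card : ℝ) ^ 3 * ((A * A).card : ℝ) ^ 2) * (A.card : ℝ) ^ ε := by
    calc (A.card : ℝ) ^ 6 ≤ _ := hb
      _ ≤ 256 * (q : ℝ) ^ 2 * k * (B ^ 3 * (A.card : ℝ) ^ (ε / 2)) *
          (A.card : ℝ) ^ (ε / 2) * (((A + A).card : ℝ) ^ 3 * ((A * A).card : ℝ) ^ 2) := by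
        gcongr
      _ = 256 * (q : ℝ) ^ 2 * k * B ^ 3 * (((A + A).card : ℝ) ^ 3 * ((A * A).card : ℝ) ^ 2) *
          ((A.card : ℝ) ^ (ε / 2) * (A.card : ℝ) ^ (ε / 2)) := by ring
      _ = _ := by rw [← Real.rpow_add hApos, add_halves, hC]
  rw [Real.rpow_sub hApos, div_le_iff₀ (by positivity)]
  exact_mod_cast hfinal
end

section
/- Let q be a prime power and F_q(t) the field of rational functions over the finite field F_q. For every ε > 0 there exists a constant c > 0 (depending on q and ε) such that for every finite nonempty set A ⊆ F_q(t), max{|A + A|, |A·A|} ≥ c·|A|^(1 + 1/5 − ε). -/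
open scoped Pointwise

theorem SP.le_ord_sub {F : Type} [Field F] {x y : LaurentSeries F} {m : WithTop ℤ}
    (hx : m ≤ HahnSeries.orderTop x) (hy : m ≤ HahnSeries.orderTop y) :
    m ≤ HahnSeries.orderTop (x - y) :=
  le_trans (le_min hx hy) HahnSeries.min_orderTop_le_orderTop_sub

theorem SP.le_ord_add {F : Type} [Field F] {x y : LaurentSeries F} {m : WithTop ℤ}
    (hx : m ≤ HahnSeries.orderTop x) (hy : m ≤ HahnSeries.orderTop y) :
    m ≤ HahnSeries.orderTop (x + y) :=
  le_trans (le_min hx hy) HahnSeries.min_orderTop_le_orderTop_add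

theorem SP.succ_le_ord {F : Type} [Field F] {x : LaurentSeries F} {m : ℤ}
    (hx : (m : WithTop ℤ) ≤ HahnSeries.orderTop x) (h0 : x.coeff m = 0) :
    ((m + 1 : ℤ) : WithTop ℤ) ≤ HahnSeries.orderTop x := by
  rw [HahnSeries.le_orderTop_iff_forall] at *
  intro j hj
  have hj' : j < m + 1 := by exact_mod_cast hj
  rcases (Int.lt_add_one_iff.mp hj').lt_or_eq with h | h
  · exact hx j (by exact_mod_cast h)
  · rw [h]; exact h0

theorem SP.coeff_zero_of_succ_le {F : Type} [Field F] {x : LaurentSeries F} {m : ℤ}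
    (hx : ((m + 1 : ℤ) : WithTop ℤ) ≤ HahnSeries.orderTop x) : x.coeff m = 0 := by
  apply HahnSeries.coeff_eq_zero_of_lt_orderTop
  refine lt_of_lt_of_le ?_ hx
  exact_mod_cast Int.lt_succ m

/-- The combinatorial heart: a tree decomposition of the set of slopes. -/
theorem SP.tree {F : Type} [Field F] [Fintype F] [DecidableEq F] {σ : Type} [DecidableEq σ]
    (T : Finset σ) (z : σ → LaurentSeries F) (d : σ → WithTop ℤ)
    (lo hi : LaurentSeries F → WithTop ℤ) (e : ℕ) (S : Finset (LaurentSeries F))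
    (hgood : ∀ a ∈ S, ∀ b ∈ S, a ≠ b → hi b ≤ lo a → ∃ E ⊆ T, e ≤ E.card ∧
      ∀ s ∈ E, HahnSeries.orderTop (z s - a) = HahnSeries.orderTop (b - a))
    (hbad : ∀ a ∈ S, ∀ b ∈ S, a ≠ b → lo a < hi b → ∃ E ⊆ T, e ≤ E.card ∧
      ∀ s ∈ E, HahnSeries.orderTop (b - a) < HahnSeries.orderTop (z s - a) ∧
        hi a ≤ d s ∧ d s ≤ lo a) :
    ∀ n : ℕ, ∀ Λ ⊆ S, Λ.card = n → Λ.Nonempty → ∃ h : σ → ℕ,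
      (e * n ≤ e + Fintype.card F * ∑ s ∈ T, h s) ∧
      (∀ s ∈ T, h s ≤ 2 * Nat.log 2 n + 1) ∧
      (∀ s ∈ T, (∀ a ∈ Λ, hi a ≤ d s) → h s ≤ 2 * Nat.log 2 n) ∧
      (∀ s ∈ T, 0 < h s → ∀ m : ℤ,
        (∀ a ∈ Λ, ∀ b ∈ Λ, (m : WithTop ℤ) ≤ HahnSeries.orderTop (a - b)) →
        ∀ a ∈ Λ, (m : WithTop ℤ) ≤ HahnSeries.orderTop (z s - a)) := by
  intro n
  induction n using Nat.strong_induction_on with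
  | _ n ih =>
  intro Λ hΛS hcard hne
  by_cases hn1 : n = 1
  · refine ⟨fun _ => 0, ?_, ?_, ?_, ?_⟩
    · subst hn1; simp
    · intros; simp
    · intros; simp
    · intro s _ h; exact absurd h (by simp)
  have hn2 : 2 ≤ n := by
    have := hne.card_pos; omega
  -- the minimal order of a difference
  obtain ⟨m, hm, a₀, ha₀, b₀, hb₀, hab₀⟩ : ∃ m : ℤ,
      (∀ a ∈ Λ, ∀ b ∈ Λ, (m : WithTop ℤ) ≤ HahnSeries.orderTop (a - b)) ∧
      ∃ a ∈ Λ, ∃ b ∈ Λ, HahnSeries.orderTop (a - b) = (m : WithTop ℤ) := by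
    have hne2 : (Λ ×ˢ Λ).Nonempty := hne.product hne
    obtain ⟨p, hp, hpmin⟩ := Finset.exists_min_image (Λ ×ˢ Λ)
      (fun p => HahnSeries.orderTop (p.1 - p.2)) hne2
    have hp' := Finset.mem_product.mp hp
    obtain ⟨a, ha, b, hb, hab⟩ := Finset.one_lt_card.mp (show 1 < Λ.card by omega)
    have hlt : HahnSeries.orderTop (p.1 - p.2) < ⊤ := by
      refine lt_of_le_of_lt (hpmin (a, b) (Finset.mk_mem_product ha hb)) ?_
      rw [HahnSeries.orderTop_lt_top]
      exact sub_ne_zero.mpr hab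
    obtain ⟨m, hm⟩ := WithTop.ne_top_iff_exists.mp hlt.ne
    refine ⟨m, ?_, p.1, hp'.1, p.2, hp'.2, hm.symm⟩
    intro a ha b hb
    rw [hm]
    exact hpmin (a, b) (Finset.mk_mem_product ha hb)
  set C : F → Finset (LaurentSeries F) := fun c => Λ.filter (fun a => a.coeff m = c) with hC
  have hCsub : ∀ c, C c ⊆ Λ := fun c => Finset.filter_subset _ _
  have hCmem : ∀ c a, a ∈ C c ↔ a ∈ Λ ∧ a.coeff m = c := by
    intro c a; simp [hC]
  have hin : ∀ c, ∀ a ∈ C c, ∀ b ∈ C c,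
      ((m + 1 : ℤ) : WithTop ℤ) ≤ HahnSeries.orderTop (a - b) := by
    intro c a ha b hb
    rw [hCmem] at ha hb
    refine SP.succ_le_ord (hm a ha.1 b hb.1) ?_
    rw [HahnSeries.coeff_sub, ha.2, hb.2, sub_self]
  have hout : ∀ c c' a b, a ∈ C c → b ∈ C c' → c ≠ c' →
      HahnSeries.orderTop (a - b) = (m : WithTop ℤ) := by
    intro c c' a b ha hb hcc
    rw [hCmem] at ha hb
    refine le_antisymm ?_ (hm a ha.1 b hb.1)
    apply HahnSeries.orderTop_le_of_coeff_ne_zero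
    rw [HahnSeries.coeff_sub, ha.2, hb.2]
    exact sub_ne_zero.mpr hcc
  have hsum : ∑ c, (C c).card = n := by
    rw [← hcard]
    exact (Finset.card_eq_sum_card_fiberwise (f := fun a : LaurentSeries F => a.coeff m)
      (t := Finset.univ) (fun _ _ => Finset.mem_coe.mpr (Finset.mem_univ _))).symm
  -- heavy class
  obtain ⟨H, -, hH⟩ := Finset.exists_max_image (Finset.univ : Finset F)
    (fun c => (C c).card) Finset.univ_nonempty
  have hHne : (C H).Nonempty := by
    have h1 : 0 < (C (a₀.coeff m)).card :=
      Finset.card_pos.mpr ⟨a₀, (hCmem _ _).mpr ⟨ha₀, rfl⟩⟩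
    exact Finset.card_pos.mp (lt_of_lt_of_le h1 (hH _ (Finset.mem_univ _)))
  obtain ⟨c', hc'H, hc'ne⟩ : ∃ c', c' ≠ H ∧ (C c').Nonempty := by
    have hdiff : a₀.coeff m ≠ b₀.coeff m := by
      intro h
      have := hin _ a₀ ((hCmem _ _).mpr ⟨ha₀, h⟩) b₀ ((hCmem _ _).mpr ⟨hb₀, rfl⟩)
      rw [hab₀] at this
      have h2 : m + 1 ≤ m := by exact_mod_cast this
      omega
    by_cases h : a₀.coeff m = H
    · exact ⟨b₀.coeff m, fun h' => hdiff (h.trans h'.symm), b₀, (hCmem _ _).mpr ⟨hb₀, rfl⟩⟩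
    · exact ⟨a₀.coeff m, h, a₀, (hCmem _ _).mpr ⟨ha₀, rfl⟩⟩
  have hpair : ∀ c, c ≠ H → (C c).card + (C H).card ≤ n := by
    intro c hc
    have h1 := Finset.sum_pair (f := fun c => (C c).card) hc
    have h2 : ∑ i ∈ {c, H}, (C i).card ≤ ∑ i, (C i).card :=
      Finset.sum_le_sum_of_subset (Finset.subset_univ _)
    rw [hsum] at h2
    omega
  have hlt : ∀ c, (C c).card < n := by
    intro c
    have h1 := hpair c' hc'H
    have h2 := hc'ne.card_pos
    have h3 := hH c (Finset.mem_univ _)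
    omega
  have hlogle : ∀ c, Nat.log 2 (C c).card ≤ Nat.log 2 n := fun c =>
    Nat.log_mono_right (hlt c).le
  have hloglight : ∀ c, c ≠ H → Nat.log 2 (C c).card + 1 ≤ Nat.log 2 n := by
    intro c hc
    have h1 := hpair c hc
    have h3 := hH c (Finset.mem_univ _)
    have h4 : (C c).card ≤ n / 2 := by omega
    have h5 : Nat.log 2 n = Nat.log 2 (n / 2) + 1 := by
      rw [Nat.log_of_one_lt_of_le (by norm_num) hn2]
    rw [h5]
    exact Nat.succ_le_succ (Nat.log_mono_right h4)
  -- children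
  have hchild : ∀ c, ∃ h : σ → ℕ,
      (e * (C c).card ≤ e + Fintype.card F * ∑ s ∈ T, h s) ∧
      (∀ s ∈ T, h s ≤ 2 * Nat.log 2 (C c).card + 1) ∧
      (∀ s ∈ T, (∀ a ∈ C c, hi a ≤ d s) → h s ≤ 2 * Nat.log 2 (C c).card) ∧
      (∀ s ∈ T, 0 < h s → ∀ m : ℤ,
        (∀ a ∈ C c, ∀ b ∈ C c, (m : WithTop ℤ) ≤ HahnSeries.orderTop (a - b)) →
        ∀ a ∈ C c, (m : WithTop ℤ) ≤ HahnSeries.orderTop (z s - a)) ∧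
      (∀ s, 0 < h s → (C c).Nonempty) := by
    intro c
    by_cases hcne : (C c).Nonempty
    · obtain ⟨h, h1, h2, h3, h4⟩ := ih _ (hlt c) (C c) ((hCsub c).trans hΛS) rfl hcne
      exact ⟨h, h1, h2, h3, h4, fun _ _ => hcne⟩
    · refine ⟨fun _ => 0, ?_, ?_, ?_, ?_, ?_⟩
      · rw [Finset.not_nonempty_iff_eq_empty] at hcne
        simp [hcne]
      · intros; simp
      · intros; simp
      · intro s _ h; exact absurd h (by simp)
      · intro s h; exact absurd h (by simp)
  choose g hg1 hg2 hg3 hg4 hg5 using hchild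
  -- location of the support of the children
  have hloc : ∀ c, ∀ s ∈ T, 0 < g c s → ∀ a ∈ C c,
      ((m + 1 : ℤ) : WithTop ℤ) ≤ HahnSeries.orderTop (z s - a) := by
    intro c s hs h a ha
    exact hg4 c s hs h (m + 1) (hin c) a ha
  have hdisj : ∀ s ∈ T, ∀ c c₁, 0 < g c s → 0 < g c₁ s → c = c₁ := by
    intro s hs c c₁ h h₁
    by_contra hcc
    obtain ⟨a, ha⟩ := hg5 c s h
    obtain ⟨b, hb⟩ := hg5 c₁ s h₁
    have h2 := hloc c s hs h a ha
    have h3 := hloc c₁ s hs h₁ b hb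
    have h4 := SP.le_ord_sub h3 h2
    have h5 : z s - b - (z s - a) = a - b := by ring
    rw [h5, hout c c₁ a b ha hb hcc] at h4
    have h6 : m + 1 ≤ m := by exact_mod_cast h4
    omega
  have hone : ∀ s ∈ T, ∀ c, 0 < g c s → ∑ c₁, g c₁ s = g c s := by
    intro s hs c hc
    refine Finset.sum_eq_single c (fun c₁ _ hne => ?_) (fun h => absurd (Finset.mem_univ _) h)
    by_contra h0
    exact hne (hdisj s hs c₁ c (Nat.pos_of_ne_zero h0) hc)
  have hpos : ∀ s, 0 < ∑ c, g c s → ∃ c, 0 < g c s := by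
    intro s h
    by_contra hcon
    push Not at hcon
    have : ∑ c, g c s = 0 := Finset.sum_eq_zero (fun c _ => Nat.le_zero.mp (hcon c))
    omega
  have hsupp : ∀ s ∈ T, 0 < ∑ c, g c s →
      ∀ a ∈ Λ, (m : WithTop ℤ) ≤ HahnSeries.orderTop (z s - a) := by
    intro s hs h a ha
    obtain ⟨c, hc⟩ := hpos s h
    obtain ⟨b, hb⟩ := hg5 c s hc
    have h2 := hloc c s hs hc b hb
    have h3 : (m : WithTop ℤ) ≤ HahnSeries.orderTop (z s - b) :=
      le_trans (by exact_mod_cast (Int.le.intro 1 rfl)) h2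
    have h4 := SP.le_ord_add h3 (hm b (hCsub c hb) a ha)
    rwa [sub_add_sub_cancel] at h4
  -- the edge at the root
  obtain ⟨E, hET, hEe, hEm, hEcase⟩ : ∃ E ⊆ T, e ≤ E.card ∧
      (∀ s ∈ E, ∀ a ∈ Λ, (m : WithTop ℤ) ≤ HahnSeries.orderTop (z s - a)) ∧
      ((∀ s ∈ E, g H s = 0) ∨
        (∀ s ∈ E, (∀ c, c ≠ H → g c s = 0) ∧ (∀ a ∈ C H, hi a ≤ d s) ∧
          ∃ b ∈ Λ, d s < hi b)) := by
    obtain ⟨a, haH, hamax⟩ := Finset.exists_max_image (C H) hi hHne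
    obtain ⟨b, hb⟩ := hc'ne
    have haΛ := hCsub _ haH
    have hbΛ := hCsub _ hb
    by_cases hex : ∃ a ∈ C H, hi b ≤ lo a
    · obtain ⟨a, haH, hle⟩ := hex
      have haΛ := hCsub _ haH
      have hord := hout _ _ b a hb haH hc'H
      have hne' : a ≠ b := by
        rintro rfl
        simp at hord
      obtain ⟨E, hET, hEe, hE⟩ := hgood a (hΛS haΛ) b (hΛS hbΛ) hne' hle
      refine ⟨E, hET, hEe, ?_, Or.inl ?_⟩
      · intro s hs a₁ ha₁
        have h3 : (m : WithTop ℤ) ≤ HahnSeries.orderTop (z s - a) := by rw [hE s hs, hord]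
        have h4 := SP.le_ord_add h3 (hm a haΛ a₁ ha₁)
        rwa [sub_add_sub_cancel] at h4
      · intro s hs
        by_contra h0
        have h1 := hloc H s (hET hs) (Nat.pos_of_ne_zero h0) a haH
        rw [hE s hs, hord] at h1
        have h6 : m + 1 ≤ m := by exact_mod_cast h1
        omega
    · push Not at hex
      have hord := hout _ _ b a hb haH hc'H
      have hne' : a ≠ b := by
        rintro rfl
        simp at hord
      obtain ⟨E, hET, hEe, hE⟩ := hbad a (hΛS haΛ) b (hΛS hbΛ) hne' (hex a haH)
      have hz : ∀ s ∈ E, ((m + 1 : ℤ) : WithTop ℤ) ≤ HahnSeries.orderTop (z s - a) := by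
        intro s hs
        have h1 := (hE s hs).1
        rw [hord] at h1
        exact SP.succ_le_ord h1.le (HahnSeries.coeff_eq_zero_of_lt_orderTop h1)
      refine ⟨E, hET, hEe, ?_, Or.inr ?_⟩
      · intro s hs a₁ ha₁
        have h1 := (hE s hs).1
        rw [hord] at h1
        have h4 := SP.le_ord_add h1.le (hm a haΛ a₁ ha₁)
        rwa [sub_add_sub_cancel] at h4
      · intro s hs
        refine ⟨?_, ?_, b, hbΛ, lt_of_le_of_lt (hE s hs).2.2 (hex a haH)⟩
        · intro c hc
          by_contra h0
          obtain ⟨a₁, ha₁⟩ := hg5 c s (Nat.pos_of_ne_zero h0)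
          have h1 := hloc c s (hET hs) (Nat.pos_of_ne_zero h0) a₁ ha₁
          have h4 := SP.le_ord_sub h1 (hz s hs)
          have h5 : z s - a₁ - (z s - a) = a - a₁ := by ring
          rw [h5, hout H c a a₁ haH ha₁ (Ne.symm hc)] at h4
          have h6 : m + 1 ≤ m := by exact_mod_cast h4
          omega
        · intro a₁ ha₁
          exact (hamax a₁ ha₁).trans (hE s hs).2.1
  refine ⟨fun s => (if s ∈ E then 1 else 0) + ∑ c, g c s, ?_, ?_, ?_, ?_⟩
  · have h1 : ∑ s ∈ T, (if s ∈ E then 1 else 0) = E.card := by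
      rw [Finset.sum_ite_mem, Finset.inter_eq_right.mpr hET]; simp
    rw [Finset.sum_add_distrib, h1, Finset.sum_comm, mul_add, Finset.mul_sum]
    have h2 : ∑ c, e * (C c).card ≤ ∑ c, (e + Fintype.card F * ∑ s ∈ T, g c s) :=
      Finset.sum_le_sum (fun c _ => hg1 c)
    rw [← Finset.mul_sum, hsum, Finset.sum_add_distrib] at h2
    simp only [Finset.sum_const, Finset.card_univ, smul_eq_mul] at h2
    have h3 : Fintype.card F * e ≤ Fintype.card F * E.card := Nat.mul_le_mul_left _ hEe
    omega
  · intro s hs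
    have hb : ∑ c, g c s ≤ 2 * Nat.log 2 n + 1 := by
      rcases Nat.eq_zero_or_pos (∑ c, g c s) with h | h
      · omega
      · obtain ⟨c, hc⟩ := hpos s h
        rw [hone s hs c hc]
        have := hg2 c s hs
        have := hlogle c
        omega
    by_cases hsE : s ∈ E
    · simp only [hsE, if_true]
      rcases Nat.eq_zero_or_pos (∑ c, g c s) with h | h
      · omega
      · obtain ⟨c, hc⟩ := hpos s h
        rw [hone s hs c hc]
        rcases hEcase with hE | hE
        · have hcH : c ≠ H := by
            rintro rfl
            have := hE s hsE
            omega
          have := hg2 c s hs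
          have := hloglight c hcH
          omega
        · have hcH : c = H := by
            by_contra hcH
            have := (hE s hsE).1 c hcH
            omega
          subst hcH
          have := hg3 c s hs (hE s hsE).2.1
          have := hlogle c
          omega
    · simp only [hsE, if_false]
      omega
  · intro s hs hcond
    have hb : ∑ c, g c s ≤ 2 * Nat.log 2 n := by
      rcases Nat.eq_zero_or_pos (∑ c, g c s) with h | h
      · omega
      · obtain ⟨c, hc⟩ := hpos s h
        rw [hone s hs c hc]
        have := hg3 c s hs (fun a ha => hcond a (hCsub c ha))
        have := hlogle c
        omega
    by_cases hsE : s ∈ E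
    · simp only [hsE, if_true]
      rcases hEcase with hE | hE
      · rcases Nat.eq_zero_or_pos (∑ c, g c s) with h | h
        · have := hloglight c' hc'H
          omega
        · obtain ⟨c, hc⟩ := hpos s h
          rw [hone s hs c hc]
          have hcH : c ≠ H := by
            rintro rfl
            have := hE s hsE
            omega
          have := hg2 c s hs
          have := hloglight c hcH
          omega
      · obtain ⟨b, hbΛ, hlt'⟩ := (hE s hsE).2.2
        exact absurd (hcond b hbΛ) (not_le.mpr hlt')
    · simp only [hsE, if_false]
      omega
  · intro s hs hh m' hm' a ha
    have hmm : (m' : WithTop ℤ) ≤ (m : WithTop ℤ) := by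
      rw [← hab₀]; exact hm' a₀ ha₀ b₀ hb₀
    refine hmm.trans ?_
    by_cases hsE : s ∈ E
    · exact hEm s hsE a ha
    · simp only [hsE, if_false, zero_add] at hh
      exact hsupp s hs hh a ha

theorem SP.quantile {α β : Type} [LinearOrder β] (X : Finset α) (ν : α → β) (m : ℕ)
    (hm : 1 ≤ m) (hX : m ≤ X.card) :
    ∃ v : β, m ≤ (X.filter (fun x => ν x ≤ v)).card ∧ (X.filter (fun x => ν x < v)).card < m := by
  have hne : (X.filter (fun x => m ≤ (X.filter (fun y => ν y ≤ ν x)).card)).Nonempty := by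
    have hXne : X.Nonempty := Finset.card_pos.mp (by omega)
    obtain ⟨x, hx, hmax⟩ := Finset.exists_max_image X ν hXne
    refine ⟨x, Finset.mem_filter.mpr ⟨hx, ?_⟩⟩
    rw [Finset.filter_true_of_mem hmax]
    exact hX
  obtain ⟨x, hx, hmin⟩ := Finset.exists_min_image _ ν hne
  rw [Finset.mem_filter] at hx
  refine ⟨ν x, hx.2, ?_⟩
  by_contra hcon
  push Not at hcon
  have hne2 : (X.filter (fun y => ν y < ν x)).Nonempty := Finset.card_pos.mp (by omega)
  obtain ⟨w, hw, hwmax⟩ := Finset.exists_max_image _ ν hne2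
  have hw' := Finset.mem_filter.mp hw
  have h1 : w ∈ X.filter (fun x => m ≤ (X.filter (fun y => ν y ≤ ν x)).card) := by
    refine Finset.mem_filter.mpr ⟨hw'.1, hcon.trans (Finset.card_le_card ?_)⟩
    intro y hy
    exact Finset.mem_filter.mpr ⟨(Finset.mem_filter.mp hy).1, hwmax y hy⟩
  exact absurd (hmin w h1) (not_le.mpr hw'.2)

theorem SP.thirds {α β : Type} [LinearOrder β] (X : Finset α) (ν : α → β) (m : ℕ)
    (hm : 1 ≤ m) (hX : 3 * m ≤ X.card) :
    ∃ p : β × β, m ≤ (X.filter (fun x => ν x ≤ p.1)).card ∧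
      m ≤ (X.filter (fun x => p.1 ≤ ν x ∧ ν x ≤ p.2)).card ∧
      m ≤ (X.filter (fun x => p.2 ≤ ν x)).card := by
  obtain ⟨v, hv1, hv2⟩ := SP.quantile X ν m hm (by omega)
  obtain ⟨w, hw1, hw2⟩ := SP.quantile (β := βᵒᵈ) X (fun x => OrderDual.toDual (ν x)) m hm (by omega)
  have hw1' : m ≤ (X.filter (fun x => OrderDual.ofDual w ≤ ν x)).card := hw1
  have hw2' : (X.filter (fun x => OrderDual.ofDual w < ν x)).card < m := hw2
  refine ⟨(v, OrderDual.ofDual w), hv1, ?_, hw1'⟩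
  classical
  have hsub : X ⊆ X.filter (fun x => ν x < v) ∪ X.filter (fun x => OrderDual.ofDual w < ν x) ∪
      X.filter (fun x => v ≤ ν x ∧ ν x ≤ OrderDual.ofDual w) := by
    intro x hx
    simp only [Finset.mem_union, Finset.mem_filter, hx, true_and]
    rcases lt_or_ge (ν x) v with h | h
    · exact Or.inl (Or.inl h)
    · rcases lt_or_ge (OrderDual.ofDual w) (ν x) with h' | h'
      · exact Or.inl (Or.inr h')
      · exact Or.inr ⟨h, h'⟩
  have h1 := Finset.card_le_card hsub
  have h2 := Finset.card_union_le (X.filter (fun x => ν x < v) ∪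
    X.filter (fun x => OrderDual.ofDual w < ν x))
      (X.filter (fun x => v ≤ ν x ∧ ν x ≤ OrderDual.ofDual w))
  have h3 := Finset.card_union_le (X.filter (fun x => ν x < v))
    (X.filter (fun x => OrderDual.ofDual w < ν x))
  change m ≤ (X.filter (fun x => v ≤ ν x ∧ ν x ≤ OrderDual.ofDual w)).card
  omega

theorem SP.ord_div {F : Type} [Field F] (y : LaurentSeries F) {w : LaurentSeries F} (hw : w ≠ 0) :
    HahnSeries.orderTop (y / w) + HahnSeries.orderTop w = HahnSeries.orderTop y := by
  rw [← HahnSeries.orderTop_mul, div_mul_cancel₀ _ hw]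

theorem SP.slope_eq {F : Type} [Field F] {a b u y : LaurentSeries F} (h : u + y ≠ 0) :
    (a * u + b * y) / (u + y) - a = (b - a) * (y / (u + y)) := by
  field_simp
  ring

theorem SP.slope_good {F : Type} [Field F] {a b u y : LaurentSeries F} (hy : y ≠ 0)
    (h : HahnSeries.orderTop (u + y) = HahnSeries.orderTop y) :
    HahnSeries.orderTop ((a * u + b * y) / (u + y) - a) = HahnSeries.orderTop (b - a) := by
  have hw : u + y ≠ 0 := by
    rw [← HahnSeries.orderTop_ne_top, h]; exact HahnSeries.orderTop_ne_top.mpr hy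
  have h1 := SP.ord_div y hw
  rw [SP.slope_eq hw, HahnSeries.orderTop_mul]
  rw [h] at h1
  obtain ⟨k, hk⟩ := WithTop.ne_top_iff_exists.mp (HahnSeries.orderTop_ne_top.mpr hy)
  rw [← hk] at h1
  have h2 : HahnSeries.orderTop (y / (u + y)) = 0 := by
    have hq : y / (u + y) ≠ 0 := div_ne_zero hy hw
    obtain ⟨l, hl⟩ := WithTop.ne_top_iff_exists.mp (HahnSeries.orderTop_ne_top.mpr hq)
    rw [← hl] at h1 ⊢
    have h3 : l + k = k := by exact_mod_cast h1
    have : l = 0 := by omega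
    simp [this]
  rw [h2, add_zero]

theorem SP.slope_bad {F : Type} [Field F] {a b x y : LaurentSeries F} (hab : a ≠ b) (hx : x ≠ 0)
    (hy : y ≠ 0) (h : HahnSeries.orderTop x < HahnSeries.orderTop y) :
    HahnSeries.orderTop (b - a) < HahnSeries.orderTop ((a * x + b * y) / (x + y) - a) := by
  have h0 := HahnSeries.orderTop_add_eq_left h
  have hw : x + y ≠ 0 := by
    rw [← HahnSeries.orderTop_ne_top, h0]; exact HahnSeries.orderTop_ne_top.mpr hx
  have h1 := SP.ord_div y hw
  rw [SP.slope_eq hw, HahnSeries.orderTop_mul]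
  rw [h0] at h1
  obtain ⟨k, hk⟩ := WithTop.ne_top_iff_exists.mp (HahnSeries.orderTop_ne_top.mpr hx)
  obtain ⟨j, hj⟩ := WithTop.ne_top_iff_exists.mp (HahnSeries.orderTop_ne_top.mpr hy)
  obtain ⟨i, hi⟩ := WithTop.ne_top_iff_exists.mp
    (HahnSeries.orderTop_ne_top.mpr (sub_ne_zero.mpr hab.symm))
  have hq : y / (x + y) ≠ 0 := div_ne_zero hy hw
  obtain ⟨l, hl⟩ := WithTop.ne_top_iff_exists.mp (HahnSeries.orderTop_ne_top.mpr hq)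
  rw [← hl, ← hk, ← hj] at h1
  rw [← hk, ← hj] at h
  rw [← hl, ← hi]
  have h3 : l + k = j := by exact_mod_cast h1
  have h4 : k < j := by exact_mod_cast h
  have : i < i + l := by omega
  exact_mod_cast this

/-- no cancellation in odd characteristic -/
theorem SP.ord_add_same {F : Type} [Field F] (h2 : (2 : F) ≠ 0) {x y : LaurentSeries F}
    (hy : y ≠ 0) (hl : x.leadingCoeff = y.leadingCoeff)
    (ho : HahnSeries.orderTop x = HahnSeries.orderTop y) :
    HahnSeries.orderTop (x + y) = HahnSeries.orderTop y := by
  obtain ⟨k, hk⟩ := WithTop.ne_top_iff_exists.mp (HahnSeries.orderTop_ne_top.mpr hy)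
  rw [← hk] at ho
  have h1 := HahnSeries.le_orderTop_of_leadingCoeff_eq ho hk.symm hl
  have h3 : HahnSeries.orderTop (y + y) = HahnSeries.orderTop y := by
    rw [← two_mul, HahnSeries.orderTop_mul]
    have : HahnSeries.orderTop (2 : LaurentSeries F) = 0 := by
      have : (2 : LaurentSeries F) = HahnSeries.single 0 (2 : F) := by
        have h := map_ofNat (HahnSeries.C : F →+* LaurentSeries F) 2
        rw [← h]; rfl
      rw [this, HahnSeries.orderTop_single h2]; rfl
    rw [this, zero_add]
  have h4 : x + y = (y + y) + (x - y) := by ring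
  rw [h4, HahnSeries.orderTop_add_eq_left, h3]
  rw [h3, ← hk]; exact h1

/-- full cancellation in characteristic two -/
theorem SP.ord_add_two {F : Type} [Field F] (h2 : (2 : F) = 0) {x y : LaurentSeries F}
    (hy : y ≠ 0) (hl : x.leadingCoeff = y.leadingCoeff)
    (ho : HahnSeries.orderTop x = HahnSeries.orderTop y) :
    HahnSeries.orderTop y < HahnSeries.orderTop (x + y) := by
  obtain ⟨k, hk⟩ := WithTop.ne_top_iff_exists.mp (HahnSeries.orderTop_ne_top.mpr hy)
  rw [← hk] at ho
  have h1 := HahnSeries.le_orderTop_of_leadingCoeff_eq ho hk.symm hl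
  have h3 : (2 : LaurentSeries F) = 0 := by
    have h := map_ofNat (HahnSeries.C : F →+* LaurentSeries F) 2
    rw [← h, show (OfNat.ofNat 2 : F) = 0 from h2, map_zero]
  have h4 : x + y = x - y := by linear_combination y * h3
  rw [h4, ← hk]; exact h1

theorem SP.pair_inj {F : Type} [Field F] {a b u y u' y' : LaurentSeries F} (hab : a ≠ b)
    (h1 : u + y = u' + y') (h2 : a * u + b * y = a * u' + b * y') : u = u' ∧ y = y' := by
  have h3 : (b - a) * (y - y') = 0 := by linear_combination h2 - a * h1
  rcases mul_eq_zero.mp h3 with h | h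
  · exact absurd (sub_eq_zero.mp h).symm hab
  · have : y = y' := sub_eq_zero.mp h
    subst this
    exact ⟨add_right_cancel h1, rfl⟩

open Classical in
/-- the target set -/
noncomputable def SP.target {F : Type} [Field F] (A : Finset (LaurentSeries F)) :
    Finset (LaurentSeries F × LaurentSeries F) :=
  (A + A) ×ˢ (A + A) ∪ (A + A + A) ×ˢ (A + A + A)

open Classical in
noncomputable def SP.fib {F : Type} [Field F] (A : Finset (LaurentSeries F))
    (a : LaurentSeries F) : Finset (LaurentSeries F) := A.filter (fun x => a * x ∈ A)

open Classical in
theorem SP.good_edge {F : Type} [Field F] (A : Finset (LaurentSeries F))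
    (h0 : ∀ x ∈ A, x ≠ 0) (hlc : ∀ x ∈ A, ∀ y ∈ A, x.leadingCoeff = y.leadingCoeff)
    (a b : LaurentSeries F) (hab : a ≠ b) (m e : ℕ) (he : 2 * e ≤ m * m + 1)
    (P Q : Finset (LaurentSeries F)) (hP : P ⊆ SP.fib A a) (hQ : Q ⊆ SP.fib A b)
    (hPm : m ≤ P.card) (hQm : m ≤ Q.card)
    (hPQ : ∀ x ∈ P, ∀ y ∈ Q, HahnSeries.orderTop y ≤ HahnSeries.orderTop x) :
    ∃ E ⊆ SP.target A, e ≤ E.card ∧ ∀ s ∈ E,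
      HahnSeries.orderTop (s.2 / s.1 - a) = HahnSeries.orderTop (b - a) := by
  have hPA : ∀ x ∈ P, x ∈ A ∧ a * x ∈ A := fun x hx => by
    simpa [SP.fib] using hP hx
  have hQA : ∀ x ∈ Q, x ∈ A ∧ b * x ∈ A := fun x hx => by
    simpa [SP.fib] using hQ hx
  set P1 := (P ×ˢ Q).filter (fun p => HahnSeries.orderTop p.2 < HahnSeries.orderTop p.1) with hP1
  set P2 := (P ×ˢ Q).filter (fun p => ¬ HahnSeries.orderTop p.2 < HahnSeries.orderTop p.1) with hP2
  have hcard : P1.card + P2.card = P.card * Q.card := by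
    rw [hP1, hP2, Finset.card_filter_add_card_filter_not, Finset.card_product]
  have hmm : m * m ≤ P.card * Q.card := Nat.mul_le_mul hPm hQm
  have hmem1 : ∀ p ∈ P1, p.1 ∈ P ∧ p.2 ∈ Q ∧
      HahnSeries.orderTop p.2 < HahnSeries.orderTop p.1 := by
    intro p hp
    rw [hP1, Finset.mem_filter, Finset.mem_product] at hp
    exact ⟨hp.1.1, hp.1.2, hp.2⟩
  have hmem2 : ∀ p ∈ P2, p.1 ∈ P ∧ p.2 ∈ Q ∧
      HahnSeries.orderTop p.1 = HahnSeries.orderTop p.2 := by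
    intro p hp
    rw [hP2, Finset.mem_filter, Finset.mem_product] at hp
    exact ⟨hp.1.1, hp.1.2, le_antisymm (not_lt.mp hp.2) (hPQ _ hp.1.1 _ hp.1.2)⟩
  -- two-fold sums
  have htwo : ∀ R : Finset (LaurentSeries F × LaurentSeries F), e ≤ R.card →
      (∀ p ∈ R, p.1 ∈ P ∧ p.2 ∈ Q ∧
        HahnSeries.orderTop (p.1 + p.2) = HahnSeries.orderTop p.2) →
      ∃ E ⊆ SP.target A, e ≤ E.card ∧ ∀ s ∈ E,
        HahnSeries.orderTop (s.2 / s.1 - a) = HahnSeries.orderTop (b - a) := by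
    intro R hR hRp
    refine ⟨R.image (fun p => (p.1 + p.2, a * p.1 + b * p.2)), ?_, ?_, ?_⟩
    · intro s hs
      obtain ⟨p, hp, rfl⟩ := Finset.mem_image.mp hs
      obtain ⟨h1, h2, -⟩ := hRp p hp
      refine Finset.mem_union_left _ (Finset.mk_mem_product ?_ ?_)
      · exact Finset.add_mem_add (hPA _ h1).1 (hQA _ h2).1
      · exact Finset.add_mem_add (hPA _ h1).2 (hQA _ h2).2
    · rw [Finset.card_image_of_injective]
      · exact hR
      · intro p p' hpp
        simp only [Prod.mk.injEq] at hpp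
        obtain ⟨h1, h2⟩ := SP.pair_inj hab hpp.1 hpp.2
        exact Prod.ext h1 h2
    · intro s hs
      obtain ⟨p, hp, rfl⟩ := Finset.mem_image.mp hs
      obtain ⟨h1, h2, h3⟩ := hRp p hp
      exact SP.slope_good (h0 _ (hQA _ h2).1) h3
  rcases le_or_gt e P1.card with h | h
  · refine htwo P1 h (fun p hp => ?_)
    obtain ⟨h1, h2, h3⟩ := hmem1 p hp
    exact ⟨h1, h2, HahnSeries.orderTop_add_eq_right h3⟩
  have hP2e : e ≤ P2.card := by omega
  by_cases h2 : (2 : F) = 0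
  · -- characteristic two
    set r : LaurentSeries F → LaurentSeries F := fun y =>
      if h : ∃ x ∈ P, HahnSeries.orderTop x = HahnSeries.orderTop y then h.choose else 0 with hr
    have hrs : ∀ p ∈ P2, r p.2 ∈ P ∧
        HahnSeries.orderTop (r p.2) = HahnSeries.orderTop p.2 := by
      intro p hp
      obtain ⟨h1, h2, h3⟩ := hmem2 p hp
      have hex : ∃ x ∈ P, HahnSeries.orderTop x = HahnSeries.orderTop p.2 := ⟨p.1, h1, h3⟩
      simp only [hr, hex, dif_pos]
      exact hex.choose_spec
    refine ⟨P2.image (fun p => (p.1 + r p.2 + p.2, a * (p.1 + r p.2) + b * p.2)), ?_, ?_, ?_⟩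
    · intro s hs
      obtain ⟨p, hp, rfl⟩ := Finset.mem_image.mp hs
      obtain ⟨h1, h2, -⟩ := hmem2 p hp
      have h4 := (hrs p hp).1
      refine Finset.mem_union_right _ (Finset.mk_mem_product ?_ ?_)
      · exact Finset.add_mem_add (Finset.add_mem_add (hPA _ h1).1 (hPA _ h4).1) (hQA _ h2).1
      · rw [mul_add]
        exact Finset.add_mem_add (Finset.add_mem_add (hPA _ h1).2 (hPA _ h4).2) (hQA _ h2).2
    · rw [Finset.card_image_of_injective]
      · exact hP2e
      · intro p p' hpp
        simp only [Prod.mk.injEq] at hpp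
        obtain ⟨h1, h2⟩ := SP.pair_inj hab hpp.1 hpp.2
        rw [h2] at h1
        exact Prod.ext (add_right_cancel h1) h2
    · intro s hs
      obtain ⟨p, hp, rfl⟩ := Finset.mem_image.mp hs
      obtain ⟨h1, h2', h3⟩ := hmem2 p hp
      obtain ⟨h4, h5⟩ := hrs p hp
      have hr0 := h0 _ (hPA _ h4).1
      refine SP.slope_good (h0 _ (hQA _ h2').1) (HahnSeries.orderTop_add_eq_right ?_)
      rw [← h5]
      exact SP.ord_add_two h2 hr0 (hlc _ (hPA _ h1).1 _ (hPA _ h4).1) (h3.trans h5.symm)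
  · refine htwo P2 hP2e (fun p hp => ?_)
    obtain ⟨h1, h2', h3⟩ := hmem2 p hp
    exact ⟨h1, h2', SP.ord_add_same h2 (h0 _ (hQA _ h2').1)
      (hlc _ (hPA _ h1).1 _ (hQA _ h2').1) h3⟩

open Classical in
theorem SP.bad_edge {F : Type} [Field F] (A : Finset (LaurentSeries F))
    (h0 : ∀ x ∈ A, x ≠ 0)
    (a b : LaurentSeries F) (hab : a ≠ b) (m : ℕ)
    (P Q : Finset (LaurentSeries F)) (hP : P ⊆ SP.fib A a) (hQ : Q ⊆ SP.fib A b)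
    (hPm : m ≤ P.card) (hQm : m ≤ Q.card)
    (hPQ : ∀ x ∈ P, ∀ y ∈ Q, HahnSeries.orderTop x < HahnSeries.orderTop y) :
    ∃ E ⊆ SP.target A, m * m ≤ E.card ∧ ∀ s ∈ E,
      HahnSeries.orderTop (b - a) < HahnSeries.orderTop (s.2 / s.1 - a) ∧
      ∃ x ∈ P, HahnSeries.orderTop s.1 = HahnSeries.orderTop x := by
  have hPA : ∀ x ∈ P, x ∈ A ∧ a * x ∈ A := fun x hx => by
    simpa [SP.fib] using hP hx
  have hQA : ∀ x ∈ Q, x ∈ A ∧ b * x ∈ A := fun x hx => by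
    simpa [SP.fib] using hQ hx
  refine ⟨(P ×ˢ Q).image (fun p => (p.1 + p.2, a * p.1 + b * p.2)), ?_, ?_, ?_⟩
  · intro s hs
    obtain ⟨p, hp, rfl⟩ := Finset.mem_image.mp hs
    obtain ⟨h1, h2⟩ := Finset.mem_product.mp hp
    refine Finset.mem_union_left _ (Finset.mk_mem_product ?_ ?_)
    · exact Finset.add_mem_add (hPA _ h1).1 (hQA _ h2).1
    · exact Finset.add_mem_add (hPA _ h1).2 (hQA _ h2).2
  · rw [Finset.card_image_of_injective]
    · rw [Finset.card_product]
      exact Nat.mul_le_mul hPm hQm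
    · intro p p' hpp
      simp only [Prod.mk.injEq] at hpp
      obtain ⟨h1, h2⟩ := SP.pair_inj hab hpp.1 hpp.2
      exact Prod.ext h1 h2
  · intro s hs
    obtain ⟨p, hp, rfl⟩ := Finset.mem_image.mp hs
    obtain ⟨h1, h2⟩ := Finset.mem_product.mp hp
    have h3 := hPQ _ h1 _ h2
    exact ⟨SP.slope_bad hab (h0 _ (hPA _ h1).1) (h0 _ (hQA _ h2).1) h3,
      p.1, h1, HahnSeries.orderTop_add_eq_left h3⟩

open Classical in
theorem SP.sum_fib_le {F : Type} [Field F] (A S : Finset (LaurentSeries F)) (h0 : ∀ x ∈ A, x ≠ 0) :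
    ∑ a ∈ S, (SP.fib A a).card ≤ A.card * A.card := by
  rw [← Finset.card_sigma, ← Finset.card_product]
  refine Finset.card_le_card_of_injOn (fun p => (p.2, p.1 * p.2)) ?_ ?_
  · intro p hp
    have hp' := Finset.mem_sigma.mp (Finset.mem_coe.mp hp)
    have h2 : p.2 ∈ A ∧ p.1 * p.2 ∈ A := by simpa [SP.fib] using hp'.2
    exact Finset.mem_coe.mpr (Finset.mk_mem_product h2.1 h2.2)
  · rintro ⟨a, x⟩ hp ⟨b, y⟩ hq h
    have hp' := Finset.mem_sigma.mp (Finset.mem_coe.mp hp)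
    have h2 : x ∈ A ∧ a * x ∈ A := by simpa [SP.fib] using hp'.2
    simp only [Prod.mk.injEq] at h
    obtain ⟨rfl, h⟩ := h
    have := mul_right_cancel₀ (h0 _ h2.1) h
    subst this
    rfl

open Classical in
theorem SP.card_sq_le_target {F : Type} [Field F] (A : Finset (LaurentSeries F)) :
    A.card * A.card ≤ (SP.target A).card := by
  have h1 : A.card ≤ (A + A).card := by
    rcases A.eq_empty_or_nonempty with h | h
    · simp [h]
    · exact Finset.card_le_card_add_right h
  calc A.card * A.card ≤ (A + A).card * (A + A).card := Nat.mul_le_mul h1 h1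
    _ = ((A + A) ×ˢ (A + A)).card := (Finset.card_product _ _).symm
    _ ≤ _ := Finset.card_le_card Finset.subset_union_left

open Classical in
theorem SP.level {F : Type} [Field F] [Fintype F] (A : Finset (LaurentSeries F))
    (h0 : ∀ x ∈ A, x ≠ 0) (hlc : ∀ x ∈ A, ∀ y ∈ A, x.leadingCoeff = y.leadingCoeff)
    (τ : ℕ) :
    ((A / A).filter (fun a => τ ≤ (SP.fib A a).card)).card * τ ^ 2 ≤
      100 * Fintype.card F * (SP.target A).card * (4 * Nat.log 2 A.card + 3) := by
  set S := (A / A).filter (fun a => τ ≤ (SP.fib A a).card) with hS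
  have hSτ : ∀ a ∈ S, τ ≤ (SP.fib A a).card := fun a ha => (Finset.mem_filter.mp ha).2
  have hq : 1 ≤ Fintype.card F := Fintype.card_pos
  set q := Fintype.card F
  set T := SP.target A with hT
  set l := Nat.log 2 A.card
  have hNT : A.card * A.card ≤ T.card := SP.card_sq_le_target A
  have hbig : T.card ≤ q * T.card * (4 * l + 3) := by
    calc T.card = 1 * T.card * 1 := by ring
      _ ≤ q * T.card * (4 * l + 3) := by gcongr; omega
  have hSsum : S.card * τ ≤ A.card * A.card := by
    refine le_trans ?_ (SP.sum_fib_le A S h0)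
    rw [← smul_eq_mul]
    exact Finset.card_nsmul_le_sum S _ τ hSτ
  rcases le_or_gt τ 2 with hτ | hτ
  · calc S.card * τ ^ 2 = S.card * τ * τ := by ring
      _ ≤ (A.card * A.card) * 2 := Nat.mul_le_mul hSsum hτ
      _ ≤ T.card * 2 := Nat.mul_le_mul_right _ hNT
      _ ≤ 100 * (q * T.card * (4 * l + 3)) := by omega
      _ = _ := by ring
  rcases S.eq_empty_or_nonempty with hSe | hSne
  · rw [hSe]; simp
  obtain ⟨m, hm1, h3m, hm5⟩ : ∃ m : ℕ, 1 ≤ m ∧ 3 * m ≤ τ ∧ τ ≤ 5 * m :=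
    ⟨τ / 3, by omega, by omega, by omega⟩
  obtain ⟨e, he1, he2⟩ : ∃ e : ℕ, 2 * e ≤ m * m + 1 ∧ m * m ≤ 2 * e :=
    ⟨(m * m + 1) / 2, by omega, by omega⟩
  have hmm : 1 ≤ m * m := Nat.mul_pos hm1 hm1
  have hth : ∀ a : LaurentSeries F, ∃ p : WithTop ℤ × WithTop ℤ, a ∈ S →
      m ≤ ((SP.fib A a).filter (fun x => HahnSeries.orderTop x ≤ p.1)).card ∧
      m ≤ ((SP.fib A a).filter
        (fun x => p.1 ≤ HahnSeries.orderTop x ∧ HahnSeries.orderTop x ≤ p.2)).card ∧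
      m ≤ ((SP.fib A a).filter (fun x => p.2 ≤ HahnSeries.orderTop x)).card := by
    intro a
    by_cases ha : a ∈ S
    · obtain ⟨p, hp⟩ := SP.thirds (SP.fib A a)
        (fun x : LaurentSeries F => HahnSeries.orderTop x) m hm1 (h3m.trans (hSτ a ha))
      refine ⟨p, fun _ => ?_⟩
      convert hp using 3
    · exact ⟨(0, 0), fun h => absurd h ha⟩
  choose p hp using hth
  obtain ⟨h, hh1, hh2, -, -⟩ := SP.tree T (fun s => s.2 / s.1) (fun s => HahnSeries.orderTop s.1)
    (fun a => (p a).2) (fun a => (p a).1) e S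
    (by
      intro a ha b hb hab hle
      refine SP.good_edge A h0 hlc a b hab m e he1 _ _ (Finset.filter_subset _ _)
        (Finset.filter_subset _ _) (hp a ha).2.2 (hp b hb).1 ?_
      intro x hx y hy
      exact ((Finset.mem_filter.mp hy).2.trans hle).trans (Finset.mem_filter.mp hx).2)
    (by
      intro a ha b hb hab hlt
      obtain ⟨E, hE1, hE2, hE3⟩ := SP.bad_edge A h0 a b hab m
        ((SP.fib A a).filter
          (fun x => (p a).1 ≤ HahnSeries.orderTop x ∧ HahnSeries.orderTop x ≤ (p a).2))
        ((SP.fib A b).filter (fun x => (p b).1 ≤ HahnSeries.orderTop x))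
        (Finset.filter_subset _ _)
        (Finset.filter_subset _ _) (hp a ha).2.1
        ((hp b hb).2.1.trans (Finset.card_le_card (fun x hx => Finset.mem_filter.mpr
          ⟨(Finset.mem_filter.mp hx).1, (Finset.mem_filter.mp hx).2.1⟩))) (by
          intro x hx y hy
          exact ((Finset.mem_filter.mp hx).2.2.trans_lt hlt).trans_le (Finset.mem_filter.mp hy).2)
      refine ⟨E, hE1, by omega, ?_⟩
      intro s hs
      obtain ⟨h1, x, hx, h2⟩ := hE3 s hs
      have hx' := (Finset.mem_filter.mp hx).2
      rw [h2]
      exact ⟨h1, hx'.1, hx'.2⟩)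
    S.card S (Finset.Subset.refl _) rfl hSne
  have hScard : S.card ≤ A.card * A.card := by
    refine le_trans ?_ hSsum
    exact Nat.le_mul_of_pos_right _ (by omega)
  have hlog : Nat.log 2 S.card ≤ 2 * l + 1 := by
    have h1 : A.card < 2 ^ (l + 1) := Nat.lt_pow_succ_log_self (by norm_num) _
    have h2 : S.card < 2 ^ (2 * l + 2) := by
      calc S.card ≤ A.card * A.card := hScard
        _ < 2 ^ (l + 1) * 2 ^ (l + 1) := Nat.mul_lt_mul'' h1 h1
        _ = 2 ^ (2 * l + 2) := by rw [← pow_add]; congr 1; ring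
    have := Nat.log_lt_of_lt_pow hSne.card_pos.ne' h2
    omega
  have hsum : ∑ s ∈ T, h s ≤ T.card * (4 * l + 3) := by
    rw [← smul_eq_mul]
    refine Finset.sum_le_card_nsmul T _ _ (fun s hs => ?_)
    have := hh2 s hs
    omega
  have hfibA : τ ≤ A.card := by
    obtain ⟨a, ha⟩ := hSne
    exact (hSτ a ha).trans (Finset.card_le_card (Finset.filter_subset _ _))
  have heT : e ≤ T.card := by
    refine le_trans ?_ hNT
    have : m * m ≤ A.card * A.card := Nat.mul_le_mul (by omega) (by omega)
    omega
  have hτe : τ ^ 2 ≤ 50 * e := by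
    have : τ ^ 2 ≤ (5 * m) ^ 2 := Nat.pow_le_pow_left hm5 2
    nlinarith
  have hfin : e * S.card ≤ 2 * (q * T.card * (4 * l + 3)) := by
    have h1 : q * ∑ s ∈ T, h s ≤ q * T.card * (4 * l + 3) := by
      rw [mul_assoc]; exact Nat.mul_le_mul_left _ hsum
    have hh1' : e * S.card ≤ e + q * ∑ s ∈ T, h s := hh1
    omega
  calc S.card * τ ^ 2 ≤ S.card * (50 * e) := Nat.mul_le_mul_left _ hτe
    _ = 50 * (e * S.card) := by ring
    _ ≤ 50 * (2 * (q * T.card * (4 * l + 3))) := Nat.mul_le_mul_left _ hfin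
    _ = _ := by ring

open Classical in
theorem SP.energy_le {F : Type} [Field F] [Fintype F] (A : Finset (LaurentSeries F))
    (h0 : ∀ x ∈ A, x ≠ 0) (hlc : ∀ x ∈ A, ∀ y ∈ A, x.leadingCoeff = y.leadingCoeff) :
    A.card ^ 4 ≤ (A * A).card * (1600 * Fintype.card F * (SP.target A).card *
      (Nat.log 2 A.card + 1) ^ 2) := by
  have h1 : A.card ^ 4 ≤ (A * A).card * Finset.mulEnergy A A := by
    have := Finset.le_card_mul_mul_mulEnergy A A
    calc A.card ^ 4 = A.card ^ 2 * A.card ^ 2 := by ring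
      _ ≤ _ := this
  refine h1.trans (Nat.mul_le_mul_left _ ?_)
  have h2 : Finset.mulEnergy A A ≤ ∑ a ∈ A / A, (SP.fib A a).card ^ 2 := by
    unfold Finset.mulEnergy
    rw [Finset.card_eq_sum_card_fiberwise (f := fun x => x.1.1 / x.1.2) (t := A / A)]
    · refine Finset.sum_le_sum (fun a ha => ?_)
      rw [sq, ← Finset.card_product]
      refine Finset.card_le_card_of_injOn (fun x => (x.1.2, x.2.1)) ?_ ?_
      · intro x hx
        simp only [Finset.coe_filter, Finset.mem_filter, Finset.mem_product, Set.mem_setOf_eq] at hx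
        obtain ⟨⟨⟨⟨h11, h12⟩, h21, h22⟩, heq⟩, hdiv⟩ := hx
        have hne := h0 _ h12
        rw [div_eq_iff hne] at hdiv
        refine Finset.mem_coe.mpr (Finset.mk_mem_product ?_ ?_)
        · refine Finset.mem_filter.mpr ⟨h12, ?_⟩
          rw [← hdiv]; exact h11
        · refine Finset.mem_filter.mpr ⟨h21, ?_⟩
          have : a * x.2.1 = x.2.2 := by
            apply mul_left_cancel₀ hne
            rw [← heq, hdiv]; ring
          rw [this]; exact h22
      · intro x hx y hy hxy
        simp only [Finset.coe_filter, Finset.mem_filter, Finset.mem_product, Set.mem_setOf_eq] at hx hy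
        obtain ⟨⟨⟨⟨h11, h12⟩, h21, h22⟩, heq⟩, hdiv⟩ := hx
        obtain ⟨⟨⟨⟨g11, g12⟩, g21, g22⟩, geq⟩, gdiv⟩ := hy
        rw [div_eq_iff (h0 _ h12)] at hdiv
        rw [div_eq_iff (h0 _ g12)] at gdiv
        simp only [Prod.mk.injEq] at hxy
        have e1 : x.1.1 = y.1.1 := by rw [hdiv, gdiv, hxy.1]
        have e2 : x.2.2 = y.2.2 := by
          apply mul_left_cancel₀ (h0 _ h12)
          rw [← heq, e1, hxy.2, geq, hxy.1]
        exact Prod.ext (Prod.ext e1 hxy.1) (Prod.ext hxy.2 e2)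
    · intro x hx
      simp only [Finset.coe_filter, Finset.mem_product, Set.mem_setOf_eq] at hx
      exact Finset.mem_coe.mpr (Finset.div_mem_div hx.1.1.1 hx.1.1.2)
  refine h2.trans ?_
  set l := Nat.log 2 A.card with hl
  have h3 : ∀ a ∈ A / A, (SP.fib A a).card ^ 2 ≤
      ∑ j ∈ Finset.range (l + 1), if 2 ^ j ≤ (SP.fib A a).card then 4 * (2 ^ j) ^ 2 else 0 := by
    intro a _
    set f := (SP.fib A a).card with hf
    rcases Nat.eq_zero_or_pos f with hf0 | hfpos
    · rw [hf0]; simp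
    have hfA : f ≤ A.card := Finset.card_le_card (Finset.filter_subset _ _)
    have hj : Nat.log 2 f ∈ Finset.range (l + 1) :=
      Finset.mem_range.mpr (Nat.lt_succ_of_le (Nat.log_mono_right hfA))
    refine le_trans ?_ (Finset.single_le_sum (f := fun j => if 2 ^ j ≤ f then 4 * (2 ^ j) ^ 2 else 0)
      (fun _ _ => Nat.zero_le _) hj)
    have h4 : 2 ^ Nat.log 2 f ≤ f := Nat.pow_log_le_self 2 hfpos.ne'
    have h5 : f < 2 ^ (Nat.log 2 f + 1) := Nat.lt_pow_succ_log_self (by norm_num) _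
    simp only [h4, if_true]
    calc f ^ 2 ≤ (2 ^ (Nat.log 2 f + 1)) ^ 2 := Nat.pow_le_pow_left h5.le 2
      _ = 4 * (2 ^ Nat.log 2 f) ^ 2 := by rw [pow_succ]; ring
  refine (Finset.sum_le_sum h3).trans ?_
  rw [Finset.sum_comm]
  have h6 : ∀ j ∈ Finset.range (l + 1),
      (∑ a ∈ A / A, if 2 ^ j ≤ (SP.fib A a).card then 4 * (2 ^ j) ^ 2 else 0) ≤
      4 * (100 * Fintype.card F * (SP.target A).card * (4 * l + 3)) := by
    intro j _
    rw [← Finset.sum_filter, Finset.sum_const, smul_eq_mul]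
    have := SP.level A h0 hlc (2 ^ j)
    calc _ = 4 * (((A / A).filter (fun a => 2 ^ j ≤ (SP.fib A a).card)).card * (2 ^ j) ^ 2) := by
          ring
      _ ≤ _ := Nat.mul_le_mul_left _ this
  refine (Finset.sum_le_card_nsmul _ _ _ h6).trans ?_
  rw [Finset.card_range, smul_eq_mul]
  calc (l + 1) * (4 * (100 * Fintype.card F * (SP.target A).card * (4 * l + 3)))
      ≤ (l + 1) * (4 * (100 * Fintype.card F * (SP.target A).card * (4 * (l + 1)))) := by
        gcongr; omega
    _ = _ := by ring

/-- Pluennecke with a large subset -/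
theorem SP.large_subset {G : Type} [AddCommGroup G] [DecidableEq G] (A : Finset G)  :
    ∃ A₁ ⊆ A, A.card ≤ 2 * A₁.card ∧
      (A₁ + A + A).card * A.card ^ 2 ≤ 4 * (A + A).card ^ 2 * A₁.card := by
  obtain ⟨A₁, hA₁, hmax⟩ := Finset.exists_max_image
    (A.powerset.filter (fun B => (B + A + A).card * A.card ^ 2 ≤ 4 * (A + A).card ^ 2 * B.card))
    Finset.card ⟨∅, by simp⟩
  rw [Finset.mem_filter, Finset.mem_powerset] at hA₁
  refine ⟨A₁, hA₁.1, ?_, hA₁.2⟩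
  by_contra hcon
  push Not at hcon
  set B := A \ A₁ with hB
  have hBc : B.card + A₁.card = A.card := Finset.card_sdiff_add_card_eq_card hA₁.1
  have hBne : B.Nonempty := Finset.card_pos.mp (by omega)
  obtain ⟨X, hX, hXmin⟩ := Finset.exists_min_image (B.powerset.filter (fun X => X.Nonempty))
    (fun X => ((X + A).card : ℚ) / X.card) ⟨B, by simp [hBne]⟩
  simp only [Finset.mem_filter, Finset.mem_powerset] at hX hXmin
  obtain ⟨hXB, hXne⟩ := hX
  have hXpos : 0 < X.card := hXne.card_pos
  have hmin : ∀ X' ⊆ B, (X + A).card * X'.card ≤ (X' + A).card * X.card := by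
    intro X' hX'
    rcases X'.eq_empty_or_nonempty with h | h
    · simp [h]
    · have h1 := hXmin X' ⟨hX', h⟩
      have h2 : 0 < X'.card := h.card_pos
      rw [div_le_div_iff₀ (by exact_mod_cast hXpos) (by exact_mod_cast h2)] at h1
      exact_mod_cast h1
  have hpet := Finset.pluennecke_petridis_inequality_add (A := X) (B := A) A
    (fun X' hX' => hmin X' (hX'.trans hXB))
  rw [add_comm A X] at hpet
  have hXA : (X + A).card * B.card ≤ (A + A).card * X.card := by
    refine (hmin B (Finset.Subset.refl _)).trans (Nat.mul_le_mul_right _ ?_)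
    exact Finset.card_le_card (Finset.add_subset_add_right Finset.sdiff_subset)
  have hXgood : (X + A + A).card * A.card ^ 2 ≤ 4 * (A + A).card ^ 2 * X.card := by
    have hAB : A.card ≤ 2 * B.card := by omega
    apply Nat.le_of_mul_le_mul_right _ hXpos
    calc (X + A + A).card * A.card ^ 2 * X.card = (X + A + A).card * X.card * A.card ^ 2 := by ring
      _ ≤ ((X + A).card * (X + A).card) * (2 * B.card) ^ 2 := by gcongr
      _ = 4 * ((X + A).card * B.card) ^ 2 := by ring
      _ ≤ 4 * ((A + A).card * X.card) ^ 2 := by gcongr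
      _ = _ := by ring
  have hdis : Disjoint A₁ X := by
    refine Finset.disjoint_left.mpr (fun x hx hx' => ?_)
    exact (Finset.mem_sdiff.mp (hXB hx')).2 hx
  have hUc : (A₁ ∪ X).card = A₁.card + X.card := Finset.card_union_of_disjoint hdis
  have := hmax (A₁ ∪ X) (by
    rw [Finset.mem_filter, Finset.mem_powerset]
    refine ⟨Finset.union_subset hA₁.1 (hXB.trans Finset.sdiff_subset), ?_⟩
    rw [Finset.union_add, Finset.union_add, hUc]
    have h1 := Finset.card_union_le (A₁ + A + A) (X + A + A)
    have h2 := Nat.mul_le_mul_right (A.card ^ 2) h1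
    have h3 := hA₁.2
    nlinarith)
  omega

open Classical in
theorem SP.main_nat {F : Type} [Field F] [Fintype F] (A : Finset (LaurentSeries F))
    (h0 : ∀ x ∈ A, x ≠ 0) (hlc : ∀ x ∈ A, ∀ y ∈ A, x.leadingCoeff = y.leadingCoeff)
    (M : ℕ) (hM1 : (A + A).card ≤ M) (hM2 : (A * A).card ≤ M) :
    A.card ^ 6 ≤ 819200 * Fintype.card F * (Nat.log 2 A.card + 1) ^ 2 * M ^ 5 := by
  obtain ⟨A₁, hsub, hcard, hpl⟩ := SP.large_subset A
  rcases A.eq_empty_or_nonempty with hAe | hAne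
  · rw [hAe]; simp
  have hApos : 0 < A.card := hAne.card_pos
  have hA₁pos : 0 < A₁.card := by omega
  have hA₁ne := Finset.card_pos.mp hA₁pos
  have hle : A₁.card ≤ A.card := Finset.card_le_card hsub
  have h1 := SP.energy_le A₁ (fun x hx => h0 x (hsub hx))
    (fun x hx y hy => hlc x (hsub hx) y (hsub hy))
  set t := (A₁ + A₁ + A₁).card with ht
  have h2 : (A₁ + A₁).card ≤ t := Finset.card_le_card_add_right hA₁ne
  have hT : (SP.target A₁).card ≤ 2 * t ^ 2 := by
    refine (Finset.card_union_le _ _).trans ?_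
    rw [Finset.card_product, Finset.card_product]
    nlinarith
  have ht2 : t * A.card ≤ 4 * M ^ 2 := by
    apply Nat.le_of_mul_le_mul_right _ hApos
    calc t * A.card * A.card = t * A.card ^ 2 := by ring
      _ ≤ (A₁ + A + A).card * A.card ^ 2 := by
        refine Nat.mul_le_mul_right _ (Finset.card_le_card ?_)
        exact Finset.add_subset_add (Finset.add_subset_add_left hsub) hsub
      _ ≤ 4 * (A + A).card ^ 2 * A₁.card := hpl
      _ ≤ 4 * M ^ 2 * A.card := by gcongr
  have hAA : (A₁ * A₁).card ≤ M :=
    (Finset.card_le_card (Finset.mul_subset_mul hsub hsub)).trans hM2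
  have hlog : Nat.log 2 A₁.card ≤ Nat.log 2 A.card := Nat.log_mono_right hle
  calc A.card ^ 6 = A.card ^ 4 * A.card ^ 2 := by ring
    _ ≤ (2 * A₁.card) ^ 4 * A.card ^ 2 := by gcongr
    _ = 16 * A₁.card ^ 4 * A.card ^ 2 := by ring
    _ ≤ 16 * ((A₁ * A₁).card * (1600 * Fintype.card F * (SP.target A₁).card *
      (Nat.log 2 A₁.card + 1) ^ 2)) * A.card ^ 2 := by gcongr
    _ ≤ 16 * (M * (1600 * Fintype.card F * (2 * t ^ 2) *
      (Nat.log 2 A.card + 1) ^ 2)) * A.card ^ 2 := by gcongr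
    _ = 51200 * Fintype.card F * (Nat.log 2 A.card + 1) ^ 2 * M * (t * A.card) ^ 2 := by ring
    _ ≤ 51200 * Fintype.card F * (Nat.log 2 A.card + 1) ^ 2 * M * (4 * M ^ 2) ^ 2 := by gcongr
    _ = _ := by ring

open Classical in
theorem SP.main_nat' {F : Type} [Field F] [Fintype F] (A : Finset (LaurentSeries F))
    (hne : A.Nonempty)
    (M : ℕ) (hM1 : (A + A).card ≤ M) (hM2 : (A * A).card ≤ M) :
    A.card ^ 6 ≤ (2 * Fintype.card F) ^ 6 * (819200 * Fintype.card F) *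
      (Nat.log 2 A.card + 1) ^ 2 * M ^ 5 := by
  have hq : 1 ≤ Fintype.card F := Fintype.card_pos
  have hMA : A.card ≤ M := (Finset.card_le_card_add_right hne).trans hM1
  have hApos := hne.card_pos
  rcases Nat.lt_or_ge A.card 2 with h1 | h2
  · have : A.card = 1 := by omega
    rw [this]
    have hMpos : 1 ≤ M := by omega
    have : 1 ≤ (2 * Fintype.card F) ^ 6 * (819200 * Fintype.card F) *
      (Nat.log 2 1 + 1) ^ 2 * M ^ 5 := by
      apply Nat.succ_le_of_lt
      positivity
    simpa using this
  obtain ⟨c, -, hc⟩ := Finset.exists_max_image (Finset.univ : Finset F)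
    (fun c => ((A.erase 0).filter (fun x => x.leadingCoeff = c)).card) Finset.univ_nonempty
  set B := (A.erase 0).filter (fun x => x.leadingCoeff = c) with hB
  have hBA : B ⊆ A := (Finset.filter_subset _ _).trans (Finset.erase_subset _ _)
  have hsum : (A.erase 0).card ≤ Fintype.card F * B.card := by
    rw [Finset.card_eq_sum_card_fiberwise (f := fun x : LaurentSeries F => x.leadingCoeff)
      (t := Finset.univ) (fun _ _ => Finset.mem_coe.mpr (Finset.mem_univ _))]
    refine (Finset.sum_le_card_nsmul _ _ _ hc).trans ?_
    rw [Finset.card_univ, smul_eq_mul]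
  have h3 := Finset.pred_card_le_card_erase (s := A) (a := 0)
  have h4 : A.card ≤ 2 * Fintype.card F * B.card := by
    rw [mul_assoc]; omega
  have h5 := SP.main_nat B
    (fun x hx => (Finset.mem_erase.mp (Finset.mem_filter.mp hx).1).1)
    (fun x hx y hy => by rw [(Finset.mem_filter.mp hx).2, (Finset.mem_filter.mp hy).2])
    M ((Finset.card_le_card (Finset.add_subset_add hBA hBA)).trans hM1)
    ((Finset.card_le_card (Finset.mul_subset_mul hBA hBA)).trans hM2)
  have hlog : Nat.log 2 B.card ≤ Nat.log 2 A.card :=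
    Nat.log_mono_right (Finset.card_le_card hBA)
  calc A.card ^ 6 ≤ (2 * Fintype.card F * B.card) ^ 6 := Nat.pow_le_pow_left h4 6
    _ = (2 * Fintype.card F) ^ 6 * B.card ^ 6 := by ring
    _ ≤ (2 * Fintype.card F) ^ 6 * (819200 * Fintype.card F *
        (Nat.log 2 B.card + 1) ^ 2 * M ^ 5) := by gcongr
    _ ≤ (2 * Fintype.card F) ^ 6 * (819200 * Fintype.card F *
        (Nat.log 2 A.card + 1) ^ 2 * M ^ 5) := by gcongr
    _ = _ := by ring

theorem SP.log_bound (δ : ℝ) (hδ : 0 < δ) : ∃ C : ℝ, 0 < C ∧ ∀ N : ℕ, 1 ≤ N →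
    ((Nat.log 2 N : ℝ) + 1) ≤ C * (N : ℝ) ^ δ := by
  have hl2 : 0 < Real.log 2 := Real.log_pos (by norm_num)
  refine ⟨1 / (δ * Real.log 2) + 1, by positivity, fun N hN => ?_⟩
  have hN' : (1 : ℝ) ≤ N := by exact_mod_cast hN
  have h1 : (Nat.log 2 N : ℝ) * Real.log 2 ≤ Real.log N := by
    rw [← Real.log_pow]
    apply Real.log_le_log (by positivity)
    exact_mod_cast Nat.pow_log_le_self 2 (by omega : N ≠ 0)
  have h2 := Real.log_le_rpow_div (by linarith : (0 : ℝ) ≤ N) hδ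
  have h3 : (1 : ℝ) ≤ (N : ℝ) ^ δ := Real.one_le_rpow hN' hδ.le
  have h4 : (Nat.log 2 N : ℝ) ≤ 1 / (δ * Real.log 2) * (N : ℝ) ^ δ := by
    have : (Nat.log 2 N : ℝ) ≤ (N : ℝ) ^ δ / δ / Real.log 2 := by
      rw [le_div_iff₀ hl2]; exact h1.trans h2
    refine this.trans (le_of_eq ?_)
    field_simp
  linarith

theorem stmt6 (F : Type) [Field F] [Fintype F] :
    ∀ ε : ℝ, 0 < ε → ∃ c : ℝ, 0 < c ∧
      ∀ A : Set (RatFunc F), A.Finite → A.Nonempty →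
        c * (A.ncard : ℝ) ^ ((1 : ℝ) + 1 / 5 - ε) ≤
          ((max (A + A).ncard (A * A).ncard : ℕ) : ℝ) := by
  classical
  intro ε hε
  obtain ⟨C, hC, hlog⟩ := SP.log_bound (5 * ε / 2) (by positivity)
  set D : ℝ := (2 * Fintype.card F) ^ 6 * (819200 * Fintype.card F) * C ^ 2 with hD
  have hq : (0 : ℝ) < Fintype.card F := by exact_mod_cast Fintype.card_pos
  have hDpos : 0 < D := by positivity
  refine ⟨(D ^ (1 / 5 : ℝ))⁻¹, by positivity, ?_⟩
  intro A hfin hne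
  obtain ⟨B, rfl⟩ := hfin.exists_finset_coe
  have hBne : B.Nonempty := by exact_mod_cast hne
  rw [← Finset.coe_add, ← Finset.coe_mul, Set.ncard_coe_finset, Set.ncard_coe_finset,
    Set.ncard_coe_finset]
  set M : ℕ := max (B + B).card (B * B).card with hM
  set φ : RatFunc F →+* LaurentSeries F := @algebraMap (RatFunc F) (LaurentSeries F) _ _ (RatFunc.liftAlgebra F (LaurentSeries F)) with hφ
  have hinj : Function.Injective φ := φ.injective
  have hcard : (B.image φ).card = B.card := Finset.card_image_of_injective _ hinj
  have hadd : (B.image φ + B.image φ).card = (B + B).card := by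
    rw [← Finset.image_add, Finset.card_image_of_injective _ hinj]
  have hmul : (B.image φ * B.image φ).card = (B * B).card := by
    rw [← Finset.image_mul, Finset.card_image_of_injective _ hinj]
  have key := SP.main_nat' (B.image φ) (hBne.image φ) M
    (by rw [hadd]; exact le_max_left _ _) (by rw [hmul]; exact le_max_right _ _)
  rw [hcard] at key
  set N := B.card with hN
  have hN1 : 1 ≤ N := hBne.card_pos
  have hN0 : (0 : ℝ) < N := by exact_mod_cast hN1
  have keyR : (N : ℝ) ^ 6 ≤ (2 * Fintype.card F) ^ 6 * (819200 * Fintype.card F) *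
      ((Nat.log 2 N : ℝ) + 1) ^ 2 * (M : ℝ) ^ 5 := by exact_mod_cast key
  have h1 : ((Nat.log 2 N : ℝ) + 1) ^ 2 ≤ C ^ 2 * (N : ℝ) ^ (5 * ε) := by
    calc ((Nat.log 2 N : ℝ) + 1) ^ 2 ≤ (C * (N : ℝ) ^ (5 * ε / 2)) ^ 2 := by
          gcongr; exact hlog N hN1
      _ = C ^ 2 * ((N : ℝ) ^ (5 * ε / 2)) ^ 2 := by ring
      _ = C ^ 2 * (N : ℝ) ^ (5 * ε) := by
          rw [← Real.rpow_natCast ((N : ℝ) ^ (5 * ε / 2)) 2, ← Real.rpow_mul hN0.le]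
          congr 2; push_cast; ring
  have h2 : (N : ℝ) ^ 6 ≤ D * (M : ℝ) ^ 5 * (N : ℝ) ^ (5 * ε) := by
    calc (N : ℝ) ^ 6 ≤ _ := keyR
      _ ≤ (2 * Fintype.card F) ^ 6 * (819200 * Fintype.card F) *
        (C ^ 2 * (N : ℝ) ^ (5 * ε)) * (M : ℝ) ^ 5 := by gcongr
      _ = _ := by rw [hD]; ring
  have h3 : ((N : ℝ) ^ ((1 : ℝ) + 1 / 5 - ε)) ^ 5 ≤ (D ^ (1 / 5 : ℝ) * M) ^ 5 := by
    have e1 : ((N : ℝ) ^ ((1 : ℝ) + 1 / 5 - ε)) ^ 5 = (N : ℝ) ^ 6 / (N : ℝ) ^ (5 * ε) := by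
      rw [← Real.rpow_natCast (_ ^ _) 5, ← Real.rpow_mul hN0.le, ← Real.rpow_natCast _ 6,
        ← Real.rpow_sub hN0]
      congr 1; push_cast; ring
    have e2 : (D ^ (1 / 5 : ℝ) * M) ^ 5 = D * (M : ℝ) ^ 5 := by
      rw [mul_pow, ← Real.rpow_natCast (_ ^ _) 5, ← Real.rpow_mul hDpos.le]
      norm_num
    rw [e1, e2, div_le_iff₀ (by positivity)]
    exact h2
  have h4 := le_of_pow_le_pow_left₀ (by norm_num) (by positivity) h3
  rw [inv_mul_le_iff₀ (by positivity)]
  exact h4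
end

section
/- There exist absolute constants c > 0 and C > 0 such that for every prime p and every finite nonempty set A ⊆ F_p with 0 ∉ A, there exists a subset A' ⊆ A with |A'| ≥ c·|A| and |A' − A'| ≤ C · |A·(A+1)|⁸ / |A|⁷. -/
namespace AAone

variable {F : Type*} [Field F] [DecidableEq F]

/-- The set `A(A+1)`. -/
def S (A : Finset F) : Finset F := (A ×ˢ A).image fun x => x.1 * (x.2 + 1)

/-- The ratio set `A/A`. -/
def Q (A : Finset F) : Finset F := (A ×ˢ A).image fun x => x.1 / x.2

/-- `aA ∩ bA`. -/
def L (A : Finset F) (a b : F) : Finset F := (A.image (a * ·)) ∩ (A.image (b * ·))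

/-- unpopular pairs -/
def Bad (A : Finset F) (a b : F) : Prop := 8 * (Q A).card * (L A a b).card < A.card ^ 2

instance (A : Finset F) (a b : F) : Decidable (Bad A a b) := by unfold Bad; infer_instance

lemma mem_S {A : Finset F} {a b : F} (ha : a ∈ A) (hb : b ∈ A) : a * (b + 1) ∈ S A :=
  Finset.mem_image.2 ⟨(a, b), Finset.mem_product.2 ⟨ha, hb⟩, rfl⟩

lemma L_comm (A : Finset F) (a b : F) : L A a b = L A b a := Finset.inter_comm _ _

lemma bad_comm (A : Finset F) (a b : F) : Bad A a b ↔ Bad A b a := by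
  unfold Bad; rw [L_comm]

lemma ruzsa (A : Finset F) (h0 : (0 : F) ∉ A) :
    (Q A).card * (A.card - 1) ≤ (S A).card ^ 2 := by
  have hq : ∀ q : F, ∃ x : F × F, q ∈ Q A → x.1 ∈ A ∧ x.2 ∈ A ∧ x.1 / x.2 = q := by
    intro q
    by_cases h : q ∈ Q A
    · obtain ⟨x, hx, rfl⟩ := Finset.mem_image.1 h
      rw [Finset.mem_product] at hx
      exact ⟨x, fun _ => ⟨hx.1, hx.2, rfl⟩⟩
    · exact ⟨0, fun h' => absurd h' h⟩
  choose f hf using hq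
  have hB : A.card - 1 ≤ (A.erase (-1)).card := Finset.pred_card_le_card_erase
  calc (Q A).card * (A.card - 1) ≤ (Q A).card * (A.erase (-1)).card := by gcongr
    _ = (Q A ×ˢ A.erase (-1)).card := (Finset.card_product _ _).symm
    _ ≤ (S A ×ˢ S A).card := by
        apply Finset.card_le_card_of_injOn
          (fun x => ((f x.1).1 * (x.2 + 1), (f x.1).2 * (x.2 + 1)))
        · rintro ⟨q, b⟩ hx
          simp only [Finset.coe_product, Set.mem_prod, Finset.mem_coe, Finset.mem_erase] at hx ⊢
          obtain ⟨h1, h2, -⟩ := hf q hx.1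
          exact ⟨mem_S h1 hx.2.2, mem_S h2 hx.2.2⟩
        · rintro ⟨q, b⟩ hx ⟨q', b'⟩ hx' h
          simp only [Finset.coe_product, Set.mem_prod, Finset.mem_coe, Finset.mem_erase] at hx hx'
          simp only [Prod.mk.injEq] at h
          obtain ⟨h1, h2, h3⟩ := hf q hx.1
          obtain ⟨h1', h2', h3'⟩ := hf q' hx'.1
          have hb : b + 1 ≠ 0 := fun h => hx.2.1 (eq_neg_of_add_eq_zero_left h)
          have hb' : b' + 1 ≠ 0 := fun h => hx'.2.1 (eq_neg_of_add_eq_zero_left h)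
          have e : q = q' := by
            rw [← h3, ← h3', ← mul_div_mul_right _ _ hb, h.1, h.2, mul_div_mul_right _ _ hb']
          subst e
          have n2 : (f q).2 ≠ 0 := fun h => h0 (h ▸ h2)
          have := mul_left_cancel₀ n2 h.2
          rw [add_right_cancel this]
    _ = (S A).card ^ 2 := by rw [Finset.card_product, sq]

lemma bad_count (A : Finset F) (hA : A.Nonempty) (h0 : (0 : F) ∉ A) :
    8 * ((A ×ˢ A).filter fun x => Bad A x.1 x.2).card ≤ A.card ^ 2 := by
  have hQ : 0 < (Q A).card := Finset.card_pos.2 ((hA.product hA).image _)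
  have nz : ∀ {x}, x ∈ A → x ≠ 0 := fun hx h => h0 (h ▸ hx)
  have key : ((A ×ˢ A).filter fun x => Bad A x.1 x.2).card =
      ∑ q ∈ Q A, (((A ×ˢ A).filter fun x => Bad A x.1 x.2).filter
        fun x => x.1 / x.2 = q).card := by
    apply Finset.card_eq_sum_card_fiberwise
    intro x hx
    exact Finset.mem_coe.2 (Finset.mem_image_of_mem _ (Finset.mem_filter.1 hx).1)
  have hfib : ∀ q ∈ Q A, 8 * (Q A).card * (((A ×ˢ A).filter fun x => Bad A x.1 x.2).filter
        fun x => x.1 / x.2 = q).card ≤ A.card ^ 2 := by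
    intro q _
    rcases (((A ×ˢ A).filter fun x => Bad A x.1 x.2).filter
        fun x => x.1 / x.2 = q).eq_empty_or_nonempty with h | ⟨⟨a, b⟩, h⟩
    · rw [h]; simp
    · simp only [Finset.mem_filter, Finset.mem_product] at h
      obtain ⟨⟨⟨ha, hb⟩, hbad⟩, hab⟩ := h
      refine le_trans (Nat.mul_le_mul_left _ ?_) (le_of_lt hbad)
      apply Finset.card_le_card_of_injOn (fun x => a * x.2)
      · rintro ⟨c, d⟩ hx
        simp only [Finset.coe_filter, Finset.mem_filter, Finset.mem_product,
          Set.mem_setOf_eq] at hx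
        obtain ⟨⟨⟨hc, hd⟩, -⟩, hcd⟩ := hx
        have e : a * d = b * c := by
          have := hab.trans hcd.symm
          rw [div_eq_div_iff (nz hb) (nz hd)] at this
          rw [this, mul_comm]
        refine Finset.mem_coe.2 (Finset.mem_inter.2 ⟨Finset.mem_image.2 ⟨d, hd, rfl⟩,
          Finset.mem_image.2 ⟨c, hc, e.symm⟩⟩)
      · rintro ⟨c, d⟩ hx ⟨c', d'⟩ hx' h
        simp only [Finset.coe_filter, Finset.mem_filter, Finset.mem_product,
          Set.mem_setOf_eq] at hx hx' h
        have e : d = d' := mul_left_cancel₀ (nz ha) h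
        subst e
        have := hx.2.trans hx'.2.symm
        rw [div_left_inj' (nz hx.1.1.2)] at this
        rw [this]
  have := Finset.sum_le_sum hfib
  rw [← Finset.mul_sum, ← key, Finset.sum_const, smul_eq_mul] at this
  refine Nat.le_of_mul_le_mul_left ?_ hQ
  linarith

/-- the good subset -/
def Good (A : Finset F) : Finset F := A.filter fun a => 4 * (A.filter (Bad A a)).card ≤ A.card

lemma card_A' (A : Finset F) (hA : A.Nonempty) (h0 : (0 : F) ∉ A) :
    A.card ≤ 2 * (Good A).card := by
  have h1 := bad_count A hA h0
  have h2 : ((A ×ˢ A).filter fun x => Bad A x.1 x.2).card =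
      ∑ a ∈ A, (A.filter (Bad A a)).card := by
    simp only [Finset.card_filter, Finset.sum_product]
  set U := A.filter fun a => ¬ 4 * (A.filter (Bad A a)).card ≤ A.card with hU
  have h3 : U.card * A.card ≤ 4 * ∑ a ∈ A, (A.filter (Bad A a)).card := by
    rw [Finset.mul_sum]
    calc U.card * A.card ≤ ∑ a ∈ U, 4 * (A.filter (Bad A a)).card := by
          rw [← smul_eq_mul]
          apply Finset.card_nsmul_le_sum
          intro a ha
          have := (Finset.mem_filter.1 ha).2
          omega
      _ ≤ _ := Finset.sum_le_sum_of_subset (Finset.filter_subset _ _)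
  have h4 : (Good A).card + U.card = A.card := Finset.card_filter_add_card_filter_not _
  have h5 : 2 * U.card ≤ A.card := by
    refine Nat.le_of_mul_le_mul_left (c := A.card) ?_ hA.card_pos
    nlinarith
  omega

lemma mem_S_of_L {A : Finset F} {a b l : F} (ha : a ∈ A) (hb : b ∈ A)
    (hl : l ∈ L A a b) : l + a ∈ S A ∧ l + b ∈ S A := by
  obtain ⟨h1, h2⟩ := Finset.mem_inter.1 hl
  obtain ⟨x, hx, rfl⟩ := Finset.mem_image.1 h1
  obtain ⟨y, hy, e⟩ := Finset.mem_image.1 h2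
  constructor
  · have := mem_S ha hx
    rwa [mul_add, mul_one] at this
  · have := mem_S hb hy
    rw [mul_add, mul_one] at this
    rwa [e] at this

lemma rep_count (A : Finset F) (hA : A.Nonempty) (a b : F) (ha : a ∈ Good A) (hb : b ∈ Good A) :
    A.card ^ 5 ≤ 128 * (Q A).card ^ 2 * ((S A ×ˢ S A ×ˢ S A ×ˢ S A).filter
      fun s => s.1 - s.2.1 + (s.2.2.1 - s.2.2.2) = a - b).card := by
  obtain ⟨ha, ha'⟩ := Finset.mem_filter.1 ha
  obtain ⟨hb, hb'⟩ := Finset.mem_filter.1 hb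
  set G := A.filter fun c => ¬ Bad A a c ∧ ¬ Bad A b c with hG
  have hGc : A.card ≤ 2 * G.card := by
    have : A ⊆ G ∪ (A.filter (Bad A a) ∪ A.filter (Bad A b)) := by
      intro x hx
      simp only [hG, Finset.mem_union, Finset.mem_filter]
      tauto
    have h1 := Finset.card_le_card this
    have h2 := Finset.card_union_le G (A.filter (Bad A a) ∪ A.filter (Bad A b))
    have h3 := Finset.card_union_le (A.filter (Bad A a)) (A.filter (Bad A b))
    omega
  have hinj : (G.sigma fun c => L A a c ×ˢ L A b c).card ≤
      ((S A ×ˢ S A ×ˢ S A ×ˢ S A).filter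
      fun s => s.1 - s.2.1 + (s.2.2.1 - s.2.2.2) = a - b).card := by
    apply Finset.card_le_card_of_injOn
      (fun x => (x.2.1 + a, x.2.1 + x.1, x.2.2 + x.1, x.2.2 + b))
    · rintro ⟨c, l, m⟩ hx
      simp only [Finset.mem_coe, Finset.mem_sigma, Finset.mem_product, hG,
        Finset.mem_filter] at hx ⊢
      obtain ⟨⟨hc, -⟩, hl, hm⟩ := hx
      obtain ⟨s1, s2⟩ := mem_S_of_L ha hc hl
      obtain ⟨s3, s4⟩ := mem_S_of_L hb hc hm
      exact ⟨⟨s1, s2, s4, s3⟩, by ring⟩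
    · rintro ⟨c, l, m⟩ - ⟨c', l', m'⟩ - h
      simp only [Prod.mk.injEq] at h
      obtain ⟨h1, h2, -, h4⟩ := h
      have e1 := add_right_cancel h1
      have e2 := add_right_cancel h4
      subst e1 e2
      have e3 := add_left_cancel h2
      subst e3
      rfl
  rw [Finset.card_sigma] at hinj
  have hsum : G.card * A.card ^ 4 ≤
      64 * (Q A).card ^ 2 * ∑ c ∈ G, (L A a c ×ˢ L A b c).card := by
    rw [Finset.mul_sum, ← smul_eq_mul]
    apply Finset.card_nsmul_le_sum
    intro c hc
    obtain ⟨-, h1, h2⟩ := Finset.mem_filter.1 hc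
    unfold Bad at h1 h2
    push Not at h1 h2
    rw [Finset.card_product]
    calc A.card ^ 4 = A.card ^ 2 * A.card ^ 2 := by ring
      _ ≤ _ := Nat.mul_le_mul h1 h2
      _ = _ := by ring
  calc A.card ^ 5 = A.card * A.card ^ 4 := by ring
    _ ≤ 2 * G.card * A.card ^ 4 := by gcongr
    _ = 2 * (G.card * A.card ^ 4) := by ring
    _ ≤ 2 * (64 * (Q A).card ^ 2 * ∑ c ∈ G, (L A a c ×ˢ L A b c).card) := by gcongr
    _ = 128 * (Q A).card ^ 2 * ∑ c ∈ G, (L A a c ×ˢ L A b c).card := by ring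
    _ ≤ _ := Nat.mul_le_mul_left _ hinj

lemma diff_count (A : Finset F) (hA : A.Nonempty) :
    ((Good A ×ˢ Good A).image fun x => x.1 - x.2).card * A.card ^ 5 ≤
      128 * (Q A).card ^ 2 * (S A).card ^ 4 := by
  set D := (Good A ×ˢ Good A).image fun x => x.1 - x.2 with hD
  set T := S A ×ˢ S A ×ˢ S A ×ˢ S A with hT
  have hTc : T.card = (S A).card ^ 4 := by
    simp only [hT, Finset.card_product]; ring
  have h1 : ∑ d ∈ D, (T.filter fun s => s.1 - s.2.1 + (s.2.2.1 - s.2.2.2) = d).card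
      ≤ T.card := by
    rw [← Finset.card_biUnion]
    · exact Finset.card_le_card (Finset.biUnion_subset.2 fun _ _ => Finset.filter_subset _ _)
    · intro x _ y _ hxy
      apply Finset.disjoint_left.2
      intro s hs hs'
      exact hxy ((Finset.mem_filter.1 hs).2.symm.trans (Finset.mem_filter.1 hs').2)
  calc D.card * A.card ^ 5 ≤ ∑ d ∈ D, 128 * (Q A).card ^ 2 *
        (T.filter fun s => s.1 - s.2.1 + (s.2.2.1 - s.2.2.2) = d).card := by
        rw [← smul_eq_mul]
        apply Finset.card_nsmul_le_sum
        intro d hd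
        obtain ⟨⟨a, b⟩, hab, rfl⟩ := Finset.mem_image.1 hd
        rw [Finset.mem_product] at hab
        exact rep_count A hA a b hab.1 hab.2
    _ ≤ _ := by
        rw [← Finset.mul_sum, ← hTc]
        gcongr

lemma main (A : Finset F) (hA : A.Nonempty) (h0 : (0 : F) ∉ A) :
    ((Good A ×ˢ Good A).image fun x => x.1 - x.2).card * A.card ^ 7 ≤
      512 * (S A).card ^ 8 := by
  have hd := diff_count A hA
  set d := ((Good A ×ˢ Good A).image fun x => x.1 - x.2).card with hdd
  have hSp : 0 < (S A).card := Finset.card_pos.2 ((hA.product hA).image _)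
  have hr := ruzsa A h0
  have hN := hA.card_pos
  by_cases h1 : A.card = 1
  · have hle : d ≤ 1 := by
      have hA' : (Good A).card ≤ 1 := h1 ▸ Finset.card_le_card (Finset.filter_subset _ _)
      calc d ≤ (Good A ×ˢ Good A).card := Finset.card_image_le
        _ = (Good A).card * (Good A).card := Finset.card_product _ _
        _ ≤ 1 * 1 := Nat.mul_le_mul hA' hA'
        _ = 1 := rfl
    rw [h1]
    have := Nat.one_le_pow 8 _ hSp
    omega
  · have h2 : A.card ≤ 2 * (A.card - 1) := by omega
    have h3 : (Q A).card * A.card ≤ 2 * (S A).card ^ 2 := by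
      calc (Q A).card * A.card ≤ (Q A).card * (2 * (A.card - 1)) := by gcongr
        _ = 2 * ((Q A).card * (A.card - 1)) := by ring
        _ ≤ _ := by gcongr
    calc d * A.card ^ 7 = (d * A.card ^ 5) * A.card ^ 2 := by ring
      _ ≤ (128 * (Q A).card ^ 2 * (S A).card ^ 4) * A.card ^ 2 := by gcongr
      _ = 128 * (S A).card ^ 4 * ((Q A).card * A.card) ^ 2 := by ring
      _ ≤ 128 * (S A).card ^ 4 * (2 * (S A).card ^ 2) ^ 2 := by gcongr
      _ = _ := by ring

end AAone

theorem stmt8 :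
    ∃ c C : ℝ, 0 < c ∧ 0 < C ∧
      ∀ p : ℕ, p.Prime →
        ∀ A : Finset (ZMod p), A.Nonempty → (0 : ZMod p) ∉ A →
          ∃ A' ⊆ A, c * (A.card : ℝ) ≤ (A'.card : ℝ) ∧
            (((A' ×ˢ A').image fun x => x.1 - x.2).card : ℝ) ≤
              C * (((A ×ˢ A).image fun x => x.1 * (x.2 + 1)).card : ℝ) ^ 8 /
                (A.card : ℝ) ^ 7 := by
  refine ⟨1 / 2, 512, by norm_num, by norm_num, ?_⟩
  intro p hp A hA h0
  haveI : Fact p.Prime := ⟨hp⟩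
  refine ⟨AAone.Good A, Finset.filter_subset _ _, ?_, ?_⟩
  · have := AAone.card_A' A hA h0
    have h : (A.card : ℝ) ≤ 2 * (AAone.Good A).card := by exact_mod_cast this
    linarith
  · have hN : (0 : ℝ) < A.card := by exact_mod_cast hA.card_pos
    rw [le_div_iff₀ (by positivity)]
    have := AAone.main A hA h0
    unfold AAone.S at this
    exact_mod_cast this
end
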